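/- Let 1 < a ≤ b ≤ c ≤ ab and let (H,z), with H = (H_A,H_B,H_C) traceless, be a non-trivial facet normal of C(a,b,c). Then (H_A,H_B,H_C) ≠ 0, and each of the three pairs (H_A,H_B), (H_A,H_C), (H_B,H_C) is either zero or satisfies the extremal-edge condition (for the appropriate pair of dimensions). -/

import Mathlib

open scoped BigOperators

noncomputable section

/-- The reduced density matrix on the first subsystem. -/
def rhoA {a b c : ℕ} (ψ : Fin a × Fin b × Fin c → ℂ) : Matrix (Fin a) (Fin a) ℂ :=
  Matrix.of fun i i' => ∑ j : Fin b, ∑ k : Fin c, ψ (i, j, k) * (starRingEnd ℂ) (ψ (i', j, k))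

/-- The reduced density matrix on the second subsystem. -/
def rhoB {a b c : ℕ} (ψ : Fin a × Fin b × Fin c → ℂ) : Matrix (Fin b) (Fin b) ℂ :=
  Matrix.of fun j j' => ∑ i : Fin a, ∑ k : Fin c, ψ (i, j, k) * (starRingEnd ℂ) (ψ (i, j', k))

/-- The reduced density matrix on the third subsystem. -/
def rhoC {a b c : ℕ} (ψ : Fin a × Fin b × Fin c → ℂ) : Matrix (Fin c) (Fin c) ℂ :=
  Matrix.of fun k k' => ∑ i : Fin a, ∑ j : Fin b, ψ (i, j, k) * (starRingEnd ℂ) (ψ (i, j, k'))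

/-- `lam` is the vector of eigenvalues of `ρ`, listed in nonincreasing order
with multiplicity. -/
def IsSpecDown {n : ℕ} (ρ : Matrix (Fin n) (Fin n) ℂ) (lam : Fin n → ℝ) : Prop :=
  Antitone lam ∧ ∃ (hρ : ρ.IsHermitian) (σ : Equiv.Perm (Fin n)), lam = hρ.eigenvalues ∘ σ

/-- The Kronecker cone `C(a,b,c)`. -/
def KronCone (a b c : ℕ) : Set ((Fin a → ℝ) × (Fin b → ℝ) × (Fin c → ℝ)) :=
  { lam | ∃ ψ : Fin a × Fin b × Fin c → ℂ,
      IsSpecDown (rhoA ψ) lam.1 ∧ IsSpecDown (rhoB ψ) lam.2.1 ∧ IsSpecDown (rhoC ψ) lam.2.2 }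

/-- The pairing `⟨(H,z), λ⟩`. -/
def wtPair {a b c : ℕ} (HA : Fin a → ℝ) (HB : Fin b → ℝ) (HC : Fin c → ℝ) (z : ℝ)
    (lam : (Fin a → ℝ) × (Fin b → ℝ) × (Fin c → ℝ)) : ℝ :=
  (∑ i, HA i * lam.1 i) + (∑ j, HB j * lam.2.1 j) + (∑ k, HC k * lam.2.2 k)
    + z * ∑ i, lam.1 i

/-- `H = (H_A, H_B, H_C)` is traceless. -/
def Traceless {a b c : ℕ} (HA : Fin a → ℝ) (HB : Fin b → ℝ) (HC : Fin c → ℝ) : Prop :=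
  (∑ i, HA i) = 0 ∧ (∑ j, HB j) = 0 ∧ (∑ k, HC k) = 0

/-- `(H, z)` is a facet normal of the Kronecker cone `C(a,b,c)`. -/
def IsFacetNormal (a b c : ℕ) (HA : Fin a → ℝ) (HB : Fin b → ℝ) (HC : Fin c → ℝ)
    (z : ℝ) : Prop :=
  Traceless HA HB HC ∧ ¬(HA = 0 ∧ HB = 0 ∧ HC = 0 ∧ z = 0) ∧
  (∀ lam ∈ KronCone a b c, 0 ≤ wtPair HA HB HC z lam) ∧
  Module.finrank ℝ
    (affineSpan ℝ {lam ∈ KronCone a b c | wtPair HA HB HC z lam = 0}).direction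
    = a + b + c - 3

/-- `(H, z)` is a trivial (Weyl chamber) normal. -/
def IsTrivialNormal {a b c : ℕ} (HA : Fin a → ℝ) (HB : Fin b → ℝ) (HC : Fin c → ℝ)
    (z : ℝ) : Prop :=
  ∃ t : ℝ, 0 < t ∧
    ((∃ i i' : Fin a, i < i' ∧ HA = t • (Pi.single i 1 - Pi.single i' 1) ∧
        HB = 0 ∧ HC = 0 ∧ z = 0) ∨
     (∃ j j' : Fin b, j < j' ∧ HB = t • (Pi.single j 1 - Pi.single j' 1) ∧
        HA = 0 ∧ HC = 0 ∧ z = 0) ∨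
     (∃ k k' : Fin c, k < k' ∧ HC = t • (Pi.single k 1 - Pi.single k' 1) ∧
        HA = 0 ∧ HB = 0 ∧ z = 0))

/-- The subspace of vectors supported on coordinates satisfying `P`. -/
def suppSubmodule {ι : Type*} (P : ι → Prop) : Submodule ℂ (ι → ℂ) where
  carrier := {ψ | ∀ p, ¬ P p → ψ p = 0}
  add_mem' := by
    intro x y hx hy p hp
    simp only [Pi.add_apply, hx p hp, hy p hp, add_zero]
  zero_mem' := by intro p _; rfl
  smul_mem' := by
    intro r x hx p hp
    simp only [Pi.smul_apply, hx p hp, smul_zero]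

/-- The zero-weight space `ℋ₀(H,z)`. -/
def weight0Space {a b c : ℕ} (HA : Fin a → ℝ) (HB : Fin b → ℝ) (HC : Fin c → ℝ)
    (z : ℝ) : Submodule ℂ (Fin a × Fin b × Fin c → ℂ) :=
  suppSubmodule fun p => HA p.1 + HB p.2.1 + HC p.2.2 + z = 0

/-- The negative-weight space `ℋ₋(H,z)`. -/
def weightNegSpace {a b c : ℕ} (HA : Fin a → ℝ) (HB : Fin b → ℝ) (HC : Fin c → ℝ)
    (z : ℝ) : Submodule ℂ (Fin a × Fin b × Fin c → ℂ) :=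
  suppSubmodule fun p => HA p.1 + HB p.2.1 + HC p.2.2 + z < 0

/-- Strictly lower triangular matrices `X` with `X i' i = 0` unless
`i < i'` and `Hv i' < Hv i`. -/
def lowerMod {d : ℕ} (Hv : Fin d → ℝ) : Submodule ℂ (Matrix (Fin d) (Fin d) ℂ) where
  carrier := {X | ∀ i' i, ¬ (i < i' ∧ Hv i' < Hv i) → X i' i = 0}
  add_mem' := by
    intro X Y hX hY i' i h
    simp only [Matrix.add_apply, hX i' i h, hY i' i h, add_zero]
  zero_mem' := by intro i' i h; rfl
  smul_mem' := by
    intro r X hX i' i h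
    simp only [Matrix.smul_apply, hX i' i h, smul_zero]

/-- The nilpotent algebra `𝔫₋(H)`. -/
def nMinusMod {a b c : ℕ} (HA : Fin a → ℝ) (HB : Fin b → ℝ) (HC : Fin c → ℝ) :
    Submodule ℂ (Matrix (Fin a) (Fin a) ℂ × Matrix (Fin b) (Fin b) ℂ ×
      Matrix (Fin c) (Fin c) ℂ) :=
  (lowerMod HA).prod ((lowerMod HB).prod (lowerMod HC))

/-- The infinitesimal action `(X,Y,Z) ↦ (X⊗I⊗I + I⊗Y⊗I + I⊗I⊗Z)ψ`. -/
def act {a b c : ℕ}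
    (t : Matrix (Fin a) (Fin a) ℂ × Matrix (Fin b) (Fin b) ℂ × Matrix (Fin c) (Fin c) ℂ)
    (ψ : Fin a × Fin b × Fin c → ℂ) : Fin a × Fin b × Fin c → ℂ := fun p =>
  (∑ i', t.1 p.1 i' * ψ (i', p.2.1, p.2.2)) +
  (∑ j', t.2.1 p.2.1 j' * ψ (p.1, j', p.2.2)) +
  (∑ k', t.2.2 p.2.2 k' * ψ (p.1, p.2.1, k'))

/-- The action as a linear map in `(X,Y,Z)`. -/
def actL {a b c : ℕ} (ψ : Fin a × Fin b × Fin c → ℂ) :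
    (Matrix (Fin a) (Fin a) ℂ × Matrix (Fin b) (Fin b) ℂ × Matrix (Fin c) (Fin c) ℂ)
      →ₗ[ℂ] (Fin a × Fin b × Fin c → ℂ) where
  toFun t := act t ψ
  map_add' t s := by
    funext p
    simp only [act, Prod.fst_add, Prod.snd_add, Matrix.add_apply, add_mul,
      Finset.sum_add_distrib, Pi.add_apply]
    ring
  map_smul' r t := by
    funext p
    simp only [act, Prod.smul_fst, Prod.smul_snd, Matrix.smul_apply, smul_eq_mul,
      Pi.smul_apply, RingHom.id_apply, Finset.mul_sum, mul_assoc, mul_add]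

/-- The tangent map `T_ψ : 𝔫₋(H) → ℋ₋(H,z)` is a linear isomorphism. -/
def TangentIso {a b c : ℕ} (HA : Fin a → ℝ) (HB : Fin b → ℝ) (HC : Fin c → ℝ)
    (z : ℝ) (ψ : Fin a × Fin b × Fin c → ℂ) : Prop :=
  ∃ h : ∀ t ∈ nMinusMod HA HB HC, actL ψ t ∈ weightNegSpace HA HB HC z,
    Function.Bijective ((actL ψ).restrict h)

/-- The tangent map `T_ψ : 𝔫₋(H) → ℋ₋(H,z)` is surjective. -/
def TangentSurj {a b c : ℕ} (HA : Fin a → ℝ) (HB : Fin b → ℝ) (HC : Fin c → ℝ)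
    (z : ℝ) (ψ : Fin a × Fin b × Fin c → ℂ) : Prop :=
  ∃ h : ∀ t ∈ nMinusMod HA HB HC, actL ψ t ∈ weightNegSpace HA HB HC z,
    Function.Surjective ((actL ψ).restrict h)

/-- `(H,z)` is admissible: the hyperplane `⟨(H,z), ·⟩ = 0` in `V` is spanned by
the weights of zero `(H,z)`-weight. -/
def Admissible {a b c : ℕ} (HA : Fin a → ℝ) (HB : Fin b → ℝ) (HC : Fin c → ℝ)
    (z : ℝ) : Prop :=
  (Submodule.span ℝ
    { w : (Fin a → ℝ) × (Fin b → ℝ) × (Fin c → ℝ) |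
      ∃ i j k, HA i + HB j + HC k + z = 0 ∧
        w = (Pi.single i 1, Pi.single j 1, Pi.single k 1) } : Set _)
  = { lam | (∑ i, lam.1 i) = (∑ j, lam.2.1 j) ∧ (∑ i, lam.1 i) = (∑ k, lam.2.2 k) ∧
        wtPair HA HB HC z lam = 0 }

/-- `(H,z)` is a Ressayre element. -/
def IsRessayre {a b c : ℕ} (HA : Fin a → ℝ) (HB : Fin b → ℝ) (HC : Fin c → ℝ)
    (z : ℝ) : Prop :=
  Traceless HA HB HC ∧ ¬(HA = 0 ∧ HB = 0 ∧ HC = 0 ∧ z = 0) ∧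
  Admissible HA HB HC z ∧
  ∃ ψ ∈ weight0Space HA HB HC z, TangentIso HA HB HC z ψ

/-- `(H_A, H_B)` satisfies the extremal-edge condition. -/
def ExtremalEdge {a b : ℕ} (HA : Fin a → ℝ) (HB : Fin b → ℝ) : Prop :=
  (∑ i, HA i) = 0 ∧ (∑ j, HB j) = 0 ∧ ¬(HA = 0 ∧ HB = 0) ∧
  ∀ (x : Fin a → ℝ) (y : Fin b → ℝ), (∑ i, x i) = 0 → (∑ j, y j) = 0 →
    (∀ i j k l, HA i + HB j = HA k + HB l → x i + y j = x k + y l) →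
    ∃ t : ℝ, x = t • HA ∧ y = t • HB

set_option linter.unusedSectionVars false

open Polynomial in
lemma finite_or_finite_compl_of_isConstructible {T : Set (PrimeSpectrum ℂ[X])}
    (hT : Topology.IsConstructible T) (P : ℂ → PrimeSpectrum ℂ[X])
    (hP : ∀ s, (P s).asIdeal = RingHom.ker (evalRingHom s)) :
    {s | P s ∈ T}.Finite ∨ {s | P s ∈ T}ᶜ.Finite := by
  have mem_zero (s : ℂ) (Q : Set ℂ[X]) :
      P s ∈ PrimeSpectrum.zeroLocus Q ↔ ∀ q ∈ Q, q.eval s = 0 := by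
    rw [PrimeSpectrum.mem_zeroLocus, hP]
    exact Iff.rfl
  have fin_zero (q : ℂ[X]) (hq : q ≠ 0) : {s | q.eval s = 0}.Finite :=
    q.roots.toFinset.finite_toSet.subset fun s hs => by simp [hq]; exact hs
  obtain ⟨D, rfl⟩ := PrimeSpectrum.exists_constructibleSetData_iff.mpr hT
  unfold PrimeSpectrum.ConstructibleSetData.toSet
  by_cases h : ∃ C ∈ D, C.f ≠ 0 ∧ ∀ i, C.g i = 0
  · obtain ⟨C, hC, hf, hg⟩ := h
    right
    refine (fin_zero _ hf).subset fun s hs => ?_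
    by_contra hne
    refine hs (Set.mem_biUnion hC ⟨?_, ?_⟩)
    · rw [mem_zero]
      rintro _ ⟨i, rfl⟩
      simp [hg]
    · rw [mem_zero]
      simpa using hne
  · left
    push Not at h
    have : {s | P s ∈ ⋃ C ∈ D, C.toSet} = ⋃ C ∈ D, {s | P s ∈ C.toSet} := by
      ext s; simp
    rw [this]
    refine D.finite_toSet.biUnion fun C hC => ?_
    by_cases hf : C.f = 0
    · convert Set.finite_empty
      ext s
      simp only [Set.mem_ofPred_eq, Set.mem_empty_iff_false, iff_false]
      rintro ⟨-, h2⟩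
      rw [mem_zero] at h2
      simp [hf] at h2
    · obtain ⟨i, hi⟩ := h C hC hf
      refine (fin_zero _ hi).subset fun s hs => ?_
      exact (mem_zero s _).1 hs.1 _ ⟨i, rfl⟩

open Polynomial in
lemma finite_or_finite_compl_range_comap (A : Type) [CommRing A] [Algebra ℂ[X] A]
    (hfp : Algebra.FinitePresentation ℂ[X] A) (P : ℂ → PrimeSpectrum ℂ[X])
    (hP : ∀ s, (P s).asIdeal = RingHom.ker (evalRingHom s)) :
    {s | P s ∈ Set.range (PrimeSpectrum.comap (algebraMap ℂ[X] A))}.Finite ∨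
    {s | P s ∈ Set.range (PrimeSpectrum.comap (algebraMap ℂ[X] A))}ᶜ.Finite :=
  finite_or_finite_compl_of_isConstructible (PrimeSpectrum.isConstructible_range_comap
    ((RingHom.finitePresentation_algebraMap (A := ℂ[X]) (B := A)).mpr hfp)) P hP

open Polynomial in
lemma mem_range_comap_of_solution {J A : Type} [CommRing A] [Algebra ℂ[X] A]
    (π : MvPolynomial J ℂ[X] →ₐ[ℂ[X]] A) (hπ : Function.Surjective π)
    (S : Set (MvPolynomial J ℂ[X])) (hS : RingHom.ker π = Ideal.span S) (s : ℂ)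
    (P : PrimeSpectrum ℂ[X]) (hP : P.asIdeal = RingHom.ker (evalRingHom s)) (x : J → ℂ)
    (hx : ∀ p ∈ S, MvPolynomial.eval₂ (evalRingHom s) x p = 0) :
    P ∈ Set.range (PrimeSpectrum.comap (algebraMap ℂ[X] A)) := by
  have hle : RingHom.ker π ≤ RingHom.ker (MvPolynomial.eval₂Hom (evalRingHom s) x) :=
    hS ▸ Ideal.span_le.2 fun p hp => hx p hp
  let ev : A →+* ℂ := (π : MvPolynomial J ℂ[X] →+* A).liftOfRightInverse _
    (Function.rightInverse_surjInv hπ) ⟨MvPolynomial.eval₂Hom (evalRingHom s) x, hle⟩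
  refine ⟨⟨RingHom.ker ev, RingHom.ker_isPrime _⟩, PrimeSpectrum.ext (Ideal.ext fun q => ?_)⟩
  have : ev (algebraMap ℂ[X] A q) = q.eval s := by
    rw [← π.commutes]
    have := (π : MvPolynomial J ℂ[X] →+* A).liftOfRightInverse_comp_apply _
      (Function.rightInverse_surjInv hπ)
      ⟨MvPolynomial.eval₂Hom (evalRingHom s) x, hle⟩ (MvPolynomial.C q)
    exact this.trans (by simp)
  rw [hP]
  change ev (algebraMap ℂ[X] A q) = 0 ↔ q.eval s = 0
  rw [this]

open Polynomial in
lemma exists_solution_of_mem_range_comap {J A : Type} [Finite J] [CommRing A] [Algebra ℂ[X] A]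
    (π : MvPolynomial J ℂ[X] →ₐ[ℂ[X]] A) (hπ : Function.Surjective π)
    (S : Set (MvPolynomial J ℂ[X])) (hS : RingHom.ker π = Ideal.span S) (s : ℂ)
    (P : PrimeSpectrum ℂ[X]) (hP : P.asIdeal = RingHom.ker (evalRingHom s))
    (hQ : P ∈ Set.range (PrimeSpectrum.comap (algebraMap ℂ[X] A))) :
    ∃ x : J → ℂ, ∀ p ∈ S, MvPolynomial.eval₂ (evalRingHom s) x p = 0 := by
  obtain ⟨Q, hQ⟩ := hQ
  obtain ⟨m, hm, hle⟩ := Ideal.exists_le_maximal Q.asIdeal Q.2.ne_top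
  let _ : Field (A ⧸ m) := Ideal.Quotient.field m
  let _ : Algebra ℂ A := Algebra.compHom A (algebraMap ℂ ℂ[X])
  have : IsScalarTower ℂ ℂ[X] A := IsScalarTower.of_algebraMap_eq fun _ => rfl
  let φ : MvPolynomial J ℂ[X] →ₐ[ℂ] (A ⧸ m) := (Ideal.Quotient.mkₐ ℂ m).comp (π.restrictScalars ℂ)
  have hφ : Function.Surjective φ := (Ideal.Quotient.mkₐ_surjective ℂ m).comp hπ
  have hφC (q : ℂ[X]) (hq : q.eval s = 0) : φ (MvPolynomial.C q) = 0 := by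
    have h1 : q ∈ (PrimeSpectrum.comap (algebraMap ℂ[X] A) Q).asIdeal := by
      rw [hQ, hP]; exact hq
    have h2 : π (MvPolynomial.C q) = algebraMap ℂ[X] A q := π.commutes q
    exact Ideal.Quotient.eq_zero_iff_mem.2 (h2 ▸ hle h1)
  have hft : Algebra.FiniteType ℂ (A ⧸ m) := by
    have h1 : Algebra.FiniteType ℂ (MvPolynomial J ℂ[X]) :=
      Algebra.FiniteType.trans (S := ℂ[X]) (inferInstance : Algebra.FiniteType ℂ ℂ[X])
        (inferInstance : Algebra.FiniteType ℂ[X] (MvPolynomial J ℂ[X]))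
    exact h1.of_surjective φ hφ
  have hfin : Module.Finite ℂ (A ⧸ m) := finite_of_finite_type_of_isJacobsonRing ℂ (A ⧸ m)
  have hbij := IsAlgClosed.algebraMap_bijective_of_isIntegral (k := ℂ) (K := A ⧸ m)
  choose x hx using fun j => hbij.2 (φ (MvPolynomial.X j))
  refine ⟨x, fun p hp => ?_⟩
  apply hbij.1
  rw [map_zero]
  have hh : (algebraMap ℂ (A ⧸ m)).comp (MvPolynomial.eval₂Hom (evalRingHom s) x) =
      (φ : MvPolynomial J ℂ[X] →+* A ⧸ m) := by
    apply MvPolynomial.ringHom_ext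
    · intro q
      have h2 := hφC (q - C (q.eval s)) (by simp)
      rw [map_sub, map_sub, sub_eq_zero] at h2
      have h3 : φ (MvPolynomial.C (C (q.eval s))) = algebraMap ℂ (A ⧸ m) (q.eval s) :=
        φ.commutes (q.eval s)
      simp only [RingHom.comp_apply, MvPolynomial.coe_eval₂Hom, MvPolynomial.eval₂_C,
        coe_evalRingHom, RingHom.coe_coe]
      rw [h2, h3]
    · intro j
      simp [hx]
  change ((algebraMap ℂ (A ⧸ m)).comp (MvPolynomial.eval₂Hom (evalRingHom s) x)) p = 0
  rw [hh]
  have h4 : π p = 0 := by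
    have : p ∈ RingHom.ker π := hS ▸ Ideal.subset_span hp
    exact this
  change Ideal.Quotient.mk m (π p) = 0
  rw [h4, map_zero]

open Polynomial in
lemma solvable_finite_or_cofinite_of_surjective {J A : Type} [Finite J] [CommRing A]
    [Algebra ℂ[X] A] (hfp : Algebra.FinitePresentation ℂ[X] A)
    (π : MvPolynomial J ℂ[X] →ₐ[ℂ[X]] A) (hπ : Function.Surjective π)
    (S : Set (MvPolynomial J ℂ[X])) (hS : RingHom.ker π = Ideal.span S) :
    {s : ℂ | ∃ x : J → ℂ, ∀ p ∈ S, MvPolynomial.eval₂ (evalRingHom s) x p = 0}.Finite ∨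
    {s : ℂ | ∃ x : J → ℂ, ∀ p ∈ S, MvPolynomial.eval₂ (evalRingHom s) x p = 0}ᶜ.Finite := by
  obtain ⟨P, hP⟩ : ∃ P : ℂ → PrimeSpectrum ℂ[X],
      ∀ s, (P s).asIdeal = RingHom.ker (evalRingHom s) :=
    ⟨fun s => ⟨RingHom.ker (evalRingHom s), RingHom.ker_isPrime _⟩, fun s => rfl⟩
  have h : {s : ℂ | ∃ x : J → ℂ, ∀ p ∈ S, MvPolynomial.eval₂ (evalRingHom s) x p = 0} =
      {s | P s ∈ Set.range (PrimeSpectrum.comap (algebraMap ℂ[X] A))} := by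
    ext s
    constructor
    · rintro ⟨x, hx⟩
      exact mem_range_comap_of_solution π hπ S hS s (P s) (hP s) x hx
    · exact exists_solution_of_mem_range_comap π hπ S hS s (P s) (hP s)
  rw [h]
  exact finite_or_finite_compl_range_comap A hfp P hP

open Polynomial in
/-- The parameters for which a polynomial system over `ℂ` is solvable form a finite or a cofinite
set. -/
theorem solvable_finite_or_cofinite {J : Type} [Finite J] (S : Set (MvPolynomial J ℂ[X])) :
    {s : ℂ | ∃ x : J → ℂ, ∀ p ∈ S, MvPolynomial.eval₂ (evalRingHom s) x p = 0}.Finite ∨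
    {s : ℂ | ∃ x : J → ℂ, ∀ p ∈ S, MvPolynomial.eval₂ (evalRingHom s) x p = 0}ᶜ.Finite := by
  have hker : RingHom.ker (Ideal.Quotient.mkₐ ℂ[X] (Ideal.span S)) = Ideal.span S :=
    Ideal.Quotient.mkₐ_ker ℂ[X] (Ideal.span S)
  exact solvable_finite_or_cofinite_of_surjective
    (A := MvPolynomial J ℂ[X] ⧸ Ideal.span S)
    (Algebra.FinitePresentation.quotient (IsNoetherian.noetherian (Ideal.span S)))
    (Ideal.Quotient.mkₐ ℂ[X] (Ideal.span S)) (Ideal.Quotient.mkₐ_surjective _ _) S hker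

section Tensor

variable {R : Type} [Fintype R] [DecidableEq R] {ι : R → Type} [∀ r, Fintype (ι r)]
  [∀ r, DecidableEq (ι r)]

/-- The action of a family of local matrices on a tensor. -/
def tens (g : ∀ r, Matrix (ι r) (ι r) ℂ) (ψ : (∀ r, ι r) → ℂ) : (∀ r, ι r) → ℂ :=
  fun w => ∑ x, (∏ r, g r (w r) (x r)) * ψ x

/-- The Hermitian inner product, conjugate-linear in the first variable. -/
def herm {X : Type} [Fintype X] (φ ψ : X → ℂ) : ℂ := ∑ w, (starRingEnd ℂ) (φ w) * ψ w

/-- The squared norm of a vector. -/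
def nsq {X : Type} [Fintype X] (ψ : X → ℂ) : ℝ := ∑ w, ‖ψ w‖ ^ 2

lemma herm_self {X : Type} [Fintype X] (ψ : X → ℂ) : herm ψ ψ = (nsq ψ : ℂ) := by
  simp only [herm, nsq, Complex.ofReal_sum]
  refine Finset.sum_congr rfl fun w _ => ?_
  rw [mul_comm, Complex.mul_conj, Complex.normSq_eq_norm_sq]

lemma nsq_nonneg {X : Type} [Fintype X] (ψ : X → ℂ) : 0 ≤ nsq ψ :=
  Finset.sum_nonneg fun _ _ => sq_nonneg _

lemma nsq_pos {X : Type} [Fintype X] {ψ : X → ℂ} (h : ψ ≠ 0) : 0 < nsq ψ := by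
  obtain ⟨w, hw⟩ := Function.ne_iff.1 h
  have h1 : 0 < ‖ψ w‖ ^ 2 := by have := norm_pos_iff.2 hw; positivity
  exact h1.trans_le (Finset.single_le_sum (f := fun w => ‖ψ w‖ ^ 2) (fun _ _ => sq_nonneg _)
    (Finset.mem_univ w))

lemma nsq_smul {X : Type} [Fintype X] (t : ℂ) (ψ : X → ℂ) : nsq (t • ψ) = ‖t‖ ^ 2 * nsq ψ := by
  simp [nsq, Finset.mul_sum, mul_pow]

lemma continuous_nsq {X : Type} [Fintype X] : Continuous (nsq : (X → ℂ) → ℝ) := by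
  unfold nsq; fun_prop

lemma tens_tens (g h : ∀ r, Matrix (ι r) (ι r) ℂ) (ψ : (∀ r, ι r) → ℂ) :
    tens g (tens h ψ) = tens (fun r => g r * h r) ψ := by
  funext w
  simp only [tens, Finset.mul_sum, Matrix.mul_apply]
  rw [Finset.sum_comm]
  refine Finset.sum_congr rfl fun v _ => ?_
  rw [Fintype.prod_sum, Finset.sum_mul]
  refine Finset.sum_congr rfl fun u _ => ?_
  rw [Finset.prod_mul_distrib, mul_assoc]

lemma tens_diagonal (a : ∀ r, ι r → ℂ) (ψ : (∀ r, ι r) → ℂ) (w : ∀ r, ι r) :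
    tens (fun r => Matrix.diagonal (a r)) ψ w = (∏ r, a r (w r)) * ψ w := by
  rw [tens, Finset.sum_eq_single w]
  · simp
  · intro v _ hv
    obtain ⟨r, hr⟩ := Function.ne_iff.1 hv
    rw [Finset.prod_eq_zero (f := fun r => Matrix.diagonal (a r) (w r) (v r)) (Finset.mem_univ r)
      (Matrix.diagonal_apply_ne (a r) hr.symm), zero_mul]
  · simp

lemma tens_one (ψ : (∀ r, ι r) → ℂ) : tens (fun r => (1 : Matrix (ι r) (ι r) ℂ)) ψ = ψ := by
  funext w
  have := tens_diagonal (fun r (_ : ι r) => (1 : ℂ)) ψ w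
  simpa using this

lemma tens_smul (g : ∀ r, Matrix (ι r) (ι r) ℂ) (t : ℂ) (ψ : (∀ r, ι r) → ℂ) :
    tens g (t • ψ) = t • tens g ψ := by
  funext w
  simp only [tens, Pi.smul_apply, smul_eq_mul, Finset.mul_sum]
  exact Finset.sum_congr rfl fun v _ => by ring

lemma herm_tens_left (g : ∀ r, Matrix (ι r) (ι r) ℂ) (φ ψ : (∀ r, ι r) → ℂ) :
    herm (tens g φ) ψ = herm φ (tens (fun r => (g r).conjTranspose) ψ) := by
  simp only [herm, tens, map_sum, map_mul, map_prod, Finset.sum_mul, Finset.mul_sum,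
    Matrix.conjTranspose_apply]
  rw [Finset.sum_comm]
  refine Finset.sum_congr rfl fun v _ => Finset.sum_congr rfl fun u _ => ?_
  simp only [starRingEnd_apply]
  ring

lemma nsq_tens_unitary (k : ∀ r, Matrix (ι r) (ι r) ℂ)
    (hk : ∀ r, (k r).conjTranspose * k r = 1) (ψ : (∀ r, ι r) → ℂ) :
    nsq (tens k ψ) = nsq ψ := by
  have : herm (tens k ψ) (tens k ψ) = herm ψ ψ := by
    rw [herm_tens_left, tens_tens]
    simp [hk, tens_one]
  rw [herm_self, herm_self] at this
  exact_mod_cast this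

lemma continuous_tens {Y : Type} [TopologicalSpace Y] (g : Y → ∀ r, Matrix (ι r) (ι r) ℂ)
    (ψ : Y → (∀ r, ι r) → ℂ) (hg : Continuous g) (hψ : Continuous ψ) :
    Continuous fun y => tens (g y) (ψ y) := by
  unfold tens
  refine continuous_pi fun w => continuous_finsetSum _ fun v _ => Continuous.mul ?_ ?_
  · refine continuous_finsetProd _ fun r _ => ?_
    exact ((continuous_apply r).comp hg).matrix_elem _ _
  · exact (continuous_apply v).comp hψ

/-- The action of a matrix on a single leg. -/
def leg (l : R) (M : Matrix (ι l) (ι l) ℂ) : ∀ r, Matrix (ι r) (ι r) ℂ :=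
  Function.update (fun _ => 1) l M

lemma tens_leg (l : R) (M : Matrix (ι l) (ι l) ℂ) (ψ : (∀ r, ι r) → ℂ) (w : ∀ r, ι r) :
    tens (leg l M) ψ w = ∑ j, M (w l) j * ψ (Function.update w l j) := by
  unfold tens
  rw [← Finset.sum_subset (Finset.subset_univ
    (Finset.univ.map ⟨Function.update w l, Function.update_injective w l⟩))]
  · rw [Finset.sum_map]
    refine Finset.sum_congr rfl fun j _ => ?_
    congr 1
    rw [Finset.prod_eq_single l]
    · simp [leg]
    · intro r _ hr
      simp [leg, hr]
    · simp
  · intro v _ hv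
    simp only [Finset.mem_map, Finset.mem_univ, Function.Embedding.coeFn_mk, true_and,
      not_exists] at hv
    have h1 : ∃ r, r ≠ l ∧ v r ≠ w r := by
      by_contra! hc
      refine hv (v l) ?_
      funext r
      by_cases hr : r = l
      · subst hr; simp
      · simp [hr, hc r hr]
    obtain ⟨r, hr, hvr⟩ := h1
    rw [Finset.prod_eq_zero (Finset.mem_univ r), zero_mul]
    simp [leg, hr, Matrix.one_apply_ne hvr.symm]

/-- The marginal (reduced density matrix) of a tensor on one leg. -/
def marg (l : R) (ψ : (∀ r, ι r) → ℂ) : Matrix (ι l) (ι l) ℂ :=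
  Matrix.of fun i j => ∑ w, if w l = i then ψ w * (starRingEnd ℂ) (ψ (Function.update w l j)) else 0

lemma trace_marg_mul (l : R) (ψ : (∀ r, ι r) → ℂ) (M : Matrix (ι l) (ι l) ℂ) :
    (marg l ψ * M).trace = herm ψ (tens (leg l M) ψ) := by
  have h1 : herm ψ (tens (leg l M) ψ) = herm (tens (leg l M.conjTranspose) ψ) ψ := by
    rw [herm_tens_left]
    congr 2
    funext r
    by_cases hr : r = l
    · subst hr; simp [leg]
    · simp [leg, hr]
  rw [h1]
  simp only [herm, tens_leg, Matrix.trace, Matrix.diag, Matrix.mul_apply, marg, Matrix.of_apply,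
    map_sum, map_mul, Finset.sum_mul]
  rw [Finset.sum_comm]
  simp only [ite_mul, zero_mul]
  have : ∀ j : ι l, ∑ i : ι l, ∑ w : ∀ r, ι r, (if w l = i then
      ψ w * (starRingEnd ℂ) (ψ (Function.update w l j)) * M j i else 0) =
      ∑ w : ∀ r, ι r, ψ w * (starRingEnd ℂ) (ψ (Function.update w l j)) * M j (w l) := by
    intro j
    rw [Finset.sum_comm]
    simp
  simp only [this]
  rw [Finset.sum_comm]
  refine Finset.sum_congr rfl fun w _ => Finset.sum_congr rfl fun j _ => ?_
  simp [Matrix.conjTranspose_apply]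
  ring

lemma marg_tens (l : R) (k : ∀ r, Matrix (ι r) (ι r) ℂ)
    (hk : ∀ r, (k r).conjTranspose * k r = 1) (ψ : (∀ r, ι r) → ℂ) :
    marg l (tens k ψ) = k l * marg l ψ * (k l).conjTranspose := by
  rw [Matrix.ext_iff_trace_mul_right]
  intro M
  rw [trace_marg_mul, tens_tens, herm_tens_left, tens_tens]
  have : (fun r => (k r).conjTranspose * (leg l M r * k r)) =
      leg l ((k l).conjTranspose * M * k l) := by
    funext r
    by_cases hr : r = l
    · subst hr; simp [leg, Matrix.mul_assoc]
    · simp [leg, hr, hk]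
  rw [this, ← trace_marg_mul]
  rw [show k l * marg l ψ * (k l).conjTranspose * M =
    k l * (marg l ψ * ((k l).conjTranspose * M)) by simp only [Matrix.mul_assoc],
    Matrix.trace_mul_comm (k l)]
  simp only [Matrix.mul_assoc]

/-- Leg marginals of an unitarily transformed tensor, on the diagonal. -/
lemma marg_apply_self (l : R) (ψ : (∀ r, ι r) → ℂ) (i : ι l) :
    marg l ψ i i = ((∑ w, if w l = i then ‖ψ w‖ ^ 2 else 0 : ℝ) : ℂ) := by
  simp only [marg, Matrix.of_apply, Complex.ofReal_sum]
  refine Finset.sum_congr rfl fun w _ => ?_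
  split_ifs with h
  · subst h
    rw [Function.update_eq_self, Complex.mul_conj, Complex.normSq_eq_norm_sq]
  · simp

lemma marg_isHermitian (l : R) (ψ : (∀ r, ι r) → ℂ) : (marg l ψ).IsHermitian := by
  rw [Matrix.IsHermitian, Matrix.ext_iff_trace_mul_right]
  intro M
  have := congrArg (starRingEnd ℂ) (trace_marg_mul l ψ M.conjTranspose)
  have h2 : (starRingEnd ℂ) (marg l ψ * M.conjTranspose).trace =
      ((marg l ψ).conjTranspose * M).trace := by
    rw [starRingEnd_apply, ← Matrix.trace_conjTranspose, Matrix.conjTranspose_mul,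
      Matrix.conjTranspose_conjTranspose, Matrix.trace_mul_comm]
  rw [← h2, this, trace_marg_mul]
  have h3 : ∀ φ χ : (∀ r, ι r) → ℂ, (starRingEnd ℂ) (herm φ χ) = herm χ φ := by
    intro φ χ; simp [herm, map_sum, mul_comm]
  rw [h3, herm_tens_left]
  congr 2
  funext r
  by_cases hr : r = l
  · subst hr; simp [leg]
  · simp [leg, hr]

end Tensor

section Potential

variable {S : Type} [Fintype S] {X : S → Type} [∀ s, Fintype (X s)] {E : Type} [Fintype E]

/-- A family of probability vectors whose weighted barycentre is the origin. -/
structure IsBalancing (c : S → ℝ) (wt : ∀ s, X s → E → ℝ) (η : ∀ s, X s → ℝ) : Prop where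
  nonneg : ∀ s x, 0 ≤ η s x
  sum_eq : ∀ s, ∑ x, η s x = 1
  bary : ∀ e, ∑ s, c s * ∑ x, η s x * wt s x e = 0

/-- The weights in the family of sets `T` admit a balanced combination. -/
def HasBalance (c : S → ℝ) (wt : ∀ s, X s → E → ℝ) (T : ∀ s, Set (X s)) : Prop :=
  ∃ η, IsBalancing c wt η ∧ ∀ s x, x ∉ T s → η s x = 0

/-- The Kempf–Ness potential along a torus orbit. -/
def pot (c : S → ℝ) (wt : ∀ s, X s → E → ℝ) (v : ∀ s, X s → ℂ) (u : E → ℝ) : ℝ :=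
  ∏ s, (∑ x, Real.exp (∑ e, u e * wt s x e) * ‖v s x‖ ^ 2) ^ c s

lemma HasBalance.mono {c : S → ℝ} {wt : ∀ s, X s → E → ℝ} {T T' : ∀ s, Set (X s)}
    (h : HasBalance c wt T) (hT : ∀ s, T s ⊆ T' s) : HasBalance c wt T' := by
  obtain ⟨η, h1, h2⟩ := h
  exact ⟨η, h1, fun s x hx => h2 s x fun h => hx (hT s h)⟩

lemma IsBalancing.le_pot {c : S → ℝ} (hc : ∀ s, 0 ≤ c s) {wt : ∀ s, X s → E → ℝ}
    {η : ∀ s, X s → ℝ} (h : IsBalancing c wt η) (v : ∀ s, X s → ℂ) (u : E → ℝ) :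
    ∏ s, ∏ x, (‖v s x‖ ^ 2) ^ (c s * η s x) ≤ pot c wt v u := by
  have h1 : ∏ s, ∏ x, (‖v s x‖ ^ 2) ^ (c s * η s x) =
      ∏ s, (∏ x, (Real.exp (∑ e, u e * wt s x e) * ‖v s x‖ ^ 2) ^ η s x) ^ c s := by
    have h2 : ∀ s, (∏ x, (Real.exp (∑ e, u e * wt s x e) * ‖v s x‖ ^ 2) ^ η s x) ^ c s =
        Real.exp (c s * ∑ x, η s x * ∑ e, u e * wt s x e) *
          ∏ x, (‖v s x‖ ^ 2) ^ (c s * η s x) := by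
      intro s
      rw [← Real.finsetProd_rpow _ _ (fun x _ => by positivity), Finset.mul_sum, Real.exp_sum,
        ← Finset.prod_mul_distrib]
      refine Finset.prod_congr rfl fun x _ => ?_
      rw [← Real.rpow_mul (by positivity), Real.mul_rpow (Real.exp_pos _).le (by positivity),
        ← Real.exp_mul, mul_comm (η s x) (c s)]
      congr 2
      ring
    simp only [h2]
    rw [Finset.prod_mul_distrib, ← Real.exp_sum]
    have h3 : ∑ s, c s * ∑ x, η s x * ∑ e, u e * wt s x e = 0 := by
      have : ∑ s, c s * ∑ x, η s x * ∑ e, u e * wt s x e =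
          ∑ e, u e * ∑ s, c s * ∑ x, η s x * wt s x e := by
        simp only [Finset.mul_sum]
        have : ∀ s, ∑ x, ∑ e, c s * (η s x * (u e * wt s x e)) =
            ∑ e, ∑ x, c s * (η s x * (u e * wt s x e)) := fun s => Finset.sum_comm
        simp only [this]
        rw [Finset.sum_comm]
        refine Finset.sum_congr rfl fun e _ => Finset.sum_congr rfl fun s _ =>
          Finset.sum_congr rfl fun x _ => by ring
      rw [this]
      simp [h.bary]
    rw [h3, Real.exp_zero, one_mul]
  rw [h1, pot]
  refine Finset.prod_le_prod (fun s _ => by positivity) fun s _ => ?_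
  refine Real.rpow_le_rpow (Finset.prod_nonneg fun _ _ => by positivity) ?_ (hc s)
  refine (Real.geom_mean_le_arith_mean_weighted Finset.univ (η s) _ (fun x _ => h.nonneg s x)
    (h.sum_eq s) (fun x _ => by positivity)).trans ?_
  refine Finset.sum_le_sum fun x _ => mul_le_of_le_one_left (by positivity) ?_
  rw [← h.sum_eq s]
  exact Finset.single_le_sum (fun y _ => h.nonneg s y) (Finset.mem_univ x)

lemma exists_pos_le_pot {Y : Type} [TopologicalSpace Y] {K : Set Y} (hK : IsCompact K)
    {c : S → ℝ} (hc : ∀ s, 0 ≤ c s) (wt : ∀ s, X s → E → ℝ) (v : Y → ∀ s, X s → ℂ)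
    (hv : Continuous v) (hb : ∀ y ∈ K, HasBalance c wt fun s => {x | v y s x ≠ 0}) :
    ∃ ε > 0, ∀ y ∈ K, ∀ u, ε ≤ pot c wt (v y) u := by
  refine hK.induction_on (p := fun K => ∃ ε > 0, ∀ y ∈ K, ∀ u, ε ≤ pot c wt (v y) u)
    ⟨1, one_pos, by simp⟩ ?_ ?_ ?_
  · rintro s t hst ⟨ε, hε, h⟩
    exact ⟨ε, hε, fun y hy => h y (hst hy)⟩
  · rintro s t ⟨ε, hε, h⟩ ⟨ε', hε', h'⟩
    refine ⟨min ε ε', lt_min hε hε', ?_⟩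
    rintro y (hy | hy) u
    · exact (min_le_left _ _).trans (h y hy u)
    · exact (min_le_right _ _).trans (h' y hy u)
  · intro y hy
    obtain ⟨η, hη, hs⟩ := hb y hy
    let f : Y → ℝ := fun y => ∏ s, ∏ x, (‖v y s x‖ ^ 2) ^ (c s * η s x)
    have hf : Continuous f := by
      refine continuous_finsetProd _ fun s _ => continuous_finsetProd _ fun x _ => ?_
      refine Continuous.rpow_const (by fun_prop) fun _ => Or.inr ?_
      exact mul_nonneg (hc s) (hη.nonneg s x)
    have hpos : 0 < f y := by
      refine Finset.prod_pos fun s _ => Finset.prod_pos fun x _ => ?_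
      by_cases hx : v y s x = 0
      · rw [hs s x (by simpa using hx), mul_zero, Real.rpow_zero]
        exact one_pos
      · have := norm_pos_iff.2 hx
        positivity
    refine ⟨{z | f y / 2 < f z}, mem_nhdsWithin_of_mem_nhds
      ((isOpen_lt continuous_const hf).mem_nhds (half_lt_self hpos)), f y / 2, half_pos hpos, ?_⟩
    intro z hz u
    exact hz.le.trans (hη.le_pot hc _ u)

lemma eventually_balanced {Y Z : Type} [TopologicalSpace Y] [TopologicalSpace Z] {K : Set Y}
    (hK : IsCompact K) (c : S → ℝ) (wt : ∀ s, X s → E → ℝ) (v : Z × Y → ∀ s, X s → ℂ)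
    (hv : Continuous v) (z₀ : Z)
    (hb : ∀ y ∈ K, HasBalance c wt fun s => {x | v (z₀, y) s x ≠ 0}) :
    ∀ᶠ z in nhds z₀, ∀ y ∈ K, HasBalance c wt fun s => {x | v (z, y) s x ≠ 0} := by
  refine hK.eventually_forall_of_forall_eventually fun y hy => ?_
  have h1 : ∀ᶠ p in nhds (z₀, y), ∀ s x, v (z₀, y) s x ≠ 0 → v p s x ≠ 0 := by
    rw [Filter.eventually_all]; intro s
    rw [Filter.eventually_all]; intro x
    by_cases hx : v (z₀, y) s x = 0
    · simp [hx]
    · have hcx : Continuous fun p => v p s x := by fun_prop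
      filter_upwards [hcx.continuousAt.eventually_ne hx] with p hp _ using hp
  filter_upwards [h1] with p hp
  exact (hb y hy).mono fun s x hx => hp s x hx

lemma balanced_of_le_pot {c : S → ℝ} (hc : ∀ s, 0 ≤ c s) (wt : ∀ s, X s → E → ℝ)
    (v : ∀ s, X s → ℂ) (hv : ∀ s, v s ≠ 0) {ε : ℝ} (hε : 0 < ε)
    (h : ∀ u, ε ≤ pot c wt v u) : HasBalance c wt fun s => {x | v s x ≠ 0} := by
  classical
  let Λ : (∀ s, X s → ℝ) →ₗ[ℝ] (E → ℝ) :=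
    ∑ s, c s • ∑ x, ((LinearMap.proj x : (X s → ℝ) →ₗ[ℝ] ℝ) ∘ₗ
      (LinearMap.proj s : (∀ s, X s → ℝ) →ₗ[ℝ] (X s → ℝ))).smulRight (wt s x)
  have hΛ : ∀ η e, Λ η e = ∑ s, c s * ∑ x, η s x * wt s x e := by
    intro η e
    simp [Λ, LinearMap.sum_apply]
  let Q : Set (∀ s, X s → ℝ) :=
    Set.univ.pi fun s => stdSimplex ℝ (X s) ∩ {η | ∀ x, v s x = 0 → η x = 0}
  have hQc : IsCompact Q := by
    refine isCompact_univ_pi fun s => (isCompact_stdSimplex ℝ (X s)).inter_right ?_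
    simp only [Set.ofPred_forall]
    refine isClosed_iInter fun x => isClosed_iInter fun _ => ?_
    exact isClosed_eq (continuous_apply x) continuous_const
  have hQv : Convex ℝ Q := by
    refine convex_pi fun s _ => (convex_stdSimplex ℝ (X s)).inter ?_
    intro η hη ζ hζ a b _ _ _ x hx
    simp [hη x hx, hζ x hx]
  by_contra hnb
  have h0 : (0 : E → ℝ) ∉ Λ '' Q := by
    rintro ⟨η, hη, h0⟩
    refine hnb ⟨η, ⟨fun s x => (hη s trivial).1.1 x, fun s => (hη s trivial).1.2, fun e => ?_⟩,
      fun s x hx => (hη s trivial).2 x (by simpa using hx)⟩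
    rw [← hΛ, h0]; rfl
  obtain ⟨f, δ, hδ, hf⟩ := geometric_hahn_banach_point_closed (hQv.linear_image Λ)
    (hQc.image Λ.continuous_of_finiteDimensional).isClosed h0
  rw [map_zero] at hδ
  have hfe : ∀ p : E → ℝ, f p = ∑ e, f (Pi.single e 1) * p e := by
    intro p
    conv_lhs => rw [pi_eq_sum_univ' p]
    simp [map_sum, mul_comm]
  let u : E → ℝ := fun e => - f (Pi.single e 1)
  have hne : ∀ s, ((Finset.univ : Finset (X s)).filter fun x => v s x ≠ 0).Nonempty := by
    intro s
    obtain ⟨x, hx⟩ := Function.ne_iff.1 (hv s)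
    exact ⟨x, by simpa using hx⟩
  choose m hm hmax using fun s => Finset.exists_max_image _
    (fun x => ∑ e, u e * wt s x e) (hne s)
  have hsum : ∑ s, c s * ∑ e, u e * wt s (m s) e < -δ := by
    have hmem : (fun s => Pi.single (m s) (1 : ℝ)) ∈ Q := by
      intro s _
      refine ⟨single_mem_stdSimplex ℝ (m s), fun x hx => ?_⟩
      refine Pi.single_eq_of_ne (M := fun _ : X s => ℝ) ?_ 1
      rintro rfl
      exact (Finset.mem_filter.1 (hm s)).2 hx
    have := hf _ (Set.mem_image_of_mem Λ hmem)
    rw [hfe] at this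
    simp only [hΛ] at this
    have h2 : ∑ s, c s * ∑ e, u e * wt s (m s) e =
        -∑ e, f (Pi.single e 1) * ∑ s, c s * ∑ x,
          (Pi.single (m s) (1 : ℝ) : X s → ℝ) x * wt s x e := by
      simp only [Finset.mul_sum, Pi.single_apply, ite_mul, one_mul, zero_mul,
        Finset.sum_ite_eq', Finset.mem_univ, if_true, u]
      rw [Finset.sum_comm, ← Finset.sum_neg_distrib]
      refine Finset.sum_congr rfl fun e _ => ?_
      rw [← Finset.sum_neg_distrib]
      exact Finset.sum_congr rfl fun s _ => by ring
    rw [h2]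
    linarith
  have hbound : ∀ t : ℝ, 0 ≤ t → pot c wt v (t • u) ≤
      Real.exp (t * (-δ)) * ∏ s, (nsq (v s)) ^ c s := by
    intro t ht
    have h1 : ∀ s, (∑ x, Real.exp (∑ e, (t • u) e * wt s x e) * ‖v s x‖ ^ 2) ^ c s ≤
        Real.exp (t * (c s * ∑ e, u e * wt s (m s) e)) * nsq (v s) ^ c s := by
      intro s
      have h2 : ∑ x, Real.exp (∑ e, (t • u) e * wt s x e) * ‖v s x‖ ^ 2 ≤
          Real.exp (t * ∑ e, u e * wt s (m s) e) * nsq (v s) := by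
        rw [nsq, Finset.mul_sum]
        refine Finset.sum_le_sum fun x _ => ?_
        by_cases hx : v s x = 0
        · simp [hx]
        · refine mul_le_mul_of_nonneg_right (Real.exp_le_exp.2 ?_) (sq_nonneg _)
          have := hmax s x (by simpa using hx)
          calc ∑ e, (t • u) e * wt s x e = t * ∑ e, u e * wt s x e := by
                simp [Finset.mul_sum, mul_assoc]
            _ ≤ _ := mul_le_mul_of_nonneg_left this ht
      refine (Real.rpow_le_rpow (Finset.sum_nonneg fun _ _ => by positivity) h2 (hc s)).trans_eq ?_
      rw [Real.mul_rpow (Real.exp_pos _).le (nsq_nonneg _), ← Real.exp_mul]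
      congr 2
      ring
    refine (Finset.prod_le_prod (fun s _ => by positivity) fun s _ => h1 s).trans ?_
    rw [Finset.prod_mul_distrib, ← Real.exp_sum, ← Finset.mul_sum]
    refine mul_le_mul_of_nonneg_right (Real.exp_le_exp.2 ?_)
      (Finset.prod_nonneg fun s _ => Real.rpow_nonneg (nsq_nonneg _) _)
    exact mul_le_mul_of_nonneg_left hsum.le ht
  have hlim : Filter.Tendsto (fun t : ℝ => Real.exp (t * (-δ)) * ∏ s, (nsq (v s)) ^ c s)
      Filter.atTop (nhds (0 * ∏ s, (nsq (v s)) ^ c s)) := by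
    refine Filter.Tendsto.mul_const _ (Real.tendsto_exp_atBot.comp ?_)
    exact Filter.tendsto_id.atTop_mul_const_of_neg (by linarith)
  rw [zero_mul] at hlim
  obtain ⟨t, h1, h2⟩ := ((hlim.eventually (gt_mem_nhds hε)).and
    (Filter.eventually_ge_atTop 0)).exists
  exact absurd ((h (t • u)).trans (hbound t h2)) (not_le.2 h1)

end Potential

section Flags

/-- The antisymmetric tensor spanned by the first coordinates, up to and including `m`. -/
def flagVec {n : ℕ} (m : Fin n) : ({j : Fin n // j ≤ m} → Fin n) → ℂ :=
  fun f => ((1 : Matrix (Fin n) (Fin n) ℂ).submatrix f Subtype.val).det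

lemma flagVec_val {n : ℕ} (m : Fin n) : flagVec m Subtype.val = 1 := by
  have : (1 : Matrix (Fin n) (Fin n) ℂ).submatrix (Subtype.val : {j : Fin n // j ≤ m} → Fin n)
      Subtype.val = 1 := Matrix.submatrix_one _ Subtype.val_injective
  rw [flagVec, this, Matrix.det_one]

lemma flagVec_ne_zero {n : ℕ} (m : Fin n) : flagVec m ≠ 0 := fun h => by
  have := congrFun h Subtype.val
  rw [flagVec_val] at this
  exact one_ne_zero this

lemma bijOn_of_flagVec_ne_zero {n : ℕ} {m : Fin n} {f : {j : Fin n // j ≤ m} → Fin n}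
    (hf : flagVec m f ≠ 0) : Function.Injective f ∧ Set.range f = {j | j ≤ m} := by
  have hinj : Function.Injective f := by
    intro r s hrs
    by_contra hne
    refine hf (Matrix.det_zero_of_row_eq hne ?_)
    funext j
    exact congrArg (fun i => (1 : Matrix (Fin n) (Fin n) ℂ) i j) hrs
  have hle : ∀ r, f r ≤ m := by
    intro r
    by_contra hr
    refine hf (Matrix.det_eq_zero_of_row_eq_zero r fun j => ?_)
    rw [Matrix.submatrix_apply, Matrix.one_apply_ne]
    intro h
    exact hr (h ▸ j.2)
  refine ⟨hinj, Set.Subset.antisymm (by rintro _ ⟨r, rfl⟩; exact hle r) ?_⟩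
  intro j hj
  have hb : Function.Bijective (fun r => (⟨f r, hle r⟩ : {j : Fin n // j ≤ m})) :=
    Finite.injective_iff_bijective.1 fun r s h => hinj (by simpa using h)
  obtain ⟨r, hr⟩ := hb.2 ⟨j, hj⟩
  exact ⟨r, by simpa using hr⟩

lemma marg_flagVec_of_ne {n : ℕ} (m : Fin n) (r : {j : Fin n // j ≤ m}) {i j : Fin n}
    (hij : i ≠ j) : marg (ι := fun _ => Fin n) r (flagVec m) i j = 0 := by
  simp only [marg, Matrix.of_apply]
  refine Finset.sum_eq_zero fun f _ => ?_
  split_ifs with hf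
  · by_contra hne
    rw [mul_eq_zero, not_or, map_eq_zero] at hne
    obtain ⟨h1, h2⟩ := bijOn_of_flagVec_ne_zero hne.1
    obtain ⟨h3, h4⟩ := bijOn_of_flagVec_ne_zero hne.2
    have hi : i ∈ Set.range (Function.update f r j) := by
      rw [h4, ← h2]; exact ⟨r, hf⟩
    obtain ⟨s, hs⟩ := hi
    by_cases hsr : s = r
    · subst hsr
      rw [Function.update_self] at hs
      exact hij hs.symm
    · rw [Function.update_of_ne hsr] at hs
      exact hsr (h1 (hs.trans hf.symm))
  · rfl

lemma sum_ite_norm_flagVec {n : ℕ} (m : Fin n) (j : Fin n) :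
    ∑ r, ∑ f : {j : Fin n // j ≤ m} → Fin n, (if f r = j then ‖flagVec m f‖ ^ 2 else 0) =
      if j ≤ m then nsq (flagVec m) else 0 := by
  rw [Finset.sum_comm]
  have : ∀ f : {j : Fin n // j ≤ m} → Fin n,
      ∑ r, (if f r = j then ‖flagVec m f‖ ^ 2 else 0) =
        if j ≤ m then ‖flagVec m f‖ ^ 2 else 0 := by
    intro f
    by_cases hf : flagVec m f = 0
    · simp [hf]
    obtain ⟨h1, h2⟩ := bijOn_of_flagVec_ne_zero hf
    split_ifs with hj
    · have hj' : j ∈ Set.range f := by rw [h2]; exact hj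
      obtain ⟨r, hr⟩ := hj'
      rw [Finset.sum_eq_single r]
      · simp [hr]
      · intro s _ hs
        rw [if_neg]
        intro h
        exact hs (h1 (h.trans hr.symm))
      · simp
    · refine Finset.sum_eq_zero fun r _ => ?_
      rw [if_neg]
      intro h
      apply hj
      have : f r ∈ {j | j ≤ m} := h2 ▸ Set.mem_range_self r
      exact h ▸ this
  simp only [this]
  split_ifs
  · rfl
  · simp

/-- The minors of `h` on its first columns, up to and including `m`. -/
def flagMinor {n : ℕ} (h : Matrix (Fin n) (Fin n) ℂ) (m : Fin n) :
    ({j : Fin n // j ≤ m} → Fin n) → ℂ :=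
  tens (ι := fun _ => Fin n) (fun _ => h) (flagVec m)

lemma flagMinor_eq_det {n : ℕ} (h : Matrix (Fin n) (Fin n) ℂ) (m : Fin n)
    (f : {j : Fin n // j ≤ m} → Fin n) :
    flagMinor h m f = (h.submatrix f Subtype.val).det := by
  have h1 : h.submatrix f Subtype.val = Matrix.of fun r => ∑ i, h (f r) i •
      fun j : {j : Fin n // j ≤ m} => (1 : Matrix (Fin n) (Fin n) ℂ) i j := by
    ext r j
    simp [Matrix.one_apply]
  have h2 := (Matrix.detRowAlternating (R := ℂ)
    (n := {j : Fin n // j ≤ m})).toMultilinearMap.map_sum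
    (fun r i => h (f r) i • fun j : {j : Fin n // j ≤ m} => (1 : Matrix (Fin n) (Fin n) ℂ) i j)
  rw [h1]
  refine Eq.trans ?_ h2.symm
  rw [flagMinor, tens]
  refine Finset.sum_congr rfl fun f' _ => ?_
  have h3 := (Matrix.detRowAlternating (R := ℂ)
    (n := {j : Fin n // j ≤ m})).toMultilinearMap.map_smul_univ
    (fun r => h (f r) (f' r))
    (fun r => fun j : {j : Fin n // j ≤ m} => (1 : Matrix (Fin n) (Fin n) ℂ) (f' r) j)
  rw [h3, smul_eq_mul]
  rfl

/-- On an upper triangular matrix, the flag minors scale with the leading diagonal entries. -/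
lemma flagMinor_of_upper {n : ℕ} (h : Matrix (Fin n) (Fin n) ℂ) (hu : ∀ i j, j < i → h i j = 0)
    (m : Fin n) : flagMinor h m = (∏ r : {j : Fin n // j ≤ m}, h r r) • flagVec m := by
  funext f
  rw [flagMinor_eq_det, Pi.smul_apply, smul_eq_mul]
  by_cases hf : ∀ r, f r ≤ m
  · have h1 : h.submatrix f Subtype.val =
        ((1 : Matrix (Fin n) (Fin n) ℂ).submatrix f
          (Subtype.val : {j : Fin n // j ≤ m} → Fin n)) *
          h.submatrix Subtype.val (Subtype.val : {j : Fin n // j ≤ m} → Fin n) := by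
      ext r j
      rw [Matrix.mul_apply, Finset.sum_eq_single ⟨f r, hf r⟩]
      · simp
      · intro b _ hb
        rw [Matrix.submatrix_apply, Matrix.one_apply_ne, zero_mul]
        rintro h
        exact hb (Subtype.ext h.symm)
      · simp
    rw [h1, Matrix.det_mul, mul_comm, flagVec]
    congr 1
    rw [Matrix.det_of_isUpperTriangular]
    · rfl
    · intro i j hij
      exact hu _ _ hij
  · push Not at hf
    obtain ⟨r, hr⟩ := hf
    have h2 : flagVec m f = 0 := by
      by_contra hne
      have := (bijOn_of_flagVec_ne_zero hne).2 ▸ Set.mem_range_self r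
      exact absurd this (not_le.2 hr)
    rw [h2, mul_zero]
    exact Matrix.det_eq_zero_of_row_eq_zero r fun j => hu _ _ (j.2.trans_lt hr)

/-- The successive differences of a finite sequence (the last one being its last term). -/
def drops {n : ℕ} (lam : Fin n → ℝ) (m : Fin n) : ℝ :=
  lam m - if h : (m : ℕ) + 1 < n then lam ⟨m + 1, h⟩ else 0

lemma drops_nonneg {n : ℕ} {lam : Fin n → ℝ} (h : Antitone lam) (h0 : ∀ i, 0 ≤ lam i)
    (m : Fin n) : 0 ≤ drops lam m := by
  unfold drops
  split_ifs with hm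
  · have : lam ⟨m + 1, hm⟩ ≤ lam m := h (by rw [Fin.le_def]; simp)
    linarith
  · simpa using h0 m

lemma sum_drops {n : ℕ} (lam : Fin n → ℝ) (j : Fin n) :
    ∑ m, (if j ≤ m then drops lam m else 0) = lam j := by
  let Λ : ℕ → ℝ := fun k => if h : k < n then lam ⟨k, h⟩ else 0
  have h1 : ∀ m : Fin n, (if j ≤ m then drops lam m else 0) =
      (fun k : ℕ => if (j : ℕ) ≤ k then Λ k - Λ (k + 1) else 0) m := by
    intro m
    simp only [drops, Λ, Fin.le_def, m.2, dif_pos]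
  simp only [h1]
  rw [Fin.sum_univ_eq_sum_range (fun k : ℕ => if (j : ℕ) ≤ k then Λ k - Λ (k + 1) else 0) n,
    ← Finset.sum_filter]
  have h2 : (Finset.range n).filter (fun k => (j : ℕ) ≤ k) = Finset.Ico (j : ℕ) n := by
    ext k; simp [and_comm]
  rw [h2]
  have h3 := Finset.sum_Ico_sub Λ j.2.le
  have h4 : ∑ k ∈ Finset.Ico (j : ℕ) n, (Λ k - Λ (k + 1)) =
      -∑ k ∈ Finset.Ico (j : ℕ) n, (Λ (k + 1) - Λ k) := by
    rw [← Finset.sum_neg_distrib]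
    exact Finset.sum_congr rfl fun _ _ => by ring
  rw [h4, h3]
  simp [Λ]

end Flags

section System

variable {L : Type} [Fintype L] [DecidableEq L] {d : L → ℕ}

/-- The index types of the tensor itself and of all the flag minors. -/
def Fac (d : L → ℕ) : Option (Σ l, Fin (d l)) → Type
  | none => ∀ l, Fin (d l)
  | some p => {j : Fin (d p.1) // j ≤ p.2} → Fin (d p.1)

instance facFintype : ∀ s, Fintype (Fac d s)
  | none => inferInstanceAs (Fintype (∀ l, Fin (d l)))
  | some p => inferInstanceAs (Fintype ({j : Fin (d p.1) // j ≤ p.2} → Fin (d p.1)))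

/-- The weights of the coordinates of a tensor and of flag minors. -/
def facWt : ∀ s, Fac d s → (Σ l, Fin (d l)) → ℝ
  | none, w, e => if w e.1 = e.2 then 1 else 0
  | some p, f, e => -∑ r, if (⟨p.1, f r⟩ : Σ l, Fin (d l)) = e then 1 else 0

/-- The exponents attached to a spectrum. -/
def facExp (lam : ∀ l, Fin (d l) → ℝ) : Option (Σ l, Fin (d l)) → ℝ
  | none => 1
  | some p => drops (lam p.1) p.2

/-- The transformed tensor, together with the transformed flag minors. -/
def facVec (g h : ∀ l, Matrix (Fin (d l)) (Fin (d l)) ℂ) (ψ : (∀ l, Fin (d l)) → ℂ) :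
    ∀ s, Fac d s → ℂ
  | none => tens g ψ
  | some p => flagMinor (h p.1) p.2

/-- The support of the transformed tensor and flag minors. -/
def facSupp (g h : ∀ l, Matrix (Fin (d l)) (Fin (d l)) ℂ) (ψ : (∀ l, Fin (d l)) → ℂ)
    (s : Option (Σ l, Fin (d l))) : Set (Fac d s) :=
  {x | facVec g h ψ s x ≠ 0}

/-- The entrywise conjugate of a family of matrices. -/
def conjFam (k : ∀ l, Matrix (Fin (d l)) (Fin (d l)) ℂ) : ∀ l, Matrix (Fin (d l)) (Fin (d l)) ℂ :=
  fun l => (k l).map (starRingEnd ℂ)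

/-- The set of families of unitary matrices. -/
def unitaryFam (d : L → ℕ) : Set (∀ l, Matrix (Fin (d l)) (Fin (d l)) ℂ) :=
  {k | ∀ l, (k l).conjTranspose * k l = 1}

lemma facExp_nonneg {lam : ∀ l, Fin (d l) → ℝ} (h : ∀ l, Antitone (lam l))
    (h0 : ∀ l i, 0 ≤ lam l i) (s : Option (Σ l, Fin (d l))) : 0 ≤ facExp lam s := by
  rcases s with _ | p
  · exact zero_le_one
  · exact drops_nonneg (h _) (h0 _) _

lemma isCompact_unitaryFam : IsCompact (unitaryFam d) := by
  have h1 : unitaryFam d = Set.univ.pi fun l =>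
      {k : Matrix (Fin (d l)) (Fin (d l)) ℂ | k.conjTranspose * k = 1} := by
    ext k; simp [unitaryFam]
  rw [h1]
  refine isCompact_univ_pi fun l => ?_
  have h2 : IsCompact (Set.univ.pi fun _ => Set.univ.pi fun _ => Metric.closedBall (0 : ℂ) 1 :
      Set (Fin (d l) → Fin (d l) → ℂ)) :=
    isCompact_univ_pi fun _ => isCompact_univ_pi fun _ => isCompact_closedBall _ _
  refine IsCompact.of_isClosed_subset (s := (Set.univ.pi fun _ => Set.univ.pi fun _ =>
    Metric.closedBall (0 : ℂ) 1 : Set (Matrix (Fin (d l)) (Fin (d l)) ℂ))) h2 ?_ ?_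
  · exact isClosed_eq (by fun_prop) continuous_const
  · intro k hk i _ j _
    have : k ∈ Matrix.unitaryGroup (Fin (d l)) ℂ := Matrix.mem_unitaryGroup_iff'.2 hk
    simpa using entry_norm_bound_of_unitary this i j

lemma continuous_facVec {Y : Type} [TopologicalSpace Y]
    (g h : Y → ∀ l, Matrix (Fin (d l)) (Fin (d l)) ℂ) (ψ : Y → (∀ l, Fin (d l)) → ℂ)
    (hg : Continuous g) (hh : Continuous h) (hψ : Continuous ψ) :
    Continuous fun y => facVec (g y) (h y) (ψ y) := by
  refine continuous_pi fun s => ?_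
  rcases s with _ | p
  · exact continuous_tens g ψ hg hψ
  · exact continuous_tens (R := {j : Fin (d p.1) // j ≤ p.2}) (ι := fun _ => Fin (d p.1))
      (fun y _ => h y p.1) (fun _ => flagVec p.2)
      (continuous_pi fun _ => (continuous_apply p.1).comp hh) continuous_const

lemma continuous_conjFam : Continuous (conjFam : (∀ l, Matrix (Fin (d l)) (Fin (d l)) ℂ) → _) := by
  unfold conjFam
  refine continuous_pi fun l => ?_
  exact (continuous_apply l).matrix_map Complex.continuous_conj

lemma conjFam_unitary {k : ∀ l, Matrix (Fin (d l)) (Fin (d l)) ℂ} (hk : k ∈ unitaryFam d) :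
    conjFam k ∈ unitaryFam d := by
  intro l
  have := congrArg (fun M => M.map (starRingEnd ℂ)) (hk l)
  simp only [Matrix.map_mul] at this
  rw [conjFam, ← Matrix.conjTranspose_map]
  · rw [this]; simp
  · intro x; simp

lemma mul_conjFam_transpose {k : ∀ l, Matrix (Fin (d l)) (Fin (d l)) ℂ} (hk : k ∈ unitaryFam d)
    (l : L) : k l * (conjFam k l).transpose = 1 := by
  have h1 : (conjFam k l).transpose = (k l).conjTranspose := by
    ext i j; simp [conjFam, Matrix.conjTranspose_apply]
  rw [h1, mul_eq_one_comm]
  exact hk l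

/-- The real diagonal family with entries `exp (u / 2)`. -/
def expFam (u : (Σ l, Fin (d l)) → ℝ) : ∀ l, Matrix (Fin (d l)) (Fin (d l)) ℂ :=
  fun l => Matrix.diagonal fun i => (Real.exp (u ⟨l, i⟩ / 2) : ℂ)

lemma nsq_facVec_mul {U g h : ∀ l, Matrix (Fin (d l)) (Fin (d l)) ℂ} (hU : U ∈ unitaryFam d)
    (u : (Σ l, Fin (d l)) → ℝ) (ψ : (∀ l, Fin (d l)) → ℂ) (s : Option (Σ l, Fin (d l))) :
    nsq (facVec (fun l => U l * (expFam u l * g l))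
      (fun l => conjFam U l * (expFam (-u) l * h l)) ψ s) =
    ∑ x, Real.exp (∑ e, u e * facWt s x e) * ‖facVec g h ψ s x‖ ^ 2 := by
  rcases s with _ | p
  · change nsq (tens (fun l => U l * (expFam u l * g l)) ψ) =
      ∑ w : ∀ l, Fin (d l), Real.exp (∑ e : Σ l, Fin (d l), u e * if w e.1 = e.2 then 1 else 0) *
        ‖tens g ψ w‖ ^ 2
    rw [← tens_tens, ← tens_tens, nsq_tens_unitary U hU, nsq]
    refine Finset.sum_congr rfl fun w _ => ?_
    have h2 : tens (fun l => expFam u l) (tens g ψ) w =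
        (∏ l, (Real.exp (u ⟨l, w l⟩ / 2) : ℂ)) * tens g ψ w := tens_diagonal _ _ w
    rw [h2, norm_mul, mul_pow]
    congr 1
    rw [norm_prod, ← Finset.prod_pow, Fintype.sum_sigma, Real.exp_sum]
    refine Finset.prod_congr rfl fun l _ => ?_
    simp only [mul_ite, mul_one, mul_zero, Finset.sum_ite_eq, Finset.mem_univ, if_true]
    rw [Complex.norm_real, Real.norm_eq_abs, abs_of_pos (Real.exp_pos _), ← Real.exp_nat_mul]
    congr 1
    push_cast; ring
  · obtain ⟨l, m⟩ := p
    change nsq (flagMinor (conjFam U l * (expFam (-u) l * h l)) m) =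
      ∑ f : {j : Fin (d l) // j ≤ m} → Fin (d l), Real.exp (∑ e : Σ l, Fin (d l), u e *
        -∑ r, if (⟨l, f r⟩ : Σ l, Fin (d l)) = e then 1 else 0) * ‖flagMinor (h l) m f‖ ^ 2
    unfold flagMinor
    rw [← tens_tens (R := {j : Fin (d l) // j ≤ m}) (ι := fun _ => Fin (d l))
      (fun _ => conjFam U l), ← tens_tens (R := {j : Fin (d l) // j ≤ m})
      (ι := fun _ => Fin (d l)) (fun _ => expFam (-u) l),
      nsq_tens_unitary _ (fun _ => conjFam_unitary hU l), nsq]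
    refine Finset.sum_congr rfl fun f _ => ?_
    rw [expFam, tens_diagonal, norm_mul, mul_pow]
    congr 1
    have h1 : ∑ e : Σ l, Fin (d l), u e *
        -∑ r, (if (⟨l, f r⟩ : Σ l, Fin (d l)) = e then (1 : ℝ) else 0) = ∑ r, -u ⟨l, f r⟩ := by
      simp only [← Finset.sum_neg_distrib, Finset.mul_sum]
      rw [Finset.sum_comm]
      refine Finset.sum_congr rfl fun r _ => ?_
      simp
    rw [norm_prod, ← Finset.prod_pow, h1, Real.exp_sum]
    refine Finset.prod_congr rfl fun r _ => ?_
    rw [Complex.norm_real, Real.norm_eq_abs, abs_of_pos (Real.exp_pos _), ← Real.exp_nat_mul]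
    congr 1
    simp only [Pi.neg_apply]
    push_cast; ring

open scoped ComplexOrder in
/-- Polar decomposition of an invertible matrix together with its contragredient. -/
lemma exists_polar {n : ℕ} (g h : Matrix (Fin n) (Fin n) ℂ) (hgh : g * h.transpose = 1) :
    ∃ (U k : Matrix (Fin n) (Fin n) ℂ) (u : Fin n → ℝ), U.conjTranspose * U = 1 ∧
      k.conjTranspose * k = 1 ∧
      g = U * (Matrix.diagonal (fun i => (Real.exp (u i / 2) : ℂ)) * k) ∧
      h = U.map (starRingEnd ℂ) *
        (Matrix.diagonal (fun i => (Real.exp (-u i / 2) : ℂ)) * k.map (starRingEnd ℂ)) := by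
  have hg : IsUnit g := IsUnit.of_mul_eq_one _ hgh
  have hpd : (g.conjTranspose * g).PosDef := Matrix.PosDef.conjTranspose_mul_self g
    (Matrix.mulVec_injective_of_isUnit hg)
  have hH := hpd.isHermitian
  let V : Matrix (Fin n) (Fin n) ℂ := hH.eigenvectorUnitary
  have hV1 : V.conjTranspose * V = 1 := Matrix.mem_unitaryGroup_iff'.1 hH.eigenvectorUnitary.2
  have hV2 : V * V.conjTranspose = 1 := Matrix.mem_unitaryGroup_iff.1 hH.eigenvectorUnitary.2
  have hspec : g.conjTranspose * g =
      V * Matrix.diagonal (fun i => (hH.eigenvalues i : ℂ)) * V.conjTranspose := by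
    exact hH.spectral_theorem
  let u : Fin n → ℝ := fun i => Real.log (hH.eigenvalues i)
  have hpos : ∀ i, 0 < hH.eigenvalues i := hpd.eigenvalues_pos
  have hu : ∀ i, Real.exp (u i) = hH.eigenvalues i := fun i => Real.exp_log (hpos i)
  let D : Matrix (Fin n) (Fin n) ℂ := Matrix.diagonal (fun i => (Real.exp (u i / 2) : ℂ))
  let D' : Matrix (Fin n) (Fin n) ℂ := Matrix.diagonal (fun i => (Real.exp (-u i / 2) : ℂ))
  have hDD : D * D' = 1 := by
    rw [Matrix.diagonal_mul_diagonal, ← Matrix.diagonal_one]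
    congr 1
    funext i
    rw [← Complex.ofReal_mul, ← Real.exp_add]
    simp [neg_div]
  have hDD' : D' * D = 1 := mul_eq_one_comm.1 hDD
  have hD'c : D'.conjTranspose = D' := by
    rw [Matrix.diagonal_conjTranspose]
    congr 1
    funext i
    exact Complex.conj_ofReal _
  have hsq : Matrix.diagonal (fun i => (hH.eigenvalues i : ℂ)) = D * D := by
    rw [Matrix.diagonal_mul_diagonal]
    congr 1
    funext i
    rw [← hu, ← Complex.ofReal_mul, ← Real.exp_add]
    congr 2; ring
  have hU : (g * V * D').conjTranspose * (g * V * D') = 1 := by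
    have : (g * V * D').conjTranspose * (g * V * D') =
        D' * (V.conjTranspose * (g.conjTranspose * g) * V) * D' := by
      simp only [Matrix.conjTranspose_mul, hD'c, Matrix.mul_assoc]
    rw [this, hspec, hsq]
    calc D' * (V.conjTranspose * (V * (D * D) * V.conjTranspose) * V) * D'
        = (D' * D) * (D * D') := by
          have : V.conjTranspose * (V * (D * D) * V.conjTranspose) * V = D * D := by
            calc _ = (V.conjTranspose * V) * (D * D) * (V.conjTranspose * V) := by
                  simp only [Matrix.mul_assoc]
              _ = D * D := by rw [hV1, one_mul, mul_one]
          rw [this]; simp only [Matrix.mul_assoc]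
      _ = 1 := by rw [hDD, hDD', one_mul]
  have hgeq : g = g * V * D' * (D * V.conjTranspose) := by
    calc g = g * V * (D' * D) * V.conjTranspose := by
          rw [hDD', mul_one, Matrix.mul_assoc, hV2, mul_one]
      _ = _ := by simp only [Matrix.mul_assoc]
  refine ⟨g * V * D', V.conjTranspose, u, hU, by rw [Matrix.conjTranspose_conjTranspose, hV2],
    hgeq, ?_⟩
  set U := g * V * D' with hUdef
  have hconjT : ∀ M : Matrix (Fin n) (Fin n) ℂ,
      (M.map (starRingEnd ℂ)).transpose = M.conjTranspose := by
    intro M; ext i j; simp [Matrix.conjTranspose_apply]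
  have key : g * (U.map (starRingEnd ℂ) *
      (D' * V.conjTranspose.map (starRingEnd ℂ))).transpose = 1 := by
    rw [Matrix.transpose_mul, Matrix.transpose_mul, hconjT, hconjT,
      Matrix.conjTranspose_conjTranspose, show D'.transpose = D' from Matrix.diagonal_transpose _]
    rw [hgeq]
    calc U * (D * V.conjTranspose) * (V * D' * U.conjTranspose)
        = U * (D * ((V.conjTranspose * V) * D')) * U.conjTranspose := by
          simp only [Matrix.mul_assoc]
      _ = 1 := by rw [hV1, one_mul, hDD, mul_one, mul_eq_one_comm]; exact hU
  have h1 : h.transpose = (U.map (starRingEnd ℂ) *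
      (D' * V.conjTranspose.map (starRingEnd ℂ))).transpose :=
    hg.mul_left_cancel (hgh.trans key.symm)
  exact Matrix.transpose_injective h1

end System

section Regular

lemma sum_norm_tens_of_marg {R : Type} [Fintype R] [DecidableEq R] {ι : R → Type}
    [∀ r, Fintype (ι r)] [∀ r, DecidableEq (ι r)] (r : R) (k : ∀ r, Matrix (ι r) (ι r) ℂ)
    (hk : ∀ r, (k r).conjTranspose * k r = 1) (ψ : (∀ r, ι r) → ℂ) (D : ι r → ℝ)
    (hD : marg r ψ = Matrix.diagonal fun j => (D j : ℂ)) (i : ι r) :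
    ∑ w, (if w r = i then ‖tens k ψ w‖ ^ 2 else 0) = ∑ j, ‖k r i j‖ ^ 2 * D j := by
  have h1 := marg_apply_self r (tens k ψ) i
  rw [marg_tens r k hk, hD, Matrix.mul_apply] at h1
  have h2 : ∑ j, (k r * Matrix.diagonal fun j => (D j : ℂ)) i j * (k r).conjTranspose j i =
      ((∑ j, ‖k r i j‖ ^ 2 * D j : ℝ) : ℂ) := by
    rw [Complex.ofReal_sum]
    refine Finset.sum_congr rfl fun j _ => ?_
    rw [Matrix.mul_diagonal, Matrix.conjTranspose_apply, Complex.ofReal_mul,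
      ← Complex.normSq_eq_norm_sq, ← Complex.mul_conj]
    simp only [starRingEnd_apply]
    ring
  rw [h2] at h1
  exact_mod_cast h1.symm

variable {L : Type} [Fintype L] [DecidableEq L] {d : L → ℕ}

/-- Semistability of `ψ` along all unitary translates, with respect to the spectra `lam`. -/
def IsStableTensor (lam : ∀ l, Fin (d l) → ℝ) (ψ : (∀ l, Fin (d l)) → ℂ) : Prop :=
  ∀ k ∈ unitaryFam d, HasBalance (facExp lam) facWt (facSupp k (conjFam k) ψ)

/-- The Kempf–Ness function of `ψ` with respect to the spectra `lam`. -/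
def capFun (lam : ∀ l, Fin (d l) → ℝ) (ψ : (∀ l, Fin (d l)) → ℂ)
    (g h : ∀ l, Matrix (Fin (d l)) (Fin (d l)) ℂ) : ℝ :=
  ∏ s, nsq (facVec g h ψ s) ^ facExp lam s

/-- The Kempf–Ness function is bounded below by a positive constant. -/
def HasCap (lam : ∀ l, Fin (d l) → ℝ) (ψ : (∀ l, Fin (d l)) → ℂ) : Prop :=
  ∃ ε > 0, ∀ g h : ∀ l, Matrix (Fin (d l)) (Fin (d l)) ℂ,
    (∀ l, g l * (h l).transpose = 1) → ε ≤ capFun lam ψ g h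

lemma sum_norm_flagMinor {n : ℕ} (k : Matrix (Fin n) (Fin n) ℂ) (hk : k.conjTranspose * k = 1)
    (m i : Fin n) :
    ∑ f, ‖flagMinor k m f‖ ^ 2 * ∑ r, (if f r = i then (1 : ℝ) else 0) =
      nsq (flagVec m) * ∑ j, ‖k i j‖ ^ 2 * if j ≤ m then 1 else 0 := by
  have hD : ∀ r, marg (ι := fun _ => Fin n) r (flagVec m) = Matrix.diagonal fun j =>
      ((∑ f : {j : Fin n // j ≤ m} → Fin n,
        if f r = j then ‖flagVec m f‖ ^ 2 else 0 : ℝ) : ℂ) := by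
    intro r
    ext a b
    by_cases hab : a = b
    · subst hab
      rw [Matrix.diagonal_apply_eq, marg_apply_self]
    · rw [Matrix.diagonal_apply_ne _ hab, marg_flagVec_of_ne m r hab]
  have h1 := fun r => sum_norm_tens_of_marg (ι := fun _ => Fin n) r (fun _ => k) (fun _ => hk)
    (flagVec m) _ (hD r) i
  have h2 : ∑ f, ‖flagMinor k m f‖ ^ 2 * ∑ r, (if f r = i then (1 : ℝ) else 0) =
      ∑ r, ∑ f : {j : Fin n // j ≤ m} → Fin n,
        (if f r = i then ‖flagMinor k m f‖ ^ 2 else 0) := by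
    rw [Finset.sum_comm]
    refine Finset.sum_congr rfl fun f _ => ?_
    rw [Finset.mul_sum]
    refine Finset.sum_congr rfl fun r _ => by simp
  rw [h2]
  unfold flagMinor
  simp only [h1]
  rw [Finset.sum_comm, Finset.mul_sum]
  refine Finset.sum_congr rfl fun j _ => ?_
  rw [← Finset.mul_sum, sum_ite_norm_flagVec]
  split_ifs <;> ring

lemma isStableTensor_of_marg {lam : ∀ l, Fin (d l) → ℝ}
    {ψ : (∀ l, Fin (d l)) → ℂ} (hψ : nsq ψ = 1)
    (hm : ∀ l, marg l ψ = Matrix.diagonal fun i => (lam l i : ℂ)) : IsStableTensor lam ψ := by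
  intro k hk
  have hkc := conjFam_unitary hk
  have hN : ∀ (l : L) (m : Fin (d l)), 0 < nsq (flagVec m) := fun l m => nsq_pos (flagVec_ne_zero m)
  let η : ∀ s, Fac d s → ℝ := fun s => match s with
    | none => fun w => ‖tens k ψ w‖ ^ 2
    | some p => fun f => ‖flagMinor (conjFam k p.1) p.2 f‖ ^ 2 / nsq (flagVec p.2)
  refine ⟨η, ⟨?_, ?_, ?_⟩, ?_⟩
  · rintro (_ | p) x
    · exact sq_nonneg _
    · exact div_nonneg (sq_nonneg _) (nsq_nonneg _)
  · rintro (_ | p)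
    · exact (nsq_tens_unitary k hk ψ).trans hψ
    · change ∑ f, ‖flagMinor (conjFam k p.1) p.2 f‖ ^ 2 / nsq (flagVec p.2) = 1
      rw [← Finset.sum_div, div_eq_one_iff_eq (hN _ _).ne']
      exact nsq_tens_unitary (R := {j : Fin (d p.1) // j ≤ p.2}) _ (fun _ => hkc p.1) _
  · rintro ⟨l, i⟩
    rw [Fintype.sum_option, Fintype.sum_sigma]
    have h1 : ∑ x, η none x * facWt none x ⟨l, i⟩ = ∑ j, ‖k l i j‖ ^ 2 * lam l j := by
      rw [← sum_norm_tens_of_marg l k hk ψ (lam l) (hm l) i]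
      refine Finset.sum_congr rfl fun w _ => ?_
      change ‖tens k ψ w‖ ^ 2 * (if w l = i then 1 else 0) = _
      simp
    have h2 : ∀ m : Fin (d l), ∑ x, η (some ⟨l, m⟩) x * facWt (some ⟨l, m⟩) x ⟨l, i⟩ =
        -∑ j, ‖k l i j‖ ^ 2 * if j ≤ m then 1 else 0 := by
      intro m
      have h3 := sum_norm_flagMinor (conjFam k l) (hkc l) m i
      have h4 : ∑ x, η (some ⟨l, m⟩) x * facWt (some ⟨l, m⟩) x ⟨l, i⟩ =
          -((∑ f, ‖flagMinor (conjFam k l) m f‖ ^ 2 * ∑ r, (if f r = i then (1 : ℝ) else 0)) /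
            nsq (flagVec m)) := by
        rw [Finset.sum_div, ← Finset.sum_neg_distrib]
        refine Finset.sum_congr rfl fun f _ => ?_
        change ‖flagMinor (conjFam k l) m f‖ ^ 2 / nsq (flagVec m) *
          (-∑ r, if (⟨l, f r⟩ : Σ l, Fin (d l)) = ⟨l, i⟩ then (1 : ℝ) else 0) = _
        simp only [Sigma.mk.injEq, heq_eq_eq, true_and]
        ring
      rw [h4, h3, mul_div_cancel_left₀ _ (hN l m).ne']
      simp [conjFam]
    have h5 : ∀ l', l' ≠ l → ∑ m : Fin (d l'), facExp lam (some ⟨l', m⟩) *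
        ∑ x, η (some ⟨l', m⟩) x * facWt (some ⟨l', m⟩) x ⟨l, i⟩ = 0 := by
      intro l' hl
      refine Finset.sum_eq_zero fun m _ => mul_eq_zero_of_right _ (Finset.sum_eq_zero fun f _ =>
        mul_eq_zero_of_right _ ?_)
      change (-∑ r, if (⟨l', f r⟩ : Σ l, Fin (d l)) = ⟨l, i⟩ then (1 : ℝ) else 0) = 0
      simp [hl]
    rw [Finset.sum_eq_single l (fun l' _ hl => h5 l' hl) (by simp), h1]
    simp only [h2]
    change 1 * _ + ∑ m : Fin (d l), drops (lam l) m * _ = 0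
    simp only [mul_neg, Finset.sum_neg_distrib, Finset.mul_sum, one_mul]
    rw [Finset.sum_comm, ← sub_eq_add_neg, sub_eq_zero]
    refine Finset.sum_congr rfl fun j _ => ?_
    rw [← sum_drops (lam l) j, Finset.mul_sum]
    refine Finset.sum_congr rfl fun m _ => ?_
    split_ifs <;> ring
  · rintro (_ | p) x hx
    · have hx' : tens k ψ x = 0 := not_not.1 hx
      change ‖tens k ψ x‖ ^ 2 = 0
      simp [hx']
    · have hx' : flagMinor (conjFam k p.1) p.2 x = 0 := not_not.1 hx
      change ‖flagMinor (conjFam k p.1) p.2 x‖ ^ 2 / _ = 0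
      simp [hx']

lemma IsStableTensor.hasCap {lam : ∀ l, Fin (d l) → ℝ} (hlam : ∀ l, Antitone (lam l))
    (h0 : ∀ l i, 0 ≤ lam l i) {ψ : (∀ l, Fin (d l)) → ℂ} (h : IsStableTensor lam ψ) :
    HasCap lam ψ := by
  obtain ⟨ε, hε, hb⟩ := exists_pos_le_pot isCompact_unitaryFam (facExp_nonneg hlam h0)
    (facWt (d := d)) (fun k => facVec k (conjFam k) ψ)
    (continuous_facVec _ _ _ continuous_id continuous_conjFam continuous_const) h
  refine ⟨ε, hε, fun g h hgh => ?_⟩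
  choose U k u hU hk hg hh using fun l => exists_polar (g l) (h l) (hgh l)
  have := hb k hk (fun e => u e.1 e.2)
  refine this.trans_eq ?_
  unfold pot capFun
  refine Finset.prod_congr rfl fun s _ => ?_
  rw [← nsq_facVec_mul hU]
  have h1 : g = fun l => U l * (expFam (fun e => u e.1 e.2) l * k l) := funext hg
  have h2 : h = fun l => conjFam U l * (expFam (-fun e => u e.1 e.2) l * conjFam k l) := funext hh
  rw [← h1, ← h2]

lemma expFam_mul_transpose (u : (Σ l, Fin (d l)) → ℝ) (l : L) :
    expFam u l * (expFam (-u) l).transpose = 1 := by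
  rw [expFam, expFam, Matrix.diagonal_transpose, Matrix.diagonal_mul_diagonal,
    ← Matrix.diagonal_one]
  congr 1
  funext i
  rw [← Complex.ofReal_mul, ← Real.exp_add]
  simp [neg_div]

lemma HasCap.hasBalance {lam : ∀ l, Fin (d l) → ℝ} (hlam : ∀ l, Antitone (lam l))
    (h0 : ∀ l i, 0 ≤ lam l i) {ψ : (∀ l, Fin (d l)) → ℂ} (hc : HasCap lam ψ)
    (g h : ∀ l, Matrix (Fin (d l)) (Fin (d l)) ℂ) (hgh : ∀ l, g l * (h l).transpose = 1) :
    HasBalance (facExp lam) facWt (facSupp g h ψ) := by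
  obtain ⟨ε, hε, hb⟩ := hc
  have hone : ∀ u : (Σ l, Fin (d l)) → ℝ, ε ≤ pot (facExp lam) facWt (facVec g h ψ) u := by
    intro u
    have hU : (fun l => (1 : Matrix (Fin (d l)) (Fin (d l)) ℂ)) ∈ unitaryFam d := by
      intro l; simp
    refine (hb _ _ ?_).trans_eq (Finset.prod_congr rfl fun s _ => by rw [nsq_facVec_mul hU u])
    intro l
    have h1 : conjFam (fun l => (1 : Matrix (Fin (d l)) (Fin (d l)) ℂ)) l = 1 := by
      simp [conjFam]
    rw [h1, one_mul, one_mul, Matrix.transpose_mul]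
    calc expFam u l * g l * ((h l).transpose * (expFam (-u) l).transpose)
        = expFam u l * (g l * (h l).transpose) * (expFam (-u) l).transpose := by
          simp only [Matrix.mul_assoc]
      _ = 1 := by rw [hgh, mul_one, expFam_mul_transpose]
  refine balanced_of_le_pot (facExp_nonneg hlam h0) facWt (facVec g h ψ) ?_ hε hone
  rintro (_ | p) hz
  · have h1 := hb g h hgh
    have h2 : capFun lam ψ g h = 0 := by
      refine Finset.prod_eq_zero (Finset.mem_univ none) ?_
      rw [hz]
      change nsq (0 : (∀ l, Fin (d l)) → ℂ) ^ (1 : ℝ) = 0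
      simp [nsq]
    linarith
  · have h1 : (g p.1).transpose * h p.1 = 1 := by
      have := congrArg Matrix.transpose (mul_eq_one_comm.1 (hgh p.1))
      simpa [Matrix.transpose_mul] using this
    have hz' : flagMinor (h p.1) p.2 = 0 := hz
    have h2 : tens (R := {j : Fin (d p.1) // j ≤ p.2}) (ι := fun _ => Fin (d p.1))
        (fun _ => (g p.1).transpose) (flagMinor (h p.1) p.2) = flagVec p.2 := by
      rw [flagMinor, tens_tens, h1, tens_one]
    refine flagVec_ne_zero p.2 ?_
    rw [← h2, hz']
    funext f
    simp [tens]

lemma IsStableTensor.eventually {lam : ∀ l, Fin (d l) → ℝ} {ψ : (∀ l, Fin (d l)) → ℂ}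
    (h : IsStableTensor lam ψ) : ∀ᶠ χ in nhds ψ, IsStableTensor lam χ :=
  eventually_balanced isCompact_unitaryFam (facExp lam) facWt
    (fun p => facVec p.2 (conjFam p.2) p.1)
    (continuous_facVec _ _ _ continuous_snd (continuous_conjFam.comp continuous_snd)
      continuous_fst) ψ h

end Regular

section Lines

open Polynomial in
/-- The polynomial functions in a distinguished parameter and further unknowns. -/
def polyFun (J : Type) : MvPolynomial J ℂ[X] →+* (ℂ × (J → ℂ) → ℂ) :=
  RingHom.pi fun p => MvPolynomial.eval₂Hom (evalRingHom p.1) p.2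

lemma polyFun_param (J : Type) : (fun p : ℂ × (J → ℂ) => p.1) ∈ (polyFun J).range :=
  ⟨MvPolynomial.C Polynomial.X, by
    funext p
    change MvPolynomial.eval₂ _ _ _ = _
    simp⟩

lemma polyFun_const (J : Type) (t : ℂ) : (fun _ : ℂ × (J → ℂ) => t) ∈ (polyFun J).range :=
  ⟨MvPolynomial.C (Polynomial.C t), by
    funext p
    change MvPolynomial.eval₂ _ _ _ = _
    simp⟩

lemma polyFun_coord {J : Type} (j : J) : (fun p : ℂ × (J → ℂ) => p.2 j) ∈ (polyFun J).range :=
  ⟨MvPolynomial.X j, by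
    funext p
    change MvPolynomial.eval₂ _ _ _ = _
    simp⟩

lemma polyFun_sum {J α : Type} [Fintype α] {f : α → ℂ × (J → ℂ) → ℂ}
    (h : ∀ a, f a ∈ (polyFun J).range) :
    (fun p => ∑ a, f a p) ∈ (polyFun J).range := by
  have := sum_mem (t := Finset.univ) fun a _ => h a
  convert this using 1
  funext p; simp

lemma polyFun_prod {J α : Type} [Fintype α] {f : α → ℂ × (J → ℂ) → ℂ}
    (h : ∀ a, f a ∈ (polyFun J).range) :
    (fun p => ∏ a, f a p) ∈ (polyFun J).range := by
  have := prod_mem (t := Finset.univ) fun a _ => h a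
  convert this using 1
  funext p; simp

lemma polyFun_solvable {J A : Type} [Finite J] (F : A → ℂ × (J → ℂ) → ℂ)
    (hF : ∀ a, F a ∈ (polyFun J).range) :
    {s : ℂ | ∃ x : J → ℂ, ∀ a, F a (s, x) = 0}.Finite ∨
    {s : ℂ | ∃ x : J → ℂ, ∀ a, F a (s, x) = 0}ᶜ.Finite := by
  choose P hP using hF
  have h := solvable_finite_or_cofinite (Set.range P)
  have h1 : {s : ℂ | ∃ x : J → ℂ, ∀ p ∈ Set.range P,
      MvPolynomial.eval₂ (Polynomial.evalRingHom s) x p = 0} =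
      {s : ℂ | ∃ x : J → ℂ, ∀ a, F a (s, x) = 0} := by
    ext s
    refine exists_congr fun x => ?_
    rw [Set.forall_mem_range]
    refine forall_congr' fun a => ?_
    rw [← hP a]
    rfl
  rwa [h1] at h

variable {L : Type} [Fintype L] [DecidableEq L] {d : L → ℕ}

/-- The parameters on a line for which some transform has support in `τ`. -/
def degenerateSet (ψ φ : (∀ l, Fin (d l)) → ℂ) (τ : ∀ s, Set (Fac d s)) : Set ℂ :=
  {z | ∃ g h : ∀ l, Matrix (Fin (d l)) (Fin (d l)) ℂ, (∀ l, g l * (h l).transpose = 1) ∧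
    ∀ s, facSupp g h (ψ + z • φ) s ⊆ τ s}

/-- Unknowns for a pair of families of matrices. -/
abbrev PairIdx (d : L → ℕ) : Type := Bool × (Σ l, Fin (d l) × Fin (d l))

/-- The family of matrices with the given entries. -/
def pairMat (e : Bool) (x : PairIdx d → ℂ) : ∀ l, Matrix (Fin (d l)) (Fin (d l)) ℂ :=
  fun l => Matrix.of fun i j => x (e, ⟨l, (i, j)⟩)

lemma facVec_mem_range (ψ φ : (∀ l, Fin (d l)) → ℂ) (s : Option (Σ l, Fin (d l)))
    (y : Fac d s) :
    (fun p : ℂ × (PairIdx d → ℂ) =>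
      facVec (pairMat false p.2) (pairMat true p.2) (ψ + p.1 • φ) s y) ∈
      (polyFun (PairIdx d)).range := by
  rcases s with _ | q
  · change (fun p : ℂ × (PairIdx d → ℂ) => ∑ w', (∏ r, pairMat false p.2 r (y r) (w' r)) *
      (ψ w' + p.1 * φ w')) ∈ _
    refine polyFun_sum fun w' => mul_mem (polyFun_prod fun r => polyFun_coord _) ?_
    exact add_mem (polyFun_const _ _) (mul_mem (polyFun_param _) (polyFun_const _ _))
  · change (fun p : ℂ × (PairIdx d → ℂ) => ∑ w' : {j : Fin (d q.1) // j ≤ q.2} → Fin (d q.1),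
      (∏ r, pairMat true p.2 q.1 (y r) (w' r)) * flagVec q.2 w') ∈ _
    exact polyFun_sum fun w' => mul_mem (polyFun_prod fun r => polyFun_coord _)
      (polyFun_const _ _)

lemma degenerateSet_finite_or_cofinite (ψ φ : (∀ l, Fin (d l)) → ℂ) (τ : ∀ s, Set (Fac d s)) :
    (degenerateSet ψ φ τ).Finite ∨ (degenerateSet ψ φ τ)ᶜ.Finite := by
  obtain ⟨F, hF⟩ : ∃ F : ((Σ l, Fin (d l) × Fin (d l)) ⊕ {y : Σ s, Fac d s // y.2 ∉ τ y.1}) →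
      ℂ × (PairIdx d → ℂ) → ℂ, F = fun a p => match a with
      | Sum.inl e => (∑ k, pairMat false p.2 e.1 e.2.1 k * pairMat true p.2 e.1 e.2.2 k) -
          (1 : Matrix (Fin (d e.1)) (Fin (d e.1)) ℂ) e.2.1 e.2.2
      | Sum.inr y => facVec (pairMat false p.2) (pairMat true p.2) (ψ + p.1 • φ) y.1.1 y.1.2 :=
    ⟨_, rfl⟩
  have h1 : degenerateSet ψ φ τ = {s : ℂ | ∃ x : PairIdx d → ℂ, ∀ a, F a (s, x) = 0} := by
    subst hF
    ext z
    constructor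
    · rintro ⟨g, h, hgh, hs⟩
      refine ⟨fun e => if e.1 then h e.2.1 e.2.2.1 e.2.2.2 else g e.2.1 e.2.2.1 e.2.2.2, ?_⟩
      rintro (⟨l, i, j⟩ | ⟨⟨s, y⟩, hy⟩)
      · have := congrFun (congrFun (hgh l) i) j
        rw [Matrix.mul_apply] at this
        simp [pairMat, ← this]
      · by_contra hne
        exact hy (hs s hne)
    · rintro ⟨x, hx⟩
      refine ⟨pairMat false x, pairMat true x, fun l => ?_, fun s y hy => ?_⟩
      · ext i j
        have := hx (Sum.inl ⟨l, i, j⟩)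
        rw [Matrix.mul_apply]
        exact sub_eq_zero.1 this
      · by_contra hne
        exact hy (hx (Sum.inr ⟨⟨s, y⟩, hne⟩))
  rw [h1]
  refine polyFun_solvable F ?_
  · subst hF
    rintro (e | y)
    · exact sub_mem (polyFun_sum fun k => mul_mem (polyFun_coord _) (polyFun_coord _))
        (polyFun_const _ _)
    · exact facVec_mem_range ψ φ _ _

instance facFinite (s : Option (Σ l, Fin (d l))) : Finite (Fac d s) := inferInstance

lemma IsStableTensor.finite_not {lam : ∀ l, Fin (d l) → ℝ} (hlam : ∀ l, Antitone (lam l))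
    (h0 : ∀ l i, 0 ≤ lam l i) {ψ : (∀ l, Fin (d l)) → ℂ} (h : IsStableTensor lam ψ)
    (φ : (∀ l, Fin (d l)) → ℂ) : {z : ℂ | ¬ IsStableTensor lam (ψ + z • φ)}.Finite := by
  have hsub : {z : ℂ | ¬ IsStableTensor lam (ψ + z • φ)} ⊆
      ⋃ τ ∈ {τ : ∀ s, Set (Fac d s) | ¬ HasBalance (facExp lam) facWt τ},
        degenerateSet ψ φ τ := by
    intro z hz
    simp only [Set.mem_ofPred_eq, IsStableTensor, not_forall] at hz
    obtain ⟨k, hk, hb⟩ := hz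
    exact Set.mem_biUnion (x := facSupp k (conjFam k) (ψ + z • φ)) hb
      ⟨k, conjFam k, mul_conjFam_transpose hk, fun s => subset_rfl⟩
  refine Set.Finite.subset (Set.Finite.biUnion (Set.toFinite _) fun τ hτ => ?_) hsub
  refine (degenerateSet_finite_or_cofinite ψ φ τ).resolve_right fun hfin => hτ ?_
  have hev : ∀ᶠ z : ℂ in nhds 0, IsStableTensor lam (ψ + z • φ) := by
    have hc : Filter.Tendsto (fun z : ℂ => ψ + z • φ) (nhds 0) (nhds ψ) := by
      have : Continuous fun z : ℂ => ψ + z • φ := by fun_prop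
      simpa using this.tendsto 0
    exact hc.eventually h.eventually
  have hinf : {z : ℂ | IsStableTensor lam (ψ + z • φ)}.Infinite :=
    infinite_of_mem_nhds 0 hev
  obtain ⟨z, hz, hzc⟩ := (hinf.sdiff hfin).nonempty
  obtain ⟨g, h', hgh, hs⟩ := not_not.1 hzc
  exact ((IsStableTensor.hasCap hlam h0 hz).hasBalance hlam h0 g h' hgh).mono hs

/-- Tensors that are stable for finitely many spectra have a common stable tensor. -/
lemma exists_common_stable {I : Type} (s : Finset I) (lam : I → ∀ l, Fin (d l) → ℝ)
    (hlam : ∀ i l, Antitone (lam i l)) (h0 : ∀ i l j, 0 ≤ lam i l j)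
    (h : ∀ i ∈ s, ∃ ψ, IsStableTensor (lam i) ψ) :
    ∃ χ, ∀ i ∈ s, IsStableTensor (lam i) χ := by
  classical
  induction s using Finset.induction_on with
  | empty => exact ⟨0, by simp⟩
  | insert i s hi ih =>
    obtain ⟨χ, hχ⟩ := ih fun j hj => h j (Finset.mem_insert_of_mem hj)
    obtain ⟨ψ, hψ⟩ := h i (Finset.mem_insert_self i s)
    have hfin1 : (⋃ j ∈ s, {z : ℂ | ¬ IsStableTensor (lam j) (χ + z • (ψ - χ))}).Finite :=
      Set.Finite.biUnion s.finite_toSet fun j hj =>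
        IsStableTensor.finite_not (hlam j) (h0 j) (hχ j hj) _
    have hfin2 : ((fun z : ℂ => 1 - z) '' {w : ℂ | ¬ IsStableTensor (lam i)
        (ψ + w • (χ - ψ))}).Finite :=
      (IsStableTensor.finite_not (hlam i) (h0 i) hψ _).image _
    obtain ⟨z, hz⟩ := (hfin1.union hfin2).infinite_compl.nonempty
    rw [Set.mem_compl_iff, Set.mem_union, not_or] at hz
    refine ⟨χ + z • (ψ - χ), fun j hj => ?_⟩
    rcases Finset.mem_insert.1 hj with rfl | hj
    · by_contra hne
      refine hz.2 ⟨1 - z, ?_, by simp⟩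
      have : ψ + (1 - z) • (χ - ψ) = χ + z • (ψ - χ) := by
        module
      rwa [Set.mem_ofPred_eq, this]
    · by_contra hne
      exact hz.1 (Set.mem_biUnion (x := j) hj hne)

end Lines

section Borel

variable {L : Type} [Fintype L] [DecidableEq L] {d : L → ℕ}

/-- A family of lower triangular matrices together with the transposed inverses. -/
structure IsBorelPair (g h : ∀ l, Matrix (Fin (d l)) (Fin (d l)) ℂ) : Prop where
  mul_transpose : ∀ l, g l * (h l).transpose = 1
  lower : ∀ l i j, i < j → g l i j = 0
  upper : ∀ l i j, j < i → h l i j = 0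

/-- The squared absolute value of the character with exponents `lam`. -/
def charSq (lam : ∀ l, Fin (d l) → ℝ) (h : ∀ l, Matrix (Fin (d l)) (Fin (d l)) ℂ) : ℝ :=
  ∏ l, ∏ j, (‖h l j j‖ ^ 2) ^ lam l j

lemma IsBorelPair.diag_ne_zero {g h : ∀ l, Matrix (Fin (d l)) (Fin (d l)) ℂ}
    (hp : IsBorelPair g h) (l : L) (j : Fin (d l)) : h l j j ≠ 0 := by
  intro h0
  have h1 := congrFun (congrFun (hp.mul_transpose l) j) j
  rw [Matrix.mul_apply, Finset.sum_eq_zero, Matrix.one_apply_eq] at h1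
  · exact zero_ne_one h1
  · intro k _
    rw [Matrix.transpose_apply]
    rcases lt_trichotomy j k with hk | rfl | hk
    · rw [hp.lower l j k hk, zero_mul]
    · rw [h0, mul_zero]
    · rw [hp.upper l j k hk, mul_zero]

lemma IsBorelPair.mul {g h g' h' : ∀ l, Matrix (Fin (d l)) (Fin (d l)) ℂ}
    (hp : IsBorelPair g h) (hp' : IsBorelPair g' h') :
    IsBorelPair (fun l => g l * g' l) (fun l => h l * h' l) := by
  refine ⟨fun l => ?_, fun l i j hij => ?_, fun l i j hij => ?_⟩
  · rw [Matrix.transpose_mul]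
    calc g l * g' l * ((h' l).transpose * (h l).transpose)
        = g l * (g' l * (h' l).transpose) * (h l).transpose := by simp only [Matrix.mul_assoc]
      _ = 1 := by rw [hp'.mul_transpose, mul_one, hp.mul_transpose]
  · rw [Matrix.mul_apply]
    refine Finset.sum_eq_zero fun k _ => ?_
    rcases lt_or_ge i k with hk | hk
    · rw [hp.lower l i k hk, zero_mul]
    · rw [hp'.lower l k j (hk.trans_lt hij), mul_zero]
  · rw [Matrix.mul_apply]
    refine Finset.sum_eq_zero fun k _ => ?_
    rcases lt_or_ge k i with hk | hk
    · rw [hp.upper l i k hk, zero_mul]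
    · rw [hp'.upper l k j (hij.trans_le hk), mul_zero]

lemma charSq_mul (lam : ∀ l, Fin (d l) → ℝ) {g h g' h' : ∀ l, Matrix (Fin (d l)) (Fin (d l)) ℂ}
    (hp : IsBorelPair g h) (hp' : IsBorelPair g' h') :
    charSq lam (fun l => h l * h' l) = charSq lam h * charSq lam h' := by
  simp only [charSq, ← Finset.prod_mul_distrib]
  refine Finset.prod_congr rfl fun l _ => Finset.prod_congr rfl fun j _ => ?_
  rw [← Real.mul_rpow (sq_nonneg _) (sq_nonneg _), ← mul_pow, ← norm_mul, Matrix.mul_apply,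
    Finset.sum_eq_single j]
  · intro k _ hk
    rcases lt_or_gt_of_ne hk with hk | hk
    · rw [hp.upper l j k hk, zero_mul]
    · rw [hp'.upper l k j hk, mul_zero]
  · simp

lemma charSq_pos (lam : ∀ l, Fin (d l) → ℝ) {g h : ∀ l, Matrix (Fin (d l)) (Fin (d l)) ℂ}
    (hp : IsBorelPair g h) : 0 < charSq lam h := by
  refine Finset.prod_pos fun l _ => Finset.prod_pos fun j _ => Real.rpow_pos_of_pos ?_ _
  have := norm_pos_iff.2 (hp.diag_ne_zero l j)
  positivity

lemma charSq_sum {I : Type} [Fintype I] (θ : I → ℝ) (lam : I → ∀ l, Fin (d l) → ℝ)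
    {g h : ∀ l, Matrix (Fin (d l)) (Fin (d l)) ℂ} (hp : IsBorelPair g h) :
    charSq (fun l j => ∑ i, θ i * lam i l j) h = ∏ i, charSq (lam i) h ^ θ i := by
  have h0 : ∀ l j, 0 < ‖h l j j‖ ^ 2 := fun l j => by
    have := norm_pos_iff.2 (hp.diag_ne_zero l j); positivity
  have h1 : ∀ i, charSq (lam i) h ^ θ i = ∏ l, ∏ j, (‖h l j j‖ ^ 2) ^ (θ i * lam i l j) := by
    intro i
    rw [charSq, ← Real.finsetProd_rpow _ _ fun l _ =>
      Finset.prod_nonneg fun j _ => Real.rpow_nonneg (h0 l j).le _]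
    refine Finset.prod_congr rfl fun l _ => ?_
    rw [← Real.finsetProd_rpow _ _ fun j _ => Real.rpow_nonneg (h0 l j).le _]
    refine Finset.prod_congr rfl fun j _ => ?_
    rw [← Real.rpow_mul (h0 l j).le, mul_comm]
  simp only [h1]
  refine Eq.trans ?_ Finset.prod_comm
  refine Finset.prod_congr rfl fun l _ => ?_
  refine Eq.trans ?_ Finset.prod_comm
  refine Finset.prod_congr rfl fun j _ => ?_
  rw [Real.rpow_sum_of_pos (h0 l j)]

lemma capFun_of_borel (lam : ∀ l, Fin (d l) → ℝ) (ψ : (∀ l, Fin (d l)) → ℂ)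
    {g h : ∀ l, Matrix (Fin (d l)) (Fin (d l)) ℂ} (hp : IsBorelPair g h) :
    capFun lam ψ g h = nsq (tens g ψ) * charSq lam h *
      ∏ p : Σ l, Fin (d l), nsq (flagVec p.2) ^ drops (lam p.1) p.2 := by
  have h1 : ∀ p : Σ l, Fin (d l), nsq (facVec g h ψ (some p)) ^ facExp lam (some p) =
      (∏ j, (‖h p.1 j j‖ ^ 2) ^ (if j ≤ p.2 then drops (lam p.1) p.2 else 0)) *
        nsq (flagVec p.2) ^ drops (lam p.1) p.2 := by
    intro p
    change nsq (flagMinor (h p.1) p.2) ^ drops (lam p.1) p.2 = _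
    rw [flagMinor_of_upper (h p.1) (hp.upper p.1), nsq_smul, norm_prod, ← Finset.prod_pow,
      Real.mul_rpow (Finset.prod_nonneg fun _ _ => sq_nonneg _) (nsq_nonneg _),
      ← Real.finsetProd_rpow _ _ fun _ _ => sq_nonneg _]
    congr 1
    rw [← Finset.prod_subtype (Finset.univ.filter (· ≤ p.2)) (by simp)
      fun j => (‖h p.1 j j‖ ^ 2) ^ drops (lam p.1) p.2, Finset.prod_filter]
    refine Finset.prod_congr rfl fun j _ => ?_
    split_ifs <;> simp
  have h2 : charSq lam h = ∏ p : Σ l, Fin (d l),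
      ∏ j, (‖h p.1 j j‖ ^ 2) ^ (if j ≤ p.2 then drops (lam p.1) p.2 else 0) := by
    rw [charSq, Fintype.prod_sigma]
    refine Finset.prod_congr rfl fun l _ => ?_
    change _ = ∏ m, ∏ j, (‖h l j j‖ ^ 2) ^ (if j ≤ m then drops (lam l) m else 0)
    refine Eq.trans ?_ Finset.prod_comm
    refine Finset.prod_congr rfl fun j _ => ?_
    have h0 : 0 < ‖h l j j‖ ^ 2 := by
      have := norm_pos_iff.2 (hp.diag_ne_zero l j); positivity
    rw [← sum_drops (lam l) j, Real.rpow_sum_of_pos h0]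
  rw [capFun, Fintype.prod_option]
  simp only [h1]
  rw [Finset.prod_mul_distrib, ← h2, ← mul_assoc]
  congr 2
  exact Real.rpow_one _

lemma nsq_tens_pos {g h : ∀ l, Matrix (Fin (d l)) (Fin (d l)) ℂ}
    (hgh : ∀ l, g l * (h l).transpose = 1) {ψ : (∀ l, Fin (d l)) → ℂ} (hψ : ψ ≠ 0) :
    0 < nsq (tens g ψ) := by
  refine nsq_pos fun h0 => hψ ?_
  have h1 : tens (fun l => (h l).transpose) (tens g ψ) = ψ := by
    rw [tens_tens]
    simp only [fun l => mul_eq_one_comm.1 (hgh l), tens_one]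
  rw [← h1, h0]
  funext w
  simp [tens]

lemma exists_le_nsq_mul_charSq {I : Type} [Fintype I] {θ : I → ℝ} (hθ : ∀ i, 0 ≤ θ i)
    (hθ1 : ∑ i, θ i = 1) {lam : I → ∀ l, Fin (d l) → ℝ} {χ : (∀ l, Fin (d l)) → ℂ}
    (hχ0 : χ ≠ 0) (hχ : ∀ i, HasCap (lam i) χ) :
    ∃ ε > 0, ∀ g h, IsBorelPair g h →
      ε ≤ nsq (tens g χ) * charSq (fun l j => ∑ i, θ i * lam i l j) h := by
  choose ε hε hb using hχ
  have hC : ∀ i, 0 < ∏ p : Σ l, Fin (d l), nsq (flagVec p.2) ^ drops (lam i p.1) p.2 := fun i =>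
    Finset.prod_pos fun p _ => Real.rpow_pos_of_pos (nsq_pos (flagVec_ne_zero p.2)) _
  refine ⟨∏ i, (ε i / ∏ p : Σ l, Fin (d l), nsq (flagVec p.2) ^ drops (lam i p.1) p.2) ^ θ i,
    Finset.prod_pos fun i _ => Real.rpow_pos_of_pos (div_pos (hε i) (hC i)) _,
    fun g h hp => ?_⟩
  have hN := nsq_tens_pos hp.mul_transpose hχ0
  have h1 : nsq (tens g χ) = ∏ i, nsq (tens g χ) ^ θ i := by
    rw [← Real.rpow_sum_of_pos hN, hθ1, Real.rpow_one]
  rw [charSq_sum θ lam hp, h1, ← Finset.prod_mul_distrib]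
  refine Finset.prod_le_prod (fun i _ => Real.rpow_nonneg (div_pos (hε i) (hC i)).le _)
    fun i _ => ?_
  rw [← Real.mul_rpow hN.le (charSq_pos _ hp).le]
  refine Real.rpow_le_rpow (div_pos (hε i) (hC i)).le ?_ (hθ i)
  rw [div_le_iff₀ (hC i), ← capFun_of_borel (lam i) χ hp]
  exact hb i g h hp.mul_transpose

/-- A unit vector that minimises the Kempf–Ness function of a Borel orbit closure. -/
lemma exists_minimal {lam : ∀ l, Fin (d l) → ℝ} {χ : (∀ l, Fin (d l)) → ℂ} (hχ0 : χ ≠ 0)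
    {ε : ℝ} (hε : 0 < ε) (hb : ∀ g h, IsBorelPair g h → ε ≤ nsq (tens g χ) * charSq lam h) :
    ∃ ψ : (∀ l, Fin (d l)) → ℂ, nsq ψ = 1 ∧
      ∀ g h, IsBorelPair g h → 1 ≤ nsq (tens g ψ) * charSq lam h := by
  let V : Set ℝ := {x | ∃ g h, IsBorelPair (d := d) g h ∧ x = nsq (tens g χ) * charSq lam h}
  have hne : V.Nonempty := ⟨_, fun _ => 1, fun _ => 1, ⟨fun l => by simp,
    fun l i j hij => Matrix.one_apply_ne hij.ne, fun l i j hij => Matrix.one_apply_ne hij.ne'⟩, rfl⟩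
  have hbd : ∀ x ∈ V, ε ≤ x := by
    rintro _ ⟨g, h, hp, rfl⟩; exact hb g h hp
  have hbdd : BddBelow V := ⟨ε, hbd⟩
  obtain ⟨u, -, hu, hmem⟩ := exists_seq_tendsto_sInf hne hbdd
  have hm : 0 < sInf V := hε.trans_le (le_csInf hne hbd)
  choose G H hGH hval using hmem
  have hN : ∀ n, 0 < nsq (tens (G n) χ) := fun n => nsq_tens_pos (hGH n).mul_transpose hχ0
  let v : ℕ → (∀ l, Fin (d l)) → ℂ := fun n =>
    ((1 / Real.sqrt (nsq (tens (G n) χ)) : ℝ) : ℂ) • tens (G n) χ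
  have hnorm : ∀ n, ‖((1 / Real.sqrt (nsq (tens (G n) χ)) : ℝ) : ℂ)‖ ^ 2 =
      1 / nsq (tens (G n) χ) := by
    intro n
    rw [Complex.norm_real, Real.norm_eq_abs, sq_abs, div_pow, Real.sq_sqrt (hN n).le, one_pow]
  have hv1 : ∀ n, nsq (v n) = 1 := by
    intro n
    rw [nsq_smul, hnorm, one_div_mul_cancel (hN n).ne']
  have hcpt : IsCompact {ψ : (∀ l, Fin (d l)) → ℂ | nsq ψ = 1} := by
    refine IsCompact.of_isClosed_subset (isCompact_closedBall 0 1)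
      (isClosed_eq continuous_nsq continuous_const) fun ψ hψ => ?_
    rw [mem_closedBall_zero_iff, pi_norm_le_iff_of_nonneg zero_le_one]
    intro w
    have : ‖ψ w‖ ^ 2 ≤ 1 := by
      rw [← (hψ : nsq ψ = 1)]
      exact Finset.single_le_sum (f := fun w => ‖ψ w‖ ^ 2) (fun _ _ => sq_nonneg _)
        (Finset.mem_univ w)
    exact (sq_le_one_iff₀ (norm_nonneg _)).1 this
  obtain ⟨ψ, hψ, φ, hφ, hlim⟩ := hcpt.tendsto_subseq (x := v) hv1
  refine ⟨ψ, hψ, fun g h hp => ?_⟩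
  have hc : Continuous fun χ : (∀ l, Fin (d l)) → ℂ => nsq (tens g χ) * charSq lam h :=
    (continuous_nsq.comp (continuous_tens _ _ continuous_const continuous_id)).mul continuous_const
  have h1 : Filter.Tendsto (fun n => nsq (tens g (v (φ n))) * charSq lam h) Filter.atTop
      (nhds (nsq (tens g ψ) * charSq lam h)) := (hc.tendsto ψ).comp hlim
  have h2 : Filter.Tendsto (fun n => sInf V / u (φ n)) Filter.atTop (nhds 1) := by
    have := (tendsto_const_nhds (x := sInf V)).div (hu.comp hφ.tendsto_atTop) hm.ne'
    rwa [div_self hm.ne'] at this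
  refine le_of_tendsto_of_tendsto' h2 h1 fun n => ?_
  have hup : 0 < u (φ n) := by
    rw [hval]; exact mul_pos (hN _) (charSq_pos _ (hGH _))
  have h3 : sInf V ≤ nsq (tens (fun l => g l * G (φ n) l) χ) *
      charSq lam (fun l => h l * H (φ n) l) :=
    csInf_le hbdd ⟨_, _, hp.mul (hGH _), rfl⟩
  rw [div_le_iff₀ hup, hval]
  rw [charSq_mul lam hp (hGH _), ← tens_tens] at h3
  refine h3.trans_eq ?_
  simp only [v]
  rw [tens_smul, nsq_smul, hnorm]
  have := (hN (φ n)).ne'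
  field_simp

lemma nsq_add_smul {X : Type} [Fintype X] (ψ φ : X → ℂ) (z : ℂ) :
    nsq (ψ + z • φ) = nsq ψ + 2 * (z * herm ψ φ).re + ‖z‖ ^ 2 * nsq φ := by
  simp only [nsq, herm, Finset.mul_sum, Complex.re_sum, ← Finset.sum_add_distrib]
  refine Finset.sum_congr rfl fun w _ => ?_
  simp only [Pi.add_apply, Pi.smul_apply, smul_eq_mul, ← Complex.normSq_eq_norm_sq]
  simp only [Complex.normSq_apply, Complex.mul_re, Complex.mul_im, Complex.add_re, Complex.add_im,
    Complex.conj_re, Complex.conj_im]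
  ring

lemma herm_eq_zero_of_forall_le {X : Type} [Fintype X] {ψ φ : X → ℂ}
    (h : ∀ z : ℂ, nsq ψ ≤ nsq (ψ + z • φ)) : herm ψ φ = 0 := by
  have hN := nsq_nonneg φ
  have h1 := h (-((1 / (nsq φ + 1) : ℝ) : ℂ) * (starRingEnd ℂ) (herm ψ φ))
  rw [nsq_add_smul, neg_mul, neg_mul, mul_assoc, mul_comm ((starRingEnd ℂ) _), Complex.mul_conj,
    norm_neg, norm_mul, RCLike.norm_conj, Complex.norm_real, Real.norm_eq_abs, mul_pow, sq_abs,
    ← Complex.ofReal_mul, ← Complex.ofReal_neg, Complex.ofReal_re, Complex.normSq_eq_norm_sq] at h1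
  have h2 : ‖herm ψ φ‖ ^ 2 ≤ 0 := by
    have h3 : 2 * -(1 / (nsq φ + 1) * ‖herm ψ φ‖ ^ 2) +
        (1 / (nsq φ + 1)) ^ 2 * ‖herm ψ φ‖ ^ 2 * nsq φ =
        -(‖herm ψ φ‖ ^ 2 * ((nsq φ + 2) / (nsq φ + 1) ^ 2)) := by
      field_simp
      ring
    have h4 : 0 < (nsq φ + 2) / (nsq φ + 1) ^ 2 := by positivity
    have h5 : ‖herm ψ φ‖ ^ 2 * ((nsq φ + 2) / (nsq φ + 1) ^ 2) ≤ 0 := by linarith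
    exact nonpos_of_mul_nonpos_left h5 h4
  have h3 : ‖herm ψ φ‖ = 0 := by nlinarith [norm_nonneg (herm ψ φ)]
  exact norm_eq_zero.1 h3

lemma isBorelPair_leg {l : L} {M N : Matrix (Fin (d l)) (Fin (d l)) ℂ}
    (h : M * N.transpose = 1) (hM : ∀ i j, i < j → M i j = 0) (hN : ∀ i j, j < i → N i j = 0) :
    IsBorelPair (leg (ι := fun l => Fin (d l)) l M) (leg (ι := fun l => Fin (d l)) l N) := by
  refine ⟨fun r => ?_, fun r i j hij => ?_, fun r i j hij => ?_⟩
  all_goals by_cases hr : r = l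
  · subst hr; simpa [leg] using h
  · simp [leg, hr]
  · subst hr; simpa [leg] using hM i j hij
  · simp [leg, hr, hij.ne]
  · subst hr; simpa [leg] using hN i j hij
  · simp [leg, hr, hij.ne']

lemma charSq_leg (lam : ∀ l, Fin (d l) → ℝ) (l : L) (N : Matrix (Fin (d l)) (Fin (d l)) ℂ) :
    charSq lam (leg (ι := fun l => Fin (d l)) l N) = ∏ j, (‖N j j‖ ^ 2) ^ lam l j := by
  rw [charSq, Finset.prod_eq_single l]
  · simp [leg]
  · intro r _ hr
    simp [leg, hr]
  · simp

/-- A minimiser of the Kempf–Ness function has diagonal marginals. -/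
lemma marg_of_minimal {lam : ∀ l, Fin (d l) → ℝ} {ψ : (∀ l, Fin (d l)) → ℂ} (hψ : nsq ψ = 1)
    (hmin : ∀ g h, IsBorelPair g h → 1 ≤ nsq (tens g ψ) * charSq lam h) (l : L) :
    marg l ψ = Matrix.diagonal fun i => (lam l i : ℂ) := by
  have hoff : ∀ p q, q < p → marg l ψ q p = 0 := by
    intro p q hpq
    have h1 : marg l ψ q p = (marg l ψ * Matrix.single p q 1).trace := by
      simp [Matrix.trace_mul_single]
    rw [h1, trace_marg_mul]
    refine herm_eq_zero_of_forall_le fun z => ?_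
    have hsq : (Matrix.single p q (1 : ℂ)) * Matrix.single p q 1 = 0 :=
      Matrix.single_mul_single_of_ne _ _ _ _ hpq.ne _
    have hp : IsBorelPair (leg (ι := fun l => Fin (d l)) l (1 + z • Matrix.single p q 1))
        (leg (ι := fun l => Fin (d l)) l (1 - z • Matrix.single q p 1)) := by
      refine isBorelPair_leg ?_ ?_ ?_
      · rw [Matrix.transpose_sub, Matrix.transpose_smul, Matrix.transpose_single,
          Matrix.transpose_one, mul_sub, add_mul, add_mul, smul_mul_smul_comm, hsq]
        simp
      · intro i j hij
        have : ¬ (p = i ∧ q = j) := by rintro ⟨rfl, rfl⟩; exact lt_asymm hij hpq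
        simp [hij.ne, this]
      · intro i j hij
        have : ¬ (q = i ∧ p = j) := by rintro ⟨rfl, rfl⟩; exact lt_asymm hij hpq
        simp [hij.ne', this]
    have h2 := hmin _ _ hp
    have h3 : ∀ j, (1 - z • Matrix.single q p 1 : Matrix (Fin (d l)) (Fin (d l)) ℂ) j j = 1 := by
      intro j
      have : ¬ (q = j ∧ p = j) := by rintro ⟨rfl, rfl⟩; exact lt_irrefl _ hpq
      simp [this]
    have h4 : tens (leg (ι := fun l => Fin (d l)) l (1 + z • Matrix.single p q 1)) ψ =
        ψ + z • tens (leg (ι := fun l => Fin (d l)) l (Matrix.single p q 1)) ψ := by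
      funext w
      rw [Pi.add_apply, Pi.smul_apply, tens_leg, tens_leg]
      simp only [Matrix.add_apply, Matrix.smul_apply, add_mul, Finset.sum_add_distrib,
        smul_eq_mul, Finset.mul_sum, mul_assoc]
      congr 1
      rw [Finset.sum_eq_single (w l)]
      · simp
      · intro j _ hj; simp [hj.symm]
      · simp
    rw [charSq_leg, h4] at h2
    simp only [h3] at h2
    rw [hψ]
    simpa using h2
  ext p q
  rcases lt_trichotomy p q with h | rfl | h
  · rw [hoff q p h, Matrix.diagonal_apply_ne _ h.ne]
  · rw [Matrix.diagonal_apply_eq, marg_apply_self]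
    set ρ : ℝ := ∑ w, if w l = p then ‖ψ w‖ ^ 2 else 0 with hρ
    have hf : ∀ t : ℝ, 1 ≤ (1 + (Real.exp t - 1) * ρ) * Real.exp (-t * lam l p) := by
      intro t
      have hp : IsBorelPair (leg (ι := fun l => Fin (d l)) l
            (Matrix.diagonal fun i => ((if i = p then Real.exp (t / 2) else 1 : ℝ) : ℂ)))
          (leg (ι := fun l => Fin (d l)) l
            (Matrix.diagonal fun i => ((if i = p then Real.exp (-t / 2) else 1 : ℝ) : ℂ))) := by
        refine isBorelPair_leg ?_ (fun i j hij => Matrix.diagonal_apply_ne _ hij.ne)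
          (fun i j hij => Matrix.diagonal_apply_ne _ hij.ne')
        rw [Matrix.diagonal_transpose, Matrix.diagonal_mul_diagonal, ← Matrix.diagonal_one]
        congr 1
        funext i
        rw [← Complex.ofReal_mul]
        split_ifs
        · rw [← Real.exp_add]; simp [neg_div]
        · simp
      have h2 := hmin _ _ hp
      have h3 : nsq (tens (leg (ι := fun l => Fin (d l)) l (Matrix.diagonal fun i =>
          ((if i = p then Real.exp (t / 2) else 1 : ℝ) : ℂ))) ψ) = 1 + (Real.exp t - 1) * ρ := by
        refine Eq.trans ?_ (congrArg (· + (Real.exp t - 1) * ρ) hψ)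
        rw [hρ, nsq, nsq, Finset.mul_sum, ← Finset.sum_add_distrib]
        refine Finset.sum_congr rfl fun w _ => ?_
        rw [tens_leg, Finset.sum_eq_single (w l)]
        · rw [Matrix.diagonal_apply_eq, Function.update_eq_self, norm_mul, Complex.norm_real,
            mul_pow, Real.norm_eq_abs, sq_abs]
          split_ifs
          · rw [← Real.exp_nat_mul, Nat.cast_ofNat, mul_div_cancel₀ _ two_ne_zero]
            ring
          · ring
        · intro j _ hj; rw [Matrix.diagonal_apply_ne _ hj.symm, zero_mul]
        · simp
      rw [h3, charSq_leg, Finset.prod_eq_single p] at h2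
      · refine h2.trans_eq ?_
        rw [Matrix.diagonal_apply_eq, if_pos rfl, Complex.norm_real, Real.norm_eq_abs, sq_abs,
          ← Real.exp_nat_mul, ← Real.exp_mul, Nat.cast_ofNat, mul_div_cancel₀ _ two_ne_zero]
      · intro j _ hj
        simp [hj]
      · simp
    have hd : HasDerivAt (fun t : ℝ => (1 + (Real.exp t - 1) * ρ) * Real.exp (-t * lam l p))
        ((Real.exp 0 * ρ) * Real.exp (-0 * lam l p) + (1 + (Real.exp 0 - 1) * ρ) *
          (Real.exp (-0 * lam l p) * (-1 * lam l p))) 0 := by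
      refine HasDerivAt.mul ?_ ?_
      · exact (((Real.hasDerivAt_exp 0).sub_const 1).mul_const ρ).const_add 1
      · exact (((hasDerivAt_id (0 : ℝ)).neg).mul_const (lam l p)).exp
    have hmin0 : IsLocalMin
        (fun t : ℝ => (1 + (Real.exp t - 1) * ρ) * Real.exp (-t * lam l p)) 0 :=
      Filter.Eventually.of_forall fun t => by simpa using hf t
    have h0 := hmin0.hasDerivAt_eq_zero hd
    simp at h0
    congr 1
    linarith
  · rw [Matrix.diagonal_apply_ne _ h.ne', ← (marg_isHermitian l ψ).apply, hoff p q h, star_zero]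

/-- Convexity: a weighted mean of spectra of tensors with diagonal marginals is again attained. -/
theorem exists_marg_mean {I : Type} [Fintype I] {θ : I → ℝ} (hθ : ∀ i, 0 ≤ θ i)
    (hθ1 : ∑ i, θ i = 1) {lam : I → ∀ l, Fin (d l) → ℝ} (hlam : ∀ i l, Antitone (lam i l))
    (h0 : ∀ i l j, 0 ≤ lam i l j) {ψ : I → (∀ l, Fin (d l)) → ℂ} (hψ : ∀ i, nsq (ψ i) = 1)
    (hm : ∀ i l, marg l (ψ i) = Matrix.diagonal fun j => (lam i l j : ℂ)) :
    ∃ φ : (∀ l, Fin (d l)) → ℂ, nsq φ = 1 ∧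
      ∀ l, marg l φ = Matrix.diagonal fun j => ((∑ i, θ i * lam i l j : ℝ) : ℂ) := by
  obtain ⟨χ, hχ⟩ := exists_common_stable Finset.univ lam hlam h0
    fun i _ => ⟨ψ i, isStableTensor_of_marg (hψ i) (hm i)⟩
  have hcap : ∀ i, HasCap (lam i) χ := fun i => (hχ i (Finset.mem_univ i)).hasCap (hlam i) (h0 i)
  have hI : Nonempty I := by
    by_contra hI
    rw [not_nonempty_iff] at hI
    simp at hθ1
  have hχ0 : χ ≠ 0 := by
    rintro rfl
    obtain ⟨i⟩ := hI
    obtain ⟨ε, hε, hb⟩ := hcap i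
    have h1 := hb (fun _ => 1) (fun _ => 1) fun l => by simp
    have h2 : capFun (lam i) (0 : (∀ l, Fin (d l)) → ℂ) (fun _ => 1) (fun _ => 1) = 0 := by
      refine Finset.prod_eq_zero (Finset.mem_univ none) ?_
      change nsq (tens (fun _ => 1) 0) ^ (1 : ℝ) = 0
      rw [tens_one]
      simp [nsq]
    linarith
  obtain ⟨ε, hε, hb⟩ := exists_le_nsq_mul_charSq hθ hθ1 hχ0 hcap
  obtain ⟨φ, hφ, hmin⟩ := exists_minimal hχ0 hε hb
  exact ⟨φ, hφ, marg_of_minimal hφ hmin⟩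

end Borel

section Spectra

lemma eq_of_antitone_of_map_eq {n : ℕ} {f g : Fin n → ℝ} (hf : Antitone f) (hg : Antitone g)
    (h : Multiset.map f Finset.univ.val = Multiset.map g Finset.univ.val) : f = g := by
  rw [Fin.univ_val_map, Fin.univ_val_map, Multiset.coe_eq_coe] at h
  exact List.ofFn_injective (h.eq_of_sortedGE hf.sortedGE_ofFn hg.sortedGE_ofFn)

lemma exists_isSpecDown {n : ℕ} {ρ : Matrix (Fin n) (Fin n) ℂ} (hρ : ρ.IsHermitian) :
    ∃ lam, IsSpecDown ρ lam := by
  refine ⟨hρ.eigenvalues ∘ Tuple.sort (-hρ.eigenvalues), ?_, hρ, _, rfl⟩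
  intro i j hij
  have := Tuple.monotone_sort (-hρ.eigenvalues) hij
  simpa using this

lemma isSpecDown_iff {n : ℕ} {ρ : Matrix (Fin n) (Fin n) ℂ} {lam : Fin n → ℝ} :
    IsSpecDown ρ lam ↔ Antitone lam ∧ ∃ U : Matrix (Fin n) (Fin n) ℂ, U.conjTranspose * U = 1 ∧
      ρ = U * Matrix.diagonal (fun i => (lam i : ℂ)) * U.conjTranspose := by
  constructor
  · rintro ⟨ha, hρ, σ, rfl⟩
    refine ⟨ha, ((hρ.eigenvectorUnitary : Matrix (Fin n) (Fin n) ℂ)).submatrix id σ, ?_, ?_⟩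
    · have h1 := Matrix.mem_unitaryGroup_iff'.1 hρ.eigenvectorUnitary.2
      rw [Matrix.conjTranspose_submatrix, ← Matrix.submatrix_mul _ _ _ _ _ Function.bijective_id]
      rw [Matrix.star_eq_conjTranspose] at h1
      rw [h1, Matrix.submatrix_one_equiv]
    · have h1 : ρ = (hρ.eigenvectorUnitary : Matrix (Fin n) (Fin n) ℂ) *
          Matrix.diagonal (fun i => (hρ.eigenvalues i : ℂ)) *
          (hρ.eigenvectorUnitary : Matrix (Fin n) (Fin n) ℂ).conjTranspose :=
        hρ.spectral_theorem
      conv_lhs => rw [h1]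
      ext i j
      rw [Matrix.mul_apply, Matrix.mul_apply, ← Equiv.sum_comp σ]
      refine Finset.sum_congr rfl fun k _ => ?_
      rw [Matrix.mul_diagonal, Matrix.mul_diagonal]
      rfl
  · rintro ⟨ha, U, hU, h⟩
    have hρ : ρ.IsHermitian := by
      rw [Matrix.IsHermitian, h, Matrix.conjTranspose_mul, Matrix.conjTranspose_mul,
        Matrix.diagonal_conjTranspose, Matrix.conjTranspose_conjTranspose, Matrix.mul_assoc]
      congr 3
      funext i; simp
    obtain ⟨lam', hl⟩ := exists_isSpecDown hρ
    have hl' := hl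
    obtain ⟨ha', hρ', σ, hσ⟩ := hl
    have h1 : ρ.charpoly = (Matrix.diagonal (fun i => (lam i : ℂ))).charpoly := by
      rw [h, Matrix.charpoly_mul_comm, ← mul_assoc, hU, one_mul]
    have h2 : ρ.charpoly.roots = Multiset.map (fun i => (lam i : ℂ)) Finset.univ.val := by
      rw [h1, Matrix.charpoly_diagonal, Polynomial.roots_prod]
      · simp
      · simp [Finset.prod_ne_zero_iff, Polynomial.X_sub_C_ne_zero]
    rw [hρ.roots_charpoly_eq_eigenvalues] at h2
    have h3 : Multiset.map lam Finset.univ.val = Multiset.map hρ.eigenvalues Finset.univ.val := by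
      have := congrArg (Multiset.map Complex.re) h2
      simpa [Multiset.map_map, Function.comp_def] using this.symm
    have h4 : lam = lam' := by
      refine eq_of_antitone_of_map_eq ha ha' (h3.trans ?_)
      rw [hσ, ← Multiset.map_map, Multiset.map_univ_val_equiv]
    rw [h4]
    exact hl'

end Spectra

section Perturbation

lemma concentrated_eigenvector {n : ℕ} {A : Matrix (Fin n) (Fin n) ℂ} {a : Fin n → ℝ} {γ ε δ : ℝ}
    (hγ : 0 < γ) (hε : 0 ≤ ε) (hgap : ∀ i j, i ≠ j → γ ≤ |a i - a j|)
    (hdiag : ∀ i, A i i = (a i : ℂ)) (hoff : ∀ i j, i ≠ j → ‖A i j‖ ≤ ε)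
    (hδ : n * ε = γ * δ / 2) (hδ1 : δ ≤ 1) {v : Fin n → ℂ} (hv : v ≠ 0) {t : ℝ}
    (h : A.mulVec v = (t : ℂ) • v) :
    ∃ i, v i ≠ 0 ∧ |t - a i| ≤ γ * δ / 2 * δ ∧ ∀ j, j ≠ i → ‖v j‖ ≤ δ * ‖v i‖ := by
  obtain ⟨i0, hi0⟩ := Function.ne_iff.1 hv
  have : Nonempty (Fin n) := ⟨i0⟩
  obtain ⟨i, hi⟩ := Finite.exists_max fun i => ‖v i‖
  have hvi : 0 < ‖v i‖ := (norm_pos_iff.2 hi0).trans_le (hi i0)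
  have hδ0 : 0 ≤ δ := by
    have h1 : 0 ≤ n * ε := by positivity
    rw [hδ] at h1
    by_contra hneg
    nlinarith
  have heq : ∀ j, ((t - a j : ℝ) : ℂ) * v j = ∑ k ∈ Finset.univ.erase j, A j k * v k := by
    intro j
    have h1 := congrFun h j
    rw [Matrix.mulVec, dotProduct, ← Finset.add_sum_erase _ _ (Finset.mem_univ j), hdiag,
      Pi.smul_apply, smul_eq_mul] at h1
    push_cast
    linear_combination -h1
  have hbound : ∀ j (M : ℝ), 0 ≤ M → (∀ k, k ≠ j → ‖v k‖ ≤ M) →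
      |t - a j| * ‖v j‖ ≤ γ * δ / 2 * M := by
    intro j M hM0 hM
    have h1 : |t - a j| * ‖v j‖ = ‖∑ k ∈ Finset.univ.erase j, A j k * v k‖ := by
      rw [← heq, norm_mul, Complex.norm_real, Real.norm_eq_abs]
    rw [h1, ← hδ]
    refine (norm_sum_le _ _).trans ?_
    refine (Finset.sum_le_card_nsmul _ _ (ε * M) fun k hk => ?_).trans ?_
    · rw [norm_mul]
      have hkj := Finset.ne_of_mem_erase hk
      exact mul_le_mul (hoff j k hkj.symm) (hM k hkj) (norm_nonneg _) hε
    · rw [nsmul_eq_mul, mul_assoc]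
      refine mul_le_mul_of_nonneg_right ?_ (by positivity)
      exact_mod_cast (Finset.card_le_univ _).trans_eq (Fintype.card_fin n)
  have h1 : |t - a i| ≤ γ * δ / 2 := by
    have := hbound i ‖v i‖ hvi.le fun k _ => hi k
    exact le_of_mul_le_mul_right this hvi
  have h2 : ∀ j, j ≠ i → ‖v j‖ ≤ δ * ‖v i‖ := by
    intro j hj
    have h3 := hbound j ‖v i‖ hvi.le fun k _ => hi k
    have h4 : γ / 2 ≤ |t - a j| := by
      have h5 := hgap i j hj.symm
      have h6 : |a i - a j| ≤ |t - a i| + |t - a j| := by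
        rw [abs_sub_comm t (a i)]
        have := abs_add_le (a i - t) (t - a j)
        simpa using this
      nlinarith
    have h5 : γ / 2 * ‖v j‖ ≤ γ / 2 * (δ * ‖v i‖) := by
      calc γ / 2 * ‖v j‖ ≤ |t - a j| * ‖v j‖ := mul_le_mul_of_nonneg_right h4 (norm_nonneg _)
        _ ≤ γ * δ / 2 * ‖v i‖ := h3
        _ = γ / 2 * (δ * ‖v i‖) := by ring
    exact le_of_mul_le_mul_left h5 (by positivity)
  refine ⟨i, norm_pos_iff.1 hvi, ?_, h2⟩
  have h3 := hbound i (δ * ‖v i‖) (by positivity) h2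
  rw [← mul_assoc] at h3
  exact le_of_mul_le_mul_right h3 hvi

lemma eq_id_of_strictMono {n : ℕ} {f : Fin n → Fin n} (hf : StrictMono f) (i : Fin n) :
    f i = i := by
  have := Subsingleton.elim
    (hf.orderIsoOfSurjective f (Finite.surjective_of_injective hf.injective))
    (OrderIso.refl (Fin n))
  exact congrArg (fun e : Fin n ≃o Fin n => e i) this

/-- The sorted spectrum of a nearly diagonal Hermitian matrix agrees with the diagonal up to second
order in the off-diagonal part. -/
lemma spec_close {n : ℕ} {A : Matrix (Fin n) (Fin n) ℂ} {a : Fin n → ℝ} {γ ε δ : ℝ}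
    (hγ : 0 < γ) (hε : 0 ≤ ε) (hgap : ∀ i j, i < j → γ ≤ a i - a j)
    (hdiag : ∀ i, A i i = (a i : ℂ)) (hoff : ∀ i j, i ≠ j → ‖A i j‖ ≤ ε)
    (hδ : n * ε = γ * δ / 2) (hδ1 : δ ≤ 1 / 2) (hδ2 : n * (δ * δ) < 1)
    {lam : Fin n → ℝ} (h : IsSpecDown A lam) (k : Fin n) : |lam k - a k| ≤ γ * δ / 2 * δ := by
  obtain ⟨hanti, U, hU, hA⟩ := isSpecDown_iff.1 h
  have hgap' : ∀ i j, i ≠ j → γ ≤ |a i - a j| := by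
    intro i j hij
    rcases lt_or_gt_of_ne hij with h | h
    · exact (hgap i j h).trans (le_abs_self _)
    · rw [abs_sub_comm]; exact (hgap j i h).trans (le_abs_self _)
  have hAU : A * U = U * Matrix.diagonal (fun i => (lam i : ℂ)) := by
    rw [hA, mul_assoc, hU, mul_one]
  have hcol : ∀ k, A.mulVec (fun i => U i k) = (lam k : ℂ) • fun i => U i k := by
    intro k
    funext i
    have := congrFun (congrFun hAU i) k
    rw [Matrix.mul_diagonal, Matrix.mul_apply] at this
    rw [Pi.smul_apply, smul_eq_mul, mul_comm, ← this]
    rfl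
  have hne : ∀ k, (fun i => U i k) ≠ 0 := by
    intro k h0
    have := congrFun (congrFun hU k) k
    rw [Matrix.mul_apply, Finset.sum_eq_zero, Matrix.one_apply_eq] at this
    · exact zero_ne_one this
    · intro i _
      rw [show U i k = 0 from congrFun h0 i, mul_zero]
  choose f hf0 hf1 hf2 using fun k => concentrated_eigenvector hγ hε hgap' hdiag hoff hδ
    (hδ1.trans (by norm_num)) (hne k) (hcol k)
  have hδ0 : 0 ≤ δ := by
    have h1 : 0 ≤ n * ε := by positivity
    rw [hδ] at h1
    by_contra hneg
    nlinarith
  have hinj : Function.Injective f := by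
    intro k k' hkk
    by_contra hne
    have h1 := congrFun (congrFun hU k) k'
    rw [Matrix.mul_apply, Matrix.one_apply_ne hne,
      ← Finset.add_sum_erase _ _ (Finset.mem_univ (f k))] at h1
    have h2 := norm_pos_iff.2 (hf0 k)
    have h3 := norm_pos_iff.2 (hf0 k')
    rw [← hkk] at h3
    have h4 : ‖U (f k) k‖ * ‖U (f k) k'‖ ≤ n * (δ * δ) * (‖U (f k) k‖ * ‖U (f k) k'‖) := by
      calc ‖U (f k) k‖ * ‖U (f k) k'‖
          = ‖∑ i ∈ Finset.univ.erase (f k), U.conjTranspose k i * U i k'‖ := by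
            rw [← norm_neg (∑ i ∈ Finset.univ.erase (f k), U.conjTranspose k i * U i k'),
              ← eq_neg_of_add_eq_zero_left h1, norm_mul, Matrix.conjTranspose_apply, norm_star]
        _ ≤ (Finset.univ.erase (f k)).card • ((δ * ‖U (f k) k‖) * (δ * ‖U (f k) k'‖)) := by
            refine (norm_sum_le _ _).trans (Finset.sum_le_card_nsmul _ _ _ fun i hi => ?_)
            have hi' := Finset.ne_of_mem_erase hi
            rw [norm_mul, Matrix.conjTranspose_apply, norm_star]
            refine mul_le_mul (hf2 k i hi') ?_ (norm_nonneg _) (by positivity)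
            have := hf2 k' i (hkk ▸ hi')
            rwa [← hkk] at this
        _ ≤ n * (δ * δ) * (‖U (f k) k‖ * ‖U (f k) k'‖) := by
            rw [nsmul_eq_mul]
            have : ((Finset.univ.erase (f k)).card : ℝ) ≤ n := by
              exact_mod_cast (Finset.card_le_univ _).trans_eq (Fintype.card_fin n)
            calc _ ≤ (n : ℝ) * ((δ * ‖U (f k) k‖) * (δ * ‖U (f k) k'‖)) :=
                  mul_le_mul_of_nonneg_right this (by positivity)
              _ = _ := by ring
    have h5 := mul_pos h2 h3
    nlinarith
  have hmono : StrictMono f := by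
    intro k k' hk
    refine lt_of_le_of_ne ?_ fun h => hk.ne (hinj h)
    by_contra hlt
    push Not at hlt
    have h1 := hgap _ _ hlt
    have h2 := hanti hk.le
    have h3 := abs_le.1 (hf1 k)
    have h4 := abs_le.1 (hf1 k')
    have h5 : γ * δ / 2 * δ ≤ γ / 8 := by
      have : δ * δ ≤ 1 / 4 := by nlinarith
      nlinarith
    linarith
  have := hf1 k
  rwa [eq_id_of_strictMono hmono k] at this

end Perturbation

open scoped Topology

section FirstOrder

variable {L : Type} [Fintype L] [DecidableEq L] {d : L → ℕ}

/-- The weight of a multi-index with respect to a family of local diagonal Hamiltonians. -/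
def weight (h : ∀ l, Fin (d l) → ℝ) (w : ∀ l, Fin (d l)) : ℝ := ∑ l, h l (w l)

lemma sum_marg_diagonal (h : ∀ l, Fin (d l) → ℝ) (p : (∀ l, Fin (d l)) → ℝ) :
    ∑ l, ∑ i, h l i * (∑ w, if w l = i then p w else 0) = ∑ w, weight h w * p w := by
  have : ∀ l, ∑ i, h l i * (∑ w, if w l = i then p w else 0) = ∑ w, h l (w l) * p w := by
    intro l
    simp only [Finset.mul_sum]
    rw [Finset.sum_comm]
    refine Finset.sum_congr rfl fun w _ => ?_
    simp
  simp only [this, weight, Finset.sum_mul]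
  exact Finset.sum_comm

/-- The first-order perturbation `(1 - t μ) ψ` of a tensor along its weights. -/
def tilt (h : ∀ l, Fin (d l) → ℝ) (t : ℝ) (ψ : (∀ l, Fin (d l)) → ℂ) : (∀ l, Fin (d l)) → ℂ :=
  fun w => ((1 - t * weight h w : ℝ) : ℂ) * ψ w

/-- The diagonal entries of the marginals of `tilt`. -/
def tiltDiag (h : ∀ l, Fin (d l) → ℝ) (t : ℝ) (ψ : (∀ l, Fin (d l)) → ℂ) (l : L)
    (i : Fin (d l)) : ℝ :=
  ∑ w, if w l = i then (1 - t * weight h w) ^ 2 * ‖ψ w‖ ^ 2 else 0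

lemma marg_tilt_self (h : ∀ l, Fin (d l) → ℝ) (t : ℝ) (ψ : (∀ l, Fin (d l)) → ℂ) (l : L)
    (i : Fin (d l)) : marg l (tilt h t ψ) i i = (tiltDiag h t ψ l i : ℂ) := by
  rw [marg_apply_self]
  congr 1
  refine Finset.sum_congr rfl fun w _ => ?_
  split_ifs
  · rw [tilt, norm_mul, mul_pow, Complex.norm_real, Real.norm_eq_abs, sq_abs]
  · rfl

lemma continuous_tiltDiag (h : ∀ l, Fin (d l) → ℝ) (ψ : (∀ l, Fin (d l)) → ℂ) (l : L)
    (i : Fin (d l)) : Continuous fun t => tiltDiag h t ψ l i := by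
  unfold tiltDiag
  refine continuous_finsetSum _ fun w _ => ?_
  split_ifs <;> fun_prop

lemma tilt_offdiag_le (h : ∀ l, Fin (d l) → ℝ) (ψ : (∀ l, Fin (d l)) → ℂ) (l : L)
    (i j : Fin (d l)) (h0 : marg l ψ i j = 0) :
    ∃ C, 0 ≤ C ∧ ∀ t, 0 ≤ t → t ≤ 1 → ‖marg l (tilt h t ψ) i j‖ ≤ C * t := by
  refine ⟨∑ w : (∀ l, Fin (d l)), (|weight h w| + |weight h (Function.update w l j)|
    + |weight h w| * |weight h (Function.update w l j)|) *
      (‖ψ w‖ * ‖ψ (Function.update w l j)‖), Finset.sum_nonneg fun w _ => by positivity, ?_⟩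
  intro t ht0 ht1
  have e : marg l (tilt h t ψ) i j = marg l (tilt h t ψ) i j - marg l ψ i j := by
    rw [h0, sub_zero]
  rw [e]
  simp only [marg, Matrix.of_apply]
  rw [← Finset.sum_sub_distrib, Finset.sum_mul]
  refine (norm_sum_le _ _).trans (Finset.sum_le_sum fun w _ => ?_)
  split_ifs
  · set w' := Function.update w l j
    have e2 : tilt h t ψ w * (starRingEnd ℂ) (tilt h t ψ w') - ψ w * (starRingEnd ℂ) (ψ w')
        = (((1 - t * weight h w) * (1 - t * weight h w') - 1 : ℝ) : ℂ) *
          (ψ w * (starRingEnd ℂ) (ψ w')) := by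
      simp only [tilt, map_mul, Complex.conj_ofReal]
      push_cast
      ring
    rw [e2, norm_mul, norm_mul, RCLike.norm_conj, Complex.norm_real, Real.norm_eq_abs,
      mul_right_comm]
    refine mul_le_mul_of_nonneg_right ?_ (by positivity)
    have e3 : (1 - t * weight h w) * (1 - t * weight h w') - 1
        = t * (-weight h w + -weight h w' + t * (weight h w * weight h w')) := by ring
    rw [e3, abs_mul, abs_of_nonneg ht0, mul_comm]
    refine mul_le_mul_of_nonneg_right ?_ ht0
    refine (abs_add_le _ _).trans (add_le_add ((abs_add_le _ _).trans ?_) ?_)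
    · rw [abs_neg, abs_neg]
    · rw [abs_mul, abs_mul, abs_of_nonneg ht0]
      exact mul_le_of_le_one_left (by positivity) ht1
  · simp only [sub_zero, norm_zero]
    positivity

lemma exists_pos_gap {lam : ∀ l, Fin (d l) → ℝ} (hlam : ∀ l, StrictAnti (lam l)) :
    ∃ γ, 0 < γ ∧ ∀ l i j, i < j → γ < lam l i - lam l j := by
  have h : ∀ᶠ γ in 𝓝[>] (0 : ℝ), 0 < γ ∧ ∀ l i j, i < j → γ < lam l i - lam l j := by
    refine (eventually_mem_nhdsWithin).and ?_
    refine Filter.eventually_all.2 fun l => Filter.eventually_all.2 fun i =>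
      Filter.eventually_all.2 fun j => ?_
    by_cases hij : i < j
    · have : 0 < lam l i - lam l j := sub_pos.2 (hlam l hij)
      filter_upwards [nhdsWithin_le_nhds (Iio_mem_nhds this)] with γ hγ _
      exact hγ
    · exact Filter.Eventually.of_forall fun γ h => absurd h hij
  exact h.exists

/-- Along `tilt`, the spectra of the marginals agree with their diagonals to first order. -/
lemma tilt_spec_close {ψ : (∀ l, Fin (d l)) → ℂ} {lam : ∀ l, Fin (d l) → ℝ}
    (hm : ∀ l, marg l ψ = Matrix.diagonal fun j => (lam l j : ℂ))
    (hlam : ∀ l, StrictAnti (lam l)) (h : ∀ l, Fin (d l) → ℝ) :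
    ∃ K, ∀ᶠ t in 𝓝[>] (0 : ℝ), ∀ l, ∀ lam' : Fin (d l) → ℝ,
      IsSpecDown (marg l (tilt h t ψ)) lam' →
        ∀ i, |lam' i - tiltDiag h t ψ l i| ≤ K * t ^ 2 := by
  obtain ⟨γ, hγ, hgap⟩ := exists_pos_gap hlam
  have hoff : ∀ l (i j : Fin (d l)), ∃ C, 0 ≤ C ∧ (i ≠ j → ∀ t, 0 ≤ t → t ≤ 1 →
      ‖marg l (tilt h t ψ) i j‖ ≤ C * t) := by
    intro l i j
    by_cases hij : i = j
    · exact ⟨0, le_rfl, fun h => absurd hij h⟩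
    · obtain ⟨C, hC, hC'⟩ := tilt_offdiag_le h ψ l i j (by
        rw [hm, Matrix.diagonal_apply_ne _ hij])
      exact ⟨C, hC, fun _ => hC'⟩
  choose C hC0 hC using hoff
  obtain ⟨D, hD0, hD⟩ : ∃ D, 0 ≤ D ∧ ∀ l i j, C l i j ≤ D := by
    refine ⟨∑ l, ∑ i, ∑ j, C l i j, Finset.sum_nonneg fun l _ => Finset.sum_nonneg fun i _ =>
      Finset.sum_nonneg fun j _ => hC0 _ _ _, fun l i j => ?_⟩
    calc C l i j ≤ ∑ j, C l i j :=
          Finset.single_le_sum (f := fun j => C l i j) (fun j _ => hC0 l i j) (Finset.mem_univ j)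
      _ ≤ ∑ i, ∑ j, C l i j :=
          Finset.single_le_sum (f := fun i => ∑ j, C l i j)
            (fun i _ => Finset.sum_nonneg fun j _ => hC0 _ _ _) (Finset.mem_univ i)
      _ ≤ _ := Finset.single_le_sum (f := fun l => ∑ i, ∑ j, C l i j)
            (fun l _ => Finset.sum_nonneg fun i _ => Finset.sum_nonneg fun j _ => hC0 _ _ _)
            (Finset.mem_univ l)
  have hdiag0 : ∀ l i, tiltDiag h 0 ψ l i = lam l i := by
    intro l i
    have h1 := marg_tilt_self h 0 ψ l i
    have h2 : tilt h 0 ψ = ψ := by funext w; simp [tilt]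
    rw [h2, hm, Matrix.diagonal_apply_eq] at h1
    exact_mod_cast h1.symm
  set N : ℕ := ∑ l, d l with hN
  have hdN : ∀ l, (d l : ℝ) ≤ N := fun l => by
    exact_mod_cast Finset.single_le_sum (f := d) (fun _ _ => Nat.zero_le _) (Finset.mem_univ l)
  refine ⟨γ * (2 * N * D / γ) ^ 2 / 2, ?_⟩
  have hg : ∀ᶠ t in 𝓝[>] (0 : ℝ), ∀ l i j, i < j →
      γ ≤ tiltDiag h t ψ l i - tiltDiag h t ψ l j := by
    refine Filter.eventually_all.2 fun l => Filter.eventually_all.2 fun i =>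
      Filter.eventually_all.2 fun j => ?_
    by_cases hij : i < j
    · have hc : Filter.Tendsto (fun t => tiltDiag h t ψ l i - tiltDiag h t ψ l j) (𝓝[>] 0)
          (𝓝 (tiltDiag h 0 ψ l i - tiltDiag h 0 ψ l j)) :=
        (((continuous_tiltDiag h ψ l i).sub (continuous_tiltDiag h ψ l j)).tendsto 0).mono_left
          nhdsWithin_le_nhds
      rw [hdiag0, hdiag0] at hc
      filter_upwards [hc.eventually (lt_mem_nhds (hgap l i j hij))] with t ht _
      exact ht.le
    · exact Filter.Eventually.of_forall fun γ h => absurd h hij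
  have h1 : ∀ᶠ t in 𝓝[>] (0 : ℝ), 2 * N * D * t / γ < 1 / 2 := by
    have : Filter.Tendsto (fun t : ℝ => 2 * N * D * t / γ) (𝓝[>] 0) (𝓝 (2 * N * D * 0 / γ)) :=
      ((by fun_prop : Continuous fun t : ℝ => 2 * N * D * t / γ).tendsto 0).mono_left
        nhdsWithin_le_nhds
    exact this.eventually (gt_mem_nhds (by norm_num))
  have h2 : ∀ᶠ t in 𝓝[>] (0 : ℝ), N * ((2 * N * D * t / γ) * (2 * N * D * t / γ)) < 1 := by
    have : Filter.Tendsto (fun t : ℝ => N * ((2 * N * D * t / γ) * (2 * N * D * t / γ)))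
        (𝓝[>] 0) (𝓝 (N * ((2 * N * D * 0 / γ) * (2 * N * D * 0 / γ)))) :=
      ((by fun_prop : Continuous fun t : ℝ =>
        N * ((2 * N * D * t / γ) * (2 * N * D * t / γ))).tendsto 0).mono_left nhdsWithin_le_nhds
    exact this.eventually (gt_mem_nhds (by norm_num))
  have h3 : ∀ᶠ t in 𝓝[>] (0 : ℝ), t ≤ 1 :=
    nhdsWithin_le_nhds (Iic_mem_nhds one_pos)
  filter_upwards [hg, h1, h2, h3, eventually_mem_nhdsWithin] with t hg h1 h2 h3 h4 l lam' hs i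
  have ht : 0 < t := h4
  have hle : 2 * d l * D * t / γ ≤ 2 * N * D * t / γ := by
    have := hdN l
    gcongr
  have hnn : 0 ≤ 2 * d l * D * t / γ := by positivity
  have key := spec_close (δ := 2 * d l * D * t / γ) hγ (mul_nonneg hD0 ht.le) (hg l)
    (marg_tilt_self h t ψ l)
    (fun i j hij => (hC l i j hij t ht.le h3).trans
      (mul_le_mul_of_nonneg_right (hD l i j) ht.le))
    (by field_simp) (hle.trans h1.le)
    (lt_of_le_of_lt (by have := hdN l; gcongr) h2) hs i
  refine key.trans ?_
  calc γ * (2 * d l * D * t / γ) / 2 * (2 * d l * D * t / γ)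
      ≤ γ * (2 * N * D * t / γ) / 2 * (2 * N * D * t / γ) := by gcongr
    _ = _ := by ring

/-- If the functional `h` is nonnegative on all marginal spectra and vanishes at a regular
spectrum, then any tensor with diagonal marginals realizing it is supported on weight zero. -/
lemma weight_eq_zero_of_min {ψ : (∀ l, Fin (d l)) → ℂ} {lam : ∀ l, Fin (d l) → ℝ}
    (hm : ∀ l, marg l ψ = Matrix.diagonal fun j => (lam l j : ℂ))
    (hlam : ∀ l, StrictAnti (lam l)) (h : ∀ l, Fin (d l) → ℝ)
    (hnn : ∀ (φ : (∀ l, Fin (d l)) → ℂ) (lam' : ∀ l, Fin (d l) → ℝ),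
      (∀ l : L, IsSpecDown (marg l φ) (lam' l)) →
      0 ≤ ∑ l, ∑ i, h l i * lam' l i)
    (h0 : ∑ l, ∑ i, h l i * lam l i = 0) (w : ∀ l, Fin (d l)) (hw : ψ w ≠ 0) :
    weight h w = 0 := by
  obtain ⟨K, hK⟩ := tilt_spec_close hm hlam h
  have hdiag : ∀ l i, lam l i = ∑ w, (if w l = i then ‖ψ w‖ ^ 2 else 0) := by
    intro l i
    have h1 := marg_apply_self l ψ i
    rw [hm, Matrix.diagonal_apply_eq] at h1
    exact_mod_cast h1
  have e0 : ∑ w, weight h w * ‖ψ w‖ ^ 2 = 0 := by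
    rw [← sum_marg_diagonal h fun w => ‖ψ w‖ ^ 2]
    simpa only [hdiag] using h0
  set S := ∑ w, weight h w ^ 2 * ‖ψ w‖ ^ 2 with hS
  set T := ∑ w, weight h w ^ 3 * ‖ψ w‖ ^ 2 with hT
  set M := ∑ l, ∑ i, |h l i| with hM
  have hev : ∀ᶠ t in 𝓝[>] (0 : ℝ), S ≤ (T + M * K) * t / 2 := by
    filter_upwards [hK, eventually_mem_nhdsWithin] with t ht ht0
    have ht0 : 0 < t := ht0
    have hex : ∀ l : L, ∃ lam', IsSpecDown (marg l (tilt h t ψ)) lam' := fun l =>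
      exists_isSpecDown (marg_isHermitian l _)
    choose lam' hlam' using hex
    have key := hnn _ _ hlam'
    have e1 : ∑ l, ∑ i, h l i * tiltDiag h t ψ l i = -2 * t * S + t ^ 2 * T := by
      unfold tiltDiag
      rw [sum_marg_diagonal h (fun w => (1 - t * weight h w) ^ 2 * ‖ψ w‖ ^ 2), 
        ← zero_add (-2 * t * S), ← e0, hS, hT, Finset.mul_sum, Finset.mul_sum,
        ← Finset.sum_add_distrib, ← Finset.sum_add_distrib]
      exact Finset.sum_congr rfl fun w _ => by ring
    have e2 : ∑ l, ∑ i, h l i * lam' l i ≤ ∑ l, ∑ i, h l i * tiltDiag h t ψ l i +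
        M * (K * t ^ 2) := by
      rw [hM, Finset.sum_mul, ← Finset.sum_add_distrib]
      refine Finset.sum_le_sum fun l _ => ?_
      rw [Finset.sum_mul, ← Finset.sum_add_distrib]
      refine Finset.sum_le_sum fun i _ => ?_
      have := ht l (lam' l) (hlam' l) i
      have h5 : h l i * (lam' l i - tiltDiag h t ψ l i) ≤ |h l i| * (K * t ^ 2) := by
        refine (le_abs_self _).trans ?_
        rw [abs_mul]
        exact mul_le_mul_of_nonneg_left this (abs_nonneg _)
      linarith
    rw [e1] at e2
    have : t * S ≤ t * ((T + M * K) * t / 2) := by nlinarith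
    exact le_of_mul_le_mul_left this ht0
  have hlim : Filter.Tendsto (fun t : ℝ => (T + M * K) * t / 2) (𝓝[>] 0)
      (𝓝 ((T + M * K) * 0 / 2)) :=
    ((by fun_prop : Continuous fun t : ℝ => (T + M * K) * t / 2).tendsto 0).mono_left
      nhdsWithin_le_nhds
  have hS0 : S ≤ 0 := by simpa using ge_of_tendsto hlim hev
  have hS1 : S = 0 := le_antisymm hS0 (Finset.sum_nonneg fun w _ => by positivity)
  have := (Finset.sum_eq_zero_iff_of_nonneg (fun w _ => by positivity)).1 hS1 w
    (Finset.mem_univ w)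
  simpa [hw] using this

end FirstOrder

section Faces

variable {L : Type} [Fintype L] [DecidableEq L] {d : L → ℕ}

lemma marg_smul (l : L) (z : ℂ) (ψ : (∀ l, Fin (d l)) → ℂ) :
    marg l (z • ψ) = ((‖z‖ ^ 2 : ℝ) : ℂ) • marg l ψ := by
  ext i j
  simp only [marg, Matrix.of_apply, Matrix.smul_apply, smul_eq_mul, Pi.smul_apply, Finset.mul_sum,
    map_mul]
  refine Finset.sum_congr rfl fun w _ => ?_
  split_ifs
  · rw [← Complex.normSq_eq_norm_sq, ← Complex.mul_conj]
    ring
  · simp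

/-- The cone of all families of marginal spectra. -/
def specCone (d : L → ℕ) : Set (∀ l, Fin (d l) → ℝ) :=
  {lam | ∃ φ : (∀ l, Fin (d l)) → ℂ, ∀ l : L, IsSpecDown (marg l φ) (lam l)}

/-- Ordered families realized as diagonal marginals of a unit tensor. -/
def unitSpec (d : L → ℕ) : Set (∀ l, Fin (d l) → ℝ) :=
  {lam | (∀ l, Antitone (lam l)) ∧ ∃ φ : (∀ l, Fin (d l)) → ℂ, nsq φ = 1 ∧
    ∀ l, marg l φ = Matrix.diagonal fun j => (lam l j : ℂ)}

/-- The linear functional on families of spectra given by local diagonal Hamiltonians. -/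
def pairing (h : ∀ l, Fin (d l) → ℝ) : (∀ l, Fin (d l) → ℝ) →ₗ[ℝ] ℝ where
  toFun v := ∑ l, ∑ i, h l i * v l i
  map_add' u v := by simp [mul_add, Finset.sum_add_distrib]
  map_smul' t v := by
    simp only [Pi.smul_apply, smul_eq_mul, Finset.mul_sum, RingHom.id_apply]
    exact Finset.sum_congr rfl fun _ _ => Finset.sum_congr rfl fun _ _ => by ring

lemma pairing_apply (h v : ∀ l, Fin (d l) → ℝ) : pairing h v = ∑ l, ∑ i, h l i * v l i := rfl

/-- The family of point masses at a multi-index. -/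
def pointMass (w : ∀ l, Fin (d l)) : ∀ l, Fin (d l) → ℝ := fun l => Pi.single (w l) 1

lemma pairing_pointMass (h : ∀ l, Fin (d l) → ℝ) (w : ∀ l, Fin (d l)) :
    pairing h (pointMass w) = weight h w := by
  simp [pairing_apply, pointMass, weight, Pi.single_apply]

/-- Families of vectors with a common total. -/
def sameTotal (d : L → ℕ) : Submodule ℝ (∀ l, Fin (d l) → ℝ) where
  carrier := {v | ∀ l m, ∑ i, v l i = ∑ i, v m i}
  add_mem' := by
    intro u v hu hv l m
    simp only [Pi.add_apply, Finset.sum_add_distrib, hu l m, hv l m]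
  zero_mem' := by intro l m; simp
  smul_mem' := by
    intro t v hv l m
    simp only [Pi.smul_apply, smul_eq_mul, ← Finset.mul_sum, hv l m]

lemma pointMass_mem_sameTotal (w : ∀ l, Fin (d l)) : pointMass w ∈ sameTotal d := by
  intro l m
  simp [pointMass]

lemma specCone_iff {lam : ∀ l, Fin (d l) → ℝ} :
    lam ∈ specCone d ↔ (∀ l, Antitone (lam l)) ∧ ∃ φ : (∀ l, Fin (d l)) → ℂ,
      ∀ l, marg l φ = Matrix.diagonal fun j => (lam l j : ℂ) := by
  constructor
  · rintro ⟨φ, hφ⟩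
    refine ⟨fun l => (hφ l).1, ?_⟩
    choose U hU hm using fun l => (isSpecDown_iff.1 (hφ l)).2
    refine ⟨tens (fun l => (U l).conjTranspose) φ, fun l => ?_⟩
    rw [marg_tens l _ (fun r => by
      rw [Matrix.conjTranspose_conjTranspose, mul_eq_one_comm.1 (hU r)]) φ, hm,
      Matrix.conjTranspose_conjTranspose, mul_assoc, mul_assoc, hU, mul_one, ← mul_assoc, hU,
      one_mul]
  · rintro ⟨ha, φ, hφ⟩
    exact ⟨φ, fun l => isSpecDown_iff.2 ⟨ha l, 1, by simp, by simp [hφ l]⟩⟩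

lemma eq_sum_pointMass {lam : ∀ l, Fin (d l) → ℝ} {φ : (∀ l, Fin (d l)) → ℂ}
    (hm : ∀ l, marg l φ = Matrix.diagonal fun j => (lam l j : ℂ)) :
    lam = ∑ w, ‖φ w‖ ^ 2 • pointMass w := by
  funext l i
  have h1 := marg_apply_self l φ i
  rw [hm, Matrix.diagonal_apply_eq] at h1
  have h2 : lam l i = ∑ w, if w l = i then ‖φ w‖ ^ 2 else 0 := by exact_mod_cast h1
  rw [h2, Finset.sum_apply, Finset.sum_apply]
  refine Finset.sum_congr rfl fun w _ => ?_
  simp [pointMass, Pi.single_apply, eq_comm]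

lemma unitSpec_nonneg {lam : ∀ l, Fin (d l) → ℝ} (h : lam ∈ unitSpec d) (l : L) (i : Fin (d l)) :
    0 ≤ lam l i := by
  obtain ⟨_, φ, _, hφ⟩ := h
  rw [eq_sum_pointMass hφ, Finset.sum_apply, Finset.sum_apply]
  refine Finset.sum_nonneg fun w _ => ?_
  simp only [Pi.smul_apply, smul_eq_mul, pointMass, Pi.single_apply]
  split_ifs <;> simp

lemma specCone_subset_sameTotal : specCone d ⊆ sameTotal d := by
  intro lam h
  obtain ⟨_, φ, hφ⟩ := specCone_iff.1 h
  rw [eq_sum_pointMass hφ]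
  exact Submodule.sum_mem _ fun w _ => Submodule.smul_mem _ _ (pointMass_mem_sameTotal w)

/-- Every element of the cone is a multiple of a normalized one. -/
lemma exists_unitSpec_of_specCone {lam : ∀ l, Fin (d l) → ℝ} (h : lam ∈ specCone d)
    (h0 : lam ≠ 0) : ∃ t : ℝ, 0 < t ∧ t • lam ∈ unitSpec d := by
  obtain ⟨ha, φ, hφ⟩ := specCone_iff.1 h
  have hφ0 : φ ≠ 0 := by
    rintro rfl
    exact h0 (by rw [eq_sum_pointMass hφ]; simp)
  have hn := nsq_pos hφ0
  refine ⟨(nsq φ)⁻¹, inv_pos.2 hn, fun l i j hij => ?_, ((√(nsq φ))⁻¹ : ℂ) • φ, ?_, fun l => ?_⟩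
  · exact mul_le_mul_of_nonneg_left (ha l hij) (inv_pos.2 hn).le
  · rw [nsq_smul, norm_inv, Complex.norm_real, Real.norm_eq_abs, inv_pow, sq_abs,
      Real.sq_sqrt hn.le, inv_mul_cancel₀ hn.ne']
  · rw [marg_smul, norm_inv, Complex.norm_real, Real.norm_eq_abs, inv_pow, sq_abs,
      Real.sq_sqrt hn.le, hφ]
    ext i j
    by_cases hij : i = j
    · subst hij; simp
    · simp [hij]

lemma convex_unitSpec : Convex ℝ (unitSpec d) := by
  intro u hu v hv s t hs ht hst
  refine ⟨fun l i j hij => ?_, ?_⟩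
  · simp only [Pi.add_apply, Pi.smul_apply, smul_eq_mul]
    exact add_le_add (mul_le_mul_of_nonneg_left (hu.1 l hij) hs)
      (mul_le_mul_of_nonneg_left (hv.1 l hij) ht)
  · have hu' := hu
    have hv' := hv
    obtain ⟨hua, φ, hφ1, hφ⟩ := hu
    obtain ⟨hva, χ, hχ1, hχ⟩ := hv
    obtain ⟨ξ, h1, h2⟩ := exists_marg_mean (I := Bool) (θ := fun b => if b then s else t)
      (by intro b; cases b <;> simpa) (by simpa using hst)
      (lam := fun b => if b then u else v)
      (by intro b; cases b <;> simpa)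
      (by intro b; cases b
          · simpa using unitSpec_nonneg hv'
          · simpa using unitSpec_nonneg hu')
      (ψ := fun b => if b then φ else χ)
      (by intro b; cases b <;> simpa) (by intro b; cases b <;> simpa)
    exact ⟨ξ, h1, fun l => by rw [h2]; simp⟩

/-- A functional vanishing where all totals agree and the pairing is zero is a multiple of the
pairing. -/
lemma exists_eq_mul_pairing (h : ∀ l, Fin (d l) → ℝ) {w₀ : ∀ l, Fin (d l)}
    (hw₀ : weight h w₀ ≠ 0) (f : (∀ l, Fin (d l) → ℝ) →ₗ[ℝ] ℝ)
    (hf : ∀ v ∈ sameTotal d, pairing h v = 0 → f v = 0) :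
    ∃ t : ℝ, ∀ v ∈ sameTotal d, f v = t * pairing h v := by
  refine ⟨f (pointMass w₀) / weight h w₀, fun v hv => ?_⟩
  have := hf (v - (pairing h v / weight h w₀) • pointMass w₀)
    (Submodule.sub_mem _ hv (Submodule.smul_mem _ _ (pointMass_mem_sameTotal w₀)))
    (by rw [map_sub, map_smul, pairing_pointMass, smul_eq_mul, div_mul_cancel₀ _ hw₀, sub_self])
  rw [map_sub, map_smul, smul_eq_mul, sub_eq_zero] at this
  rw [this]
  ring

/-- The difference of two coordinates on one leg. -/
def coordDiff (l : L) (i j : Fin (d l)) : (∀ l, Fin (d l) → ℝ) →ₗ[ℝ] ℝ where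
  toFun v := v l i - v l j
  map_add' u v := by simp only [Pi.add_apply]; ring
  map_smul' t v := by simp only [Pi.smul_apply, smul_eq_mul, RingHom.id_apply]; ring

lemma coordDiff_apply (l : L) (i j : Fin (d l)) (v : ∀ l, Fin (d l) → ℝ) :
    coordDiff l i j v = v l i - v l j := rfl

/-- Some element of the cone separates two given levels of a leg that embeds into the others. -/
lemma exists_specCone_lt {l : L} {s : Fin (d l) → ∀ m, Fin (d m)} (hs : ∀ i, s i l = i)
    (hs' : ∀ i j, Function.update (s i) l j = s j → i = j) {i j : Fin (d l)} (hij : i < j) :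
    ∃ v ∈ specCone d, v l j < v l i := by
  classical
  set φ : (∀ m, Fin (d m)) → ℂ := fun w => if w l ≤ i ∧ w = s (w l) then 1 else 0 with hφ
  have hm : marg l φ = Matrix.diagonal fun k => ((if k ≤ i then 1 else 0 : ℝ) : ℂ) := by
    ext k k'
    simp only [marg, Matrix.of_apply]
    rw [Finset.sum_eq_single (s k)]
    · rw [if_pos (hs k)]
      by_cases hkk : k = k'
      · subst hkk
        have : Function.update (s k) l k = s k := by
          conv_lhs => rw [← hs k]
          rw [hs k, Function.update_eq_self_iff]; exact (hs k).symm
        by_cases h : k ≤ i <;> simp [hφ, this, hs, h]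
      · rw [Matrix.diagonal_apply_ne _ hkk]
        have : φ (Function.update (s k) l k') = 0 := by
          simp only [hφ, Function.update_self]
          rw [if_neg]
          exact fun h => hkk (hs' _ _ h.2)
        rw [this]; simp
    · intro w _ hw
      split_ifs with h
      · have : φ w = 0 := by
          simp only [hφ]
          rw [if_neg]
          rintro ⟨_, h2⟩
          rw [h] at h2
          exact hw h2
        rw [this, zero_mul]
      · rfl
    · exact fun h => absurd (Finset.mem_univ _) h
  choose lam hlam using fun m => exists_isSpecDown (marg_isHermitian m φ)
  refine ⟨Function.update lam l fun k => if k ≤ i then 1 else 0, ⟨φ, fun m => ?_⟩, ?_⟩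
  · by_cases hml : m = l
    · subst hml
      rw [Function.update_self, hm]
      refine isSpecDown_iff.2 ⟨fun k k' hkk => ?_, 1, by simp, by simp⟩
      dsimp only
      by_cases h : k' ≤ i
      · rw [if_pos h, if_pos (hkk.trans h)]
      · rw [if_neg h]; split_ifs <;> norm_num
    · rw [Function.update_of_ne hml]
      exact hlam m
  · rw [Function.update_self, if_pos le_rfl, if_neg (not_le.2 hij)]
    norm_num

end Faces

section Dichotomy

variable {L : Type} [Fintype L] [DecidableEq L] {d : L → ℕ}

/-- A functional vanishing on all weight-zero point masses vanishes at regular points of a face. -/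
lemma eq_zero_of_strictAnti {h : ∀ l, Fin (d l) → ℝ} (hnn : ∀ v ∈ specCone d, 0 ≤ pairing h v)
    {u : ∀ l, Fin (d l) → ℝ} (hu : u ∈ unitSpec d) (hu0 : pairing h u = 0)
    (hreg : ∀ l, StrictAnti (u l)) (f : (∀ l, Fin (d l) → ℝ) →ₗ[ℝ] ℝ)
    (hf : ∀ w, weight h w = 0 → f (pointMass w) = 0) : f u = 0 := by
  obtain ⟨_, φ, _, hφ⟩ := hu
  rw [eq_sum_pointMass hφ, map_sum]
  refine Finset.sum_eq_zero fun w _ => ?_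
  rw [map_smul, smul_eq_mul]
  by_cases hw : φ w = 0
  · simp [hw]
  · rw [hf w (weight_eq_zero_of_min hφ hreg h (fun χ lam' hs => hnn lam' ⟨χ, hs⟩) hu0 w hw),
      mul_zero]

/-- If a face meets the complement of every wall of the chamber, it has a regular point. -/
lemma exists_regular {K : Set (∀ l, Fin (d l) → ℝ)} (hK : Convex ℝ K)
    (hanti : ∀ u ∈ K, ∀ l, Antitone (u l)) (hne : K.Nonempty)
    (hwall : ∀ l i j, i < j → ∃ u ∈ K, u l j < u l i) : ∃ u ∈ K, ∀ l, StrictAnti (u l) := by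
  obtain ⟨v, hv⟩ := hne
  have hch : ∀ x : Option (Σ l, Fin (d l) × Fin (d l)), ∃ u ∈ K,
      ∀ l i j, x = some ⟨l, i, j⟩ → i < j → u l j < u l i := by
    intro x
    cases x with
    | none => exact ⟨v, hv, by simp⟩
    | some y =>
      obtain ⟨l, i, j⟩ := y
      by_cases hij : i < j
      · obtain ⟨u, hu, hlt⟩ := hwall l i j hij
        refine ⟨u, hu, fun l' i' j' he _ => ?_⟩
        cases he
        exact hlt
      · refine ⟨v, hv, fun l' i' j' he h => ?_⟩
        cases he
        exact absurd h hij
  choose p hpK hp using hch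
  set θ : ℝ := (Fintype.card (Option (Σ l, Fin (d l) × Fin (d l))) : ℝ)⁻¹ with hθ
  have hcard : (0 : ℝ) < Fintype.card (Option (Σ l, Fin (d l) × Fin (d l))) := by
    exact_mod_cast Fintype.card_pos
  have hθ0 : 0 < θ := inv_pos.2 hcard
  refine ⟨∑ x, θ • p x, hK.sum_mem (fun _ _ => hθ0.le) ?_ fun x _ => hpK x, ?_⟩
  · rw [Finset.sum_const, Finset.card_univ, nsmul_eq_mul, hθ, mul_inv_cancel₀ hcard.ne']
  · intro l i j hij
    simp only [Finset.sum_apply, Pi.smul_apply, smul_eq_mul]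
    refine Finset.sum_lt_sum
      (fun x _ => mul_le_mul_of_nonneg_left (hanti _ (hpK x) l hij.le) hθ0.le)
      ⟨some ⟨l, i, j⟩, Finset.mem_univ _, ?_⟩
    exact mul_lt_mul_of_pos_left (hp _ l i j rfl hij) hθ0

/-- A face of maximal dimension either lies in a wall of the chamber, or is cut out by a functional
which is determined by its zero weights. -/
theorem wall_or_determined
    (hs : ∀ l, ∃ s : Fin (d l) → ∀ m, Fin (d m), (∀ i, s i l = i) ∧
      ∀ i j, Function.update (s i) l j = s j → i = j)
    {h : ∀ l, Fin (d l) → ℝ} (hnn : ∀ v ∈ specCone d, 0 ≤ pairing h v)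
    (hspan : ∀ v ∈ sameTotal d, pairing h v = 0 →
      v ∈ Submodule.span ℝ {v ∈ specCone d | pairing h v = 0})
    {w₀ : ∀ l, Fin (d l)} (hw₀ : weight h w₀ ≠ 0) :
    (∃ l i j, i < j ∧ ∃ t : ℝ, 0 < t ∧ ∀ w, coordDiff l i j (pointMass w) = t * weight h w) ∨
    ∀ f : (∀ l, Fin (d l) → ℝ) →ₗ[ℝ] ℝ, (∀ w, weight h w = 0 → f (pointMass w) = 0) →
      ∃ t : ℝ, ∀ w, f (pointMass w) = t * weight h w := by
  have hvanish : ∀ f : (∀ l, Fin (d l) → ℝ) →ₗ[ℝ] ℝ,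
      (∀ u ∈ unitSpec d, pairing h u = 0 → f u = 0) →
      ∃ t : ℝ, ∀ v ∈ sameTotal d, f v = t * pairing h v := by
    intro f hf
    refine exists_eq_mul_pairing h hw₀ f fun v hv hv0 => ?_
    have hle : Submodule.span ℝ {v ∈ specCone d | pairing h v = 0} ≤ LinearMap.ker f := by
      refine Submodule.span_le.2 fun u hu => ?_
      rw [SetLike.mem_coe, LinearMap.mem_ker]
      by_cases hu0 : u = 0
      · rw [hu0, map_zero]
      · obtain ⟨t, ht, hu1⟩ := exists_unitSpec_of_specCone hu.1 hu0
        have := hf _ hu1 (by rw [map_smul, hu.2, smul_zero])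
        rw [map_smul, smul_eq_mul] at this
        exact (mul_eq_zero.1 this).resolve_left ht.ne'
    exact hle (hspan v hv hv0)
  by_cases hwall : ∀ l i j, i < j → ∃ u ∈ {u ∈ unitSpec d | pairing h u = 0}, u l j < u l i
  · right
    intro f hf
    have hK : Convex ℝ {u ∈ unitSpec d | pairing h u = 0} :=
      convex_unitSpec.inter ((convex_singleton (0 : ℝ)).linear_preimage (pairing h))
    obtain ⟨t, ht⟩ := hvanish f fun v hv hv0 => by
      obtain ⟨u, hu, hreg⟩ := exists_regular hK (fun u hu => hu.1.1) ⟨v, hv, hv0⟩ hwall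
      have h1 := eq_zero_of_strictAnti hnn hu.1 hu.2 hreg f hf
      have hm := hK hu ⟨hv, hv0⟩ (by norm_num : (0 : ℝ) ≤ 1 / 2) (by norm_num : (0 : ℝ) ≤ 1 / 2)
        (by norm_num)
      have h2 := eq_zero_of_strictAnti hnn hm.1 hm.2 (fun l i j hij => by
        have h3 := hreg l hij
        have h4 := hv.1 l hij.le
        simp only [Pi.add_apply, Pi.smul_apply, smul_eq_mul]
        linarith) f hf
      rw [map_add, map_smul, map_smul, h1, smul_zero, zero_add, smul_eq_mul] at h2
      linarith
    exact ⟨t, fun w => by rw [ht _ (pointMass_mem_sameTotal w), pairing_pointMass]⟩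
  · left
    push Not at hwall
    obtain ⟨l, i, j, hij, hle⟩ := hwall
    obtain ⟨t, ht⟩ := hvanish (coordDiff l i j) fun u hu hu0 => by
      rw [coordDiff_apply, sub_eq_zero]
      exact le_antisymm (hle u ⟨hu, hu0⟩) (hu.1 l hij.le)
    refine ⟨l, i, j, hij, t, ?_, fun w => by
      rw [ht _ (pointMass_mem_sameTotal w), pairing_pointMass]⟩
    obtain ⟨s, hs1, hs2⟩ := hs l
    obtain ⟨v, hv, hlt⟩ := exists_specCone_lt hs1 hs2 hij
    have h1 := ht v (specCone_subset_sameTotal hv)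
    rw [coordDiff_apply] at h1
    have h2 : 0 < t * pairing h v := by linarith
    exact pos_of_mul_pos_left h2 (hnn v hv)

end Dichotomy

section ThreeLegs

variable {a b c : ℕ}

lemma eq_zero_of_add_eq_zero (ha : 0 < a) (hb : 0 < b) (hc : 0 < c) {X : Fin a → ℝ}
    {Y : Fin b → ℝ} {Z : Fin c → ℝ} (h : ∀ i j k, X i + Y j + Z k = 0) (hX : ∑ i, X i = 0)
    (hY : ∑ j, Y j = 0) : X = 0 ∧ Y = 0 ∧ Z = 0 := by
  have hX0 : X = 0 := by
    have e : ∀ i, X i = -(Y ⟨0, hb⟩ + Z ⟨0, hc⟩) := fun i => by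
      linarith [h i ⟨0, hb⟩ ⟨0, hc⟩]
    simp only [e, Finset.sum_const, Finset.card_univ, Fintype.card_fin, nsmul_eq_mul] at hX
    have h2 := (mul_eq_zero.1 hX).resolve_left (by positivity)
    funext i
    rw [e, h2]; rfl
  have hY0 : Y = 0 := by
    have e : ∀ j, Y j = -(X ⟨0, ha⟩ + Z ⟨0, hc⟩) := fun j => by
      linarith [h ⟨0, ha⟩ j ⟨0, hc⟩]
    simp only [e, Finset.sum_const, Finset.card_univ, Fintype.card_fin, nsmul_eq_mul] at hY
    have h2 := (mul_eq_zero.1 hY).resolve_left (by positivity)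
    funext i
    rw [e, h2]; rfl
  refine ⟨hX0, hY0, funext fun k => ?_⟩
  have := h ⟨0, ha⟩ ⟨0, hb⟩ k
  simpa [hX0, hY0] using this

/-- `P i + Q j + R k` is determined up to scaling by its zeros among separable functions. -/
def DeterminedByZeros (P : Fin a → ℝ) (Q : Fin b → ℝ) (R : Fin c → ℝ) : Prop :=
  ∀ (x : Fin a → ℝ) (y : Fin b → ℝ) (w : Fin c → ℝ),
    (∀ i j k, P i + Q j + R k = 0 → x i + y j + w k = 0) →
    ∃ t : ℝ, ∀ i j k, x i + y j + w k = t * (P i + Q j + R k)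

lemma DeterminedByZeros.extremalEdge (ha : 0 < a) (hb : 0 < b) (hc : 0 < c) {P : Fin a → ℝ}
    {Q : Fin b → ℝ} {R : Fin c → ℝ} (h : DeterminedByZeros P Q R) (hP : ∑ i, P i = 0)
    (hQ : ∑ j, Q j = 0) (h0 : ¬(P = 0 ∧ Q = 0)) : ExtremalEdge P Q := by
  have hcov : ∀ k, ∃ i j, P i + Q j + R k = 0 := by
    by_contra! hcon
    obtain ⟨k₀, hk₀⟩ := hcon
    obtain ⟨t, ht⟩ := h 0 0 (Pi.single k₀ 1) fun i j k hz => by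
      have : k ≠ k₀ := by rintro rfl; exact hk₀ i j hz
      simp [this]
    have ht0 : t ≠ 0 := by
      rintro rfl
      simpa using ht ⟨0, ha⟩ ⟨0, hb⟩ k₀
    obtain ⟨h1, h2, _⟩ := eq_zero_of_add_eq_zero ha hb hc (X := t • P) (Y := t • Q)
      (Z := t • R - Pi.single k₀ 1) (fun i j k => by
        have := ht i j k
        simp only [Pi.zero_apply, Pi.smul_apply, Pi.sub_apply, smul_eq_mul] at this ⊢
        linarith)
      (by simp [← Finset.mul_sum, hP]) (by simp [← Finset.mul_sum, hQ])
    exact h0 ⟨(smul_eq_zero.1 h1).resolve_left ht0, (smul_eq_zero.1 h2).resolve_left ht0⟩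
  refine ⟨hP, hQ, h0, fun x y hx hy hxy => ?_⟩
  choose α β hαβ using hcov
  obtain ⟨t, ht⟩ := h x y (fun k => -(x (α k) + y (β k))) fun i j k hz => by
    have := hxy i j (α k) (β k) (by linarith [hαβ k])
    linarith
  obtain ⟨h1, h2, _⟩ := eq_zero_of_add_eq_zero ha hb hc (X := x - t • P) (Y := y - t • Q)
    (Z := (fun k => -(x (α k) + y (β k))) - t • R) (fun i j k => by
      have := ht i j k
      simp only [Pi.smul_apply, Pi.sub_apply, smul_eq_mul] at this ⊢
      linarith)
    (by simp [← Finset.mul_sum, hP, hx]) (by simp [← Finset.mul_sum, hQ, hy])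
  exact ⟨t, sub_eq_zero.1 h1, sub_eq_zero.1 h2⟩

/-- The dimensions of the three legs. -/
def dims (a b c : ℕ) : Fin 3 → ℕ
  | 0 => a
  | 1 => b
  | 2 => c

/-- Assemble a family over the three legs. -/
def triple {α : ℕ → Type} (x : α a) (y : α b) (z : α c) : ∀ l, α (dims a b c l)
  | 0 => x
  | 1 => y
  | 2 => z

/-- Multi-indices over the three legs are triples. -/
def tripleEquiv (a b c : ℕ) : Fin a × Fin b × Fin c ≃ (∀ l, Fin (dims a b c l)) where
  toFun p := triple (α := Fin) p.1 p.2.1 p.2.2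
  invFun w := (w 0, w 1, w 2)
  left_inv _ := rfl
  right_inv w := by
    funext l
    match l with
    | 0 => rfl
    | 1 => rfl
    | 2 => rfl

lemma sum_triple {M : Type} [AddCommMonoid M] (F : (∀ l, Fin (dims a b c l)) → M) :
    ∑ w, F w = ∑ i, ∑ j, ∑ k, F (triple (α := Fin) i j k) := by
  rw [← (tripleEquiv a b c).sum_comp, Fintype.sum_prod_type]
  refine Finset.sum_congr rfl fun i _ => ?_
  rw [Fintype.sum_prod_type]
  rfl

lemma update_triple_zero (i i' : Fin a) (j : Fin b) (k : Fin c) :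
    Function.update (triple (α := Fin) i j k) 0 i' = triple (α := Fin) i' j k := by
  funext l
  match l with
  | 0 => rfl
  | 1 => rfl
  | 2 => rfl

lemma update_triple_one (i : Fin a) (j j' : Fin b) (k : Fin c) :
    Function.update (triple (α := Fin) i j k) 1 j' = triple (α := Fin) i j' k := by
  funext l
  match l with
  | 0 => rfl
  | 1 => rfl
  | 2 => rfl

lemma update_triple_two (i : Fin a) (j : Fin b) (k k' : Fin c) :
    Function.update (triple (α := Fin) i j k) 2 k' = triple (α := Fin) i j k' := by
  funext l
  match l with
  | 0 => rfl
  | 1 => rfl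
  | 2 => rfl

lemma marg_zero (φ : (∀ l, Fin (dims a b c l)) → ℂ) :
    marg 0 φ = rhoA (φ ∘ tripleEquiv a b c) := by
  funext (i : Fin a) (i' : Fin a)
  refine (sum_triple _).trans ((Finset.sum_eq_single i (fun i₂ _ hi => ?_) fun h =>
    absurd (Finset.mem_univ _) h).trans (Finset.sum_congr rfl fun j _ =>
      Finset.sum_congr rfl fun k _ => (if_pos rfl).trans ?_))
  · exact Finset.sum_eq_zero fun j _ => Finset.sum_eq_zero fun k _ => if_neg hi
  · exact congrArg (fun w => φ (triple (α := Fin) i j k) * (starRingEnd ℂ) (φ w))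
      (update_triple_zero i i' j k)

lemma marg_one (φ : (∀ l, Fin (dims a b c l)) → ℂ) :
    marg 1 φ = rhoB (φ ∘ tripleEquiv a b c) := by
  funext (j : Fin b) (j' : Fin b)
  refine (sum_triple _).trans (Finset.sum_congr rfl fun i _ =>
    (Finset.sum_eq_single j (fun j₂ _ hj => ?_) fun h => absurd (Finset.mem_univ _) h).trans
      (Finset.sum_congr rfl fun k _ => (if_pos rfl).trans ?_))
  · exact Finset.sum_eq_zero fun k _ => if_neg hj
  · exact congrArg (fun w => φ (triple (α := Fin) i j k) * (starRingEnd ℂ) (φ w))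
      (update_triple_one i j j' k)

lemma marg_two (φ : (∀ l, Fin (dims a b c l)) → ℂ) :
    marg 2 φ = rhoC (φ ∘ tripleEquiv a b c) := by
  funext (k : Fin c) (m : Fin c)
  refine (sum_triple _).trans (Finset.sum_congr rfl fun i _ => Finset.sum_congr rfl fun j _ =>
    (Finset.sum_eq_single k (fun k₂ _ hk => ?_) fun h => absurd (Finset.mem_univ _) h).trans
      ((if_pos rfl).trans ?_))
  · exact if_neg hk
  · exact congrArg (fun w => φ (triple (α := Fin) i j k) * (starRingEnd ℂ) (φ w))
      (update_triple_two i j k m)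

/-- Triples of vectors as families over the three legs. -/
def specEquiv (a b c : ℕ) : ((Fin a → ℝ) × (Fin b → ℝ) × (Fin c → ℝ)) ≃ₗ[ℝ]
    (∀ l, Fin (dims a b c l) → ℝ) where
  toFun p := triple (α := fun n => Fin n → ℝ) p.1 p.2.1 p.2.2
  invFun v := (v 0, v 1, v 2)
  left_inv _ := rfl
  right_inv v := by
    funext l
    match l with
    | 0 => rfl
    | 1 => rfl
    | 2 => rfl
  map_add' p q := by
    funext l
    match l with
    | 0 => rfl
    | 1 => rfl
    | 2 => rfl
  map_smul' t p := by
    funext l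
    match l with
    | 0 => rfl
    | 1 => rfl
    | 2 => rfl

lemma specEquiv_mem_specCone {p : (Fin a → ℝ) × (Fin b → ℝ) × (Fin c → ℝ)} :
    specEquiv a b c p ∈ specCone (dims a b c) ↔ p ∈ KronCone a b c := by
  constructor
  · rintro ⟨φ, hφ⟩
    refine ⟨φ ∘ tripleEquiv a b c, ?_, ?_, ?_⟩
    · rw [← marg_zero]; exact hφ 0
    · rw [← marg_one]; exact hφ 1
    · rw [← marg_two]; exact hφ 2
  · rintro ⟨ψ, h0, h1, h2⟩
    have e : (ψ ∘ (tripleEquiv a b c).symm) ∘ tripleEquiv a b c = ψ := by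
      funext p; simp
    refine ⟨ψ ∘ (tripleEquiv a b c).symm, fun l => ?_⟩
    match l with
    | 0 => rw [marg_zero, e]; exact h0
    | 1 => rw [marg_one, e]; exact h1
    | 2 => rw [marg_two, e]; exact h2

lemma weight_triple (P : Fin a → ℝ) (Q : Fin b → ℝ) (R : Fin c → ℝ) (i : Fin a) (j : Fin b)
    (k : Fin c) :
    weight (specEquiv a b c (P, Q, R)) (triple (α := Fin) i j k) = P i + Q j + R k := by
  rw [weight, Fin.sum_univ_three]
  rfl

lemma pairing_specEquiv (HA : Fin a → ℝ) (HB : Fin b → ℝ) (HC : Fin c → ℝ) (z : ℝ)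
    (p : (Fin a → ℝ) × (Fin b → ℝ) × (Fin c → ℝ)) :
    pairing (specEquiv a b c (fun i => HA i + z, HB, HC)) (specEquiv a b c p)
      = wtPair HA HB HC z p := by
  rw [pairing_apply, Fin.sum_univ_three]
  change (∑ i, (HA i + z) * p.1 i) + (∑ j, HB j * p.2.1 j) + (∑ k, HC k * p.2.2 k) = _
  simp only [wtPair, add_mul, Finset.sum_add_distrib, Finset.mul_sum]
  ring

lemma mem_sameTotal_specEquiv {p : (Fin a → ℝ) × (Fin b → ℝ) × (Fin c → ℝ)} :
    specEquiv a b c p ∈ sameTotal (dims a b c) ↔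
      ∑ i, p.1 i = ∑ j, p.2.1 j ∧ ∑ i, p.1 i = ∑ k, p.2.2 k := by
  have e : ∀ l, ∑ i, specEquiv a b c p l i
      = (![∑ i, p.1 i, ∑ j, p.2.1 j, ∑ k, p.2.2 k] : Fin 3 → ℝ) l := by
    intro l
    match l with
    | 0 => rfl
    | 1 => rfl
    | 2 => rfl
  constructor
  · intro h
    have h1 := h 0 1
    have h2 := h 0 2
    rw [e, e] at h1 h2
    exact ⟨h1, h2⟩
  · rintro ⟨h1, h2⟩ l m
    rw [e, e]
    fin_cases l <;> fin_cases m <;> simp [h1] <;> linarith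

lemma exists_injective_on_others (ha : 0 < a) (hab : a ≤ b) (hbc : b ≤ c) (hcab : c ≤ a * b)
    (l : Fin 3) : ∃ s : Fin (dims a b c l) → ∀ m, Fin (dims a b c m), (∀ i, s i l = i) ∧
      ∀ i j, Function.update (s i) l j = s j → i = j := by
  have hb : 0 < b := ha.trans_le hab
  match l with
  | 0 =>
    refine ⟨fun i : Fin a => triple (α := Fin) i (Fin.castLE hab i) ⟨0, hb.trans_le hbc⟩,
      fun _ => rfl, fun (i j : Fin a) h => ?_⟩
    have h1 : Fin.castLE hab i = Fin.castLE hab j := congrFun h 1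
    exact Fin.castLE_injective _ h1
  | 1 =>
    refine ⟨fun j : Fin b => triple (α := Fin) ⟨0, ha⟩ j (Fin.castLE hbc j),
      fun _ => rfl, fun (i j : Fin b) h => ?_⟩
    have h1 : Fin.castLE hbc i = Fin.castLE hbc j := congrFun h 2
    exact Fin.castLE_injective _ h1
  | 2 =>
    refine ⟨fun k : Fin c => triple (α := Fin) (finProdFinEquiv.symm (Fin.castLE hcab k)).1
      (finProdFinEquiv.symm (Fin.castLE hcab k)).2 k, fun _ => rfl, fun (i j : Fin c) h => ?_⟩
    have h1 : (finProdFinEquiv.symm (Fin.castLE hcab i)).1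
      = (finProdFinEquiv.symm (Fin.castLE hcab j)).1 := congrFun h 0
    have h2 : (finProdFinEquiv.symm (Fin.castLE hcab i)).2
      = (finProdFinEquiv.symm (Fin.castLE hcab j)).2 := congrFun h 1
    exact Fin.castLE_injective _ (finProdFinEquiv.symm.injective (Prod.ext h1 h2))

end ThreeLegs

section Assembly

variable {a b c : ℕ}

/-- The three equations cutting out the hyperplane `⟨(H,z), ·⟩ = 0` among triples with a common
total. -/
def constraint (HA : Fin a → ℝ) (HB : Fin b → ℝ) (HC : Fin c → ℝ) (z : ℝ) :
    ((Fin a → ℝ) × (Fin b → ℝ) × (Fin c → ℝ)) →ₗ[ℝ] ℝ × ℝ × ℝ where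
  toFun p := (∑ i, p.1 i - ∑ j, p.2.1 j, ∑ i, p.1 i - ∑ k, p.2.2 k, wtPair HA HB HC z p)
  map_add' p q := by
    simp only [wtPair, Prod.fst_add, Prod.snd_add, Pi.add_apply, mul_add, Finset.sum_add_distrib,
      Prod.mk_add_mk, Prod.mk.injEq]
    refine ⟨?_, ?_, ?_⟩ <;> ring
  map_smul' t p := by
    simp only [wtPair, Prod.smul_fst, Prod.smul_snd, Pi.smul_apply, smul_eq_mul, mul_left_comm _ t,
      ← Finset.mul_sum, Prod.smul_mk, RingHom.id_apply, Prod.mk.injEq]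
    refine ⟨?_, ?_, ?_⟩ <;> ring

lemma constraint_surjective (HA : Fin a → ℝ) (HB : Fin b → ℝ) (HC : Fin c → ℝ) (z : ℝ)
    {i : Fin a} {j : Fin b} {k : Fin c} (h : HA i + z + HB j + HC k ≠ 0) :
    Function.Surjective (constraint HA HB HC z) := by
  have e1 : constraint HA HB HC z (Pi.single i 1, Pi.single j 1, Pi.single k 1)
      = (0, 0, HA i + z + HB j + HC k) := by
    simp [constraint, wtPair, Pi.single_apply]
    ring
  have e2 : constraint HA HB HC z (0, -Pi.single j 1, 0) = (1, 0, -HB j) := by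
    simp [constraint, wtPair, Pi.single_apply]
  have e3 : constraint HA HB HC z (0, 0, -Pi.single k 1) = (0, 1, -HC k) := by
    simp [constraint, wtPair, Pi.single_apply]
  rintro ⟨r, s, t⟩
  refine ⟨((t + r * HB j + s * HC k) / (HA i + z + HB j + HC k)) •
    (Pi.single i 1, Pi.single j 1, Pi.single k 1) + r • (0, -Pi.single j 1, 0)
      + s • (0, 0, -Pi.single k 1), ?_⟩
  rw [map_add, map_add, map_smul, map_smul, map_smul, e1, e2, e3]
  simp only [Prod.smul_mk, Prod.mk_add_mk, smul_eq_mul, Prod.mk.injEq]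
  refine ⟨by ring, by ring, ?_⟩
  rw [div_mul_cancel₀ _ h]
  ring

lemma finrank_ker_constraint (HA : Fin a → ℝ) (HB : Fin b → ℝ) (HC : Fin c → ℝ) (z : ℝ)
    {i : Fin a} {j : Fin b} {k : Fin c} (h : HA i + z + HB j + HC k ≠ 0) :
    Module.finrank ℝ (LinearMap.ker (constraint HA HB HC z)) = a + b + c - 3 := by
  have h1 := LinearMap.finrank_range_add_finrank_ker (constraint HA HB HC z)
  rw [LinearMap.range_eq_top.2 (constraint_surjective HA HB HC z h), finrank_top] at h1
  simp only [Module.finrank_prod, Module.finrank_self, Module.finrank_fin_fun] at h1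
  omega

lemma KronCone_total {p : (Fin a → ℝ) × (Fin b → ℝ) × (Fin c → ℝ)} (hp : p ∈ KronCone a b c) :
    ∑ i, p.1 i = ∑ j, p.2.1 j ∧ ∑ i, p.1 i = ∑ k, p.2.2 k :=
  mem_sameTotal_specEquiv.1 (specCone_subset_sameTotal (specEquiv_mem_specCone.2 hp))

lemma ker_constraint_le_span {HA : Fin a → ℝ} {HB : Fin b → ℝ} {HC : Fin c → ℝ} {z : ℝ}
    (hfacet : IsFacetNormal a b c HA HB HC z)
    {i : Fin a} {j : Fin b} {k : Fin c} (h : HA i + z + HB j + HC k ≠ 0) :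
    LinearMap.ker (constraint HA HB HC z)
      ≤ Submodule.span ℝ {p ∈ KronCone a b c | wtPair HA HB HC z p = 0} := by
  set F := {p ∈ KronCone a b c | wtPair HA HB HC z p = 0} with hF
  have hle : Submodule.span ℝ F ≤ LinearMap.ker (constraint HA HB HC z) := by
    refine Submodule.span_le.2 fun p hp => ?_
    obtain ⟨h1, h2⟩ := KronCone_total hp.1
    rw [SetLike.mem_coe, LinearMap.mem_ker]
    change (_, _, _) = ((0 : ℝ), (0 : ℝ), (0 : ℝ))
    rw [hp.2, sub_eq_zero.2 h1, sub_eq_zero.2 h2]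
  have hdir : (affineSpan ℝ F).direction ≤ Submodule.span ℝ F := by
    rw [direction_affineSpan, vectorSpan_def]
    refine Submodule.span_le.2 ?_
    rintro _ ⟨p, hp, q, hq, rfl⟩
    exact Submodule.sub_mem _ (Submodule.subset_span hp) (Submodule.subset_span hq)
  have hrank := Submodule.finrank_mono hdir
  rw [hfacet.2.2.2] at hrank
  exact (Submodule.eq_of_le_of_finrank_le hle
    ((finrank_ker_constraint HA HB HC z h).le.trans hrank)).ge

lemma eq_zero_of_add_const_eq_zero (hc : 0 < c) {S : Fin c → ℝ} {z : ℝ}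
    (h : ∀ k, S k + z = 0) (hS : ∑ k, S k = 0) : S = 0 ∧ z = 0 := by
  have hz : ∀ k, S k = -z := fun k => by linarith [h k]
  have hz0 : z = 0 := by
    simp only [hz, Finset.sum_const, Finset.card_univ, Fintype.card_fin, nsmul_eq_mul] at hS
    simpa using (mul_eq_zero.1 hS).resolve_left (by positivity)
  exact ⟨funext fun k => by rw [hz, hz0]; simp, hz0⟩

/-- A traceless normal proportional to a root of one leg is that root. -/
lemma eq_root_of_proportional (ha : 0 < a) (hb : 0 < b) (hc : 0 < c) {P : Fin a → ℝ}
    {Q : Fin b → ℝ} {S : Fin c → ℝ} {z t : ℝ} (ht : 0 < t) {i j : Fin a} (hP : ∑ i, P i = 0)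
    (hQ : ∑ j, Q j = 0) (hS : ∑ k, S k = 0)
    (h : ∀ i' j' k', (Pi.single i' 1 : Fin a → ℝ) i - (Pi.single i' 1 : Fin a → ℝ) j
      = t * (P i' + z + Q j' + S k')) :
    P = t⁻¹ • (Pi.single i 1 - Pi.single j 1) ∧ Q = 0 ∧ S = 0 ∧ z = 0 := by
  obtain ⟨h1, h2, h3⟩ := eq_zero_of_add_eq_zero ha hb hc
    (X := P - t⁻¹ • (Pi.single i 1 - Pi.single j 1)) (Y := Q) (Z := fun k => S k + z)
    (fun i' j' k' => by
      have := h i' j' k'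
      have e : ∀ m, (Pi.single m 1 : Fin a → ℝ) i' = (Pi.single i' 1 : Fin a → ℝ) m := fun m => by
        simp only [Pi.single_apply, eq_comm]
      simp only [Pi.sub_apply, Pi.smul_apply, smul_eq_mul]
      rw [e, e, this, inv_mul_cancel_left₀ ht.ne']
      ring)
    (by simp [← Finset.mul_sum, hP]) hQ
  obtain ⟨h4, h5⟩ := eq_zero_of_add_const_eq_zero hc (fun k => congrFun h3 k) hS
  exact ⟨sub_eq_zero.1 h1, h2, h4, h5⟩

/-- A non-trivial facet normal is determined by its zero weights. -/
lemma determinedByZeros_of_facet (ha : 1 < a) (hab : a ≤ b) (hbc : b ≤ c) (hcab : c ≤ a * b)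
    {HA : Fin a → ℝ} {HB : Fin b → ℝ} {HC : Fin c → ℝ} {z : ℝ}
    (hfacet : IsFacetNormal a b c HA HB HC z) (hnt : ¬ IsTrivialNormal HA HB HC z) :
    DeterminedByZeros (fun i => HA i + z) HB HC := by
  have ha0 : 0 < a := by omega
  have hb0 : 0 < b := by omega
  have hc0 : 0 < c := by omega
  obtain ⟨⟨hA, hB, hC⟩, hne, hnn, -⟩ := id hfacet
  have hw : ∃ i j k, HA i + z + HB j + HC k ≠ 0 := by
    by_contra! hcon
    obtain ⟨h1, h2, h3⟩ := eq_zero_of_add_eq_zero ha0 hb0 hc0 (X := HA) (Y := HB)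
      (Z := fun k => HC k + z) (fun i j k => by linarith [hcon i j k]) hA hB
    obtain ⟨h4, h5⟩ := eq_zero_of_add_const_eq_zero hc0 (fun k => congrFun h3 k) hC
    exact hne ⟨h1, h2, h4, h5⟩
  obtain ⟨i₀, j₀, k₀, hw⟩ := hw
  have hw' : weight (specEquiv a b c (fun i => HA i + z, HB, HC)) (triple (α := Fin) i₀ j₀ k₀)
      ≠ 0 := by rwa [weight_triple]
  have key := wall_or_determined (exists_injective_on_others ha0 hab hbc hcab)
    (h := specEquiv a b c (fun i => HA i + z, HB, HC))
    (fun v hv => by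
      obtain ⟨p, rfl⟩ := (specEquiv a b c).surjective v
      rw [pairing_specEquiv]
      exact hnn p (specEquiv_mem_specCone.1 hv))
    (fun v hv hv0 => by
      obtain ⟨p, rfl⟩ := (specEquiv a b c).surjective v
      rw [pairing_specEquiv] at hv0
      obtain ⟨h1, h2⟩ := mem_sameTotal_specEquiv.1 hv
      have hp := ker_constraint_le_span hfacet hw (x := p) (by
        rw [LinearMap.mem_ker]
        change (_, _, _) = ((0 : ℝ), (0 : ℝ), (0 : ℝ))
        rw [hv0, sub_eq_zero.2 h1, sub_eq_zero.2 h2])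
      have hm := Submodule.mem_map_of_mem (f := (specEquiv a b c).toLinearMap) hp
      rw [Submodule.map_span] at hm
      refine Submodule.span_mono ?_ hm
      rintro _ ⟨q, hq, rfl⟩
      refine ⟨specEquiv_mem_specCone.2 hq.1, ?_⟩
      exact (pairing_specEquiv HA HB HC z q).trans hq.2) hw'
  rcases key with ⟨l, i, j, hij, t, ht, hwall⟩ | hdet
  · refine absurd ?_ hnt
    have hwall' : ∀ (i' : Fin a) (j' : Fin b) (k' : Fin c),
        coordDiff l i j (pointMass (triple (α := Fin) i' j' k'))
          = t * (HA i' + z + HB j' + HC k') := fun i' j' k' => by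
      rw [hwall, weight_triple]
    refine ⟨t⁻¹, inv_pos.2 ht, ?_⟩
    clear hwall
    match l, i, j, hij, hwall' with
    | 0, i, j, hij, hwall' =>
      obtain ⟨h1, h2, h3, h4⟩ := eq_root_of_proportional (z := z)
        (i := (i : Fin a)) (j := (j : Fin a))
        ha0 hb0 hc0 ht hA hB hC fun i' j' k' => hwall' i' j' k'
      exact Or.inl ⟨i, j, hij, h1, h2, h3, h4⟩
    | 1, i, j, hij, hwall' =>
      obtain ⟨h1, h2, h3, h4⟩ := eq_root_of_proportional (z := z)
        (i := (i : Fin b)) (j := (j : Fin b))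
        hb0 ha0 hc0 ht hB hA hC fun j' i' k' => (hwall' i' j' k').trans (by ring)
      exact Or.inr (Or.inl ⟨i, j, hij, h1, h2, h3, h4⟩)
    | 2, i, j, hij, hwall' =>
      obtain ⟨h1, h2, h3, h4⟩ := eq_root_of_proportional (z := z)
        (i := (i : Fin c)) (j := (j : Fin c))
        hc0 ha0 hb0 ht hC hA hB fun k' i' j' => (hwall' i' j' k').trans (by ring)
      exact Or.inr (Or.inr ⟨i, j, hij, h1, h2, h3, h4⟩)
  · intro x y w hxy
    obtain ⟨t, ht⟩ := hdet (pairing (specEquiv a b c (x, y, w))) (fun v hv => by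
      obtain ⟨⟨i, j, k⟩, rfl⟩ := (tripleEquiv a b c).surjective v
      change weight _ (triple (α := Fin) i j k) = 0 at hv
      change pairing _ (pointMass (triple (α := Fin) i j k)) = 0
      rw [weight_triple] at hv
      rw [pairing_pointMass, weight_triple]
      exact hxy i j k hv)
    refine ⟨t, fun i j k => ?_⟩
    have := ht (triple (α := Fin) i j k)
    rwa [pairing_pointMass, weight_triple, weight_triple] at this

end Assembly

/-- for a non-trivial facet normal of `C(a,b,c)`, the triple
`(H_A,H_B,H_C)` is nonzero and each of its pairs is zero or an extremal edge. -/
theorem facet_pairs_extremal_edges (a b c : ℕ)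
    (ha : 1 < a) (hab : a ≤ b) (hbc : b ≤ c) (hcab : c ≤ a * b)
    (HA : Fin a → ℝ) (HB : Fin b → ℝ) (HC : Fin c → ℝ) (z : ℝ)
    (hfacet : IsFacetNormal a b c HA HB HC z)
    (hnt : ¬ IsTrivialNormal HA HB HC z) :
    ¬ (HA = 0 ∧ HB = 0 ∧ HC = 0) ∧
    ((HA = 0 ∧ HB = 0) ∨ ExtremalEdge HA HB) ∧
    ((HA = 0 ∧ HC = 0) ∨ ExtremalEdge HA HC) ∧
    ((HB = 0 ∧ HC = 0) ∨ ExtremalEdge HB HC) := by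
  have hdet := determinedByZeros_of_facet ha hab hbc hcab hfacet hnt
  have ha0 : 0 < a := by omega
  have hb0 : 0 < b := by omega
  have hc0 : 0 < c := by omega
  obtain ⟨⟨hA, hB, hC⟩, hne, -, -⟩ := id hfacet
  have hAB : DeterminedByZeros HA HB fun k => HC k + z := by
    intro x y w h
    obtain ⟨t, ht⟩ := hdet x y w fun i j k h0 => h i j k (by linarith)
    exact ⟨t, fun i j k => by rw [ht]; ring⟩
  have hAC : DeterminedByZeros HA HC fun j => HB j + z := by
    intro x w y h
    obtain ⟨t, ht⟩ := hdet x y w fun i j k h0 => by linarith [h i k j (by linarith)]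
    exact ⟨t, fun i k j => by linarith [ht i j k]⟩
  have hBC : DeterminedByZeros HB HC fun i => HA i + z := by
    intro y w x h
    obtain ⟨t, ht⟩ := hdet x y w fun i j k h0 => by linarith [h j k i (by linarith)]
    exact ⟨t, fun j k i => by linarith [ht i j k]⟩
  refine ⟨?_, ?_, ?_, ?_⟩
  · rintro ⟨rfl, rfl, rfl⟩
    have hz : z ≠ 0 := fun hz => hne ⟨rfl, rfl, rfl, hz⟩
    obtain ⟨t, ht⟩ := hdet (Pi.single ⟨0, ha0⟩ 1) 0 0 fun i j k h0 => absurd h0 (by simpa)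
    have h0 := ht ⟨0, ha0⟩ ⟨0, hb0⟩ ⟨0, hc0⟩
    have h1 := ht ⟨1, ha⟩ ⟨0, hb0⟩ ⟨0, hc0⟩
    simp at h0 h1
    rcases h1 with h1 | h1
    · simp [h1] at h0
    · exact hz h1
  · exact or_iff_not_imp_left.2 fun h => hAB.extremalEdge ha0 hb0 hc0 hA hB h
  · exact or_iff_not_imp_left.2 fun h => hAC.extremalEdge ha0 hc0 hb0 hA hC h
  · exact or_iff_not_imp_left.2 fun h => hBC.extremalEdge hb0 hc0 ha0 hB hC h

end
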